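/- arXiv:1012.1825 — 2 statements merged into one kernel-verified Lean document; each statement's English description precedes it below -/
import Mathlib

section
/- Let p be a prime, K a field of characteristic p, and φ(X) = Σ_{i=d}^{D} c_i X^{p^i} ∈ K[X] a Drinfeld module of special characteristic (1 ≤ d ≤ D, c_d ≠ 0, c_D ≠ 0). Assume φ has positive modular transcendence degree and that Φ[t^∞](K^sep) is finite. Let g ≥ 1, let Γ ⊆ K^g be a finitely generated Φ(R)-submodule that is full in K, and let V be a Zariski-closed subset of affine g-space defined over K such that V(K̄) contains no translate of any infinite Zariski-closed additive subgroup of K̄^g. Then there exist a natural number m and a zero-dimensional Zariski-closed subset W of affine g-space defined over K with W(K̄) ⊆ V(K̄), such that for every fully separable field extension L/K and every γ ∈ Γ one has V(L) ∩ (γ + Φ_{t^m}(L^g)) ⊆ W(L), where Φ_{t^m}(L^g) denotes the image of L^g under the coordinatewise m-fold iterate of x ↦ φ(x). -/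
/-- The `𝔽_p`-linear map `T_φ` induced by the additive polynomial
`φ(X) = Σ_{i=d}^{D} c_i X^{p^i}` of a Drinfeld module of special characteristic. -/
noncomputable def specialTphi {L : Type*} [Field L] (p d D : ℕ) (c : ℕ → L) : L → L :=
  fun x => ∑ i ∈ Finset.Icc d D, c i * x ^ (p ^ i)

/-- For `a ∈ R = 𝔽_p[t]`, written `a = Σ_j a_j t^j`, the induced map
`Φ_a : L → L`, `Φ_a(x) = Σ_j a_j T_φ^{∘j}(x)`. -/
noncomputable def phiAct {L : Type*} [Field L] {p : ℕ} [CharP L p]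
    (Tφ : L → L) (a : Polynomial (ZMod p)) (x : L) : L :=
  ∑ j ∈ Finset.range (a.natDegree + 1),
    (ZMod.castHom (dvd_refl p) L (a.coeff j)) * (Tφ^[j] x)

/-- `Γ` is a `Φ(R)`-submodule of `K^g`: an additive subgroup stable under the
coordinatewise action of `Φ_t = T_φ`. -/
def IsPhiSub {K : Type*} [Field K] (Tφ : K → K) {g : ℕ}
    (Γ : AddSubgroup (Fin g → K)) : Prop :=
  ∀ y ∈ Γ, (fun i => Tφ (y i)) ∈ Γ

/-- `Γ` is a finitely generated `Φ(R)`-submodule of `K^g`: it is the smallest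
`Φ(R)`-submodule containing some finite subset of `K^g`. -/
def IsPhiFG {K : Type*} [Field K] (Tφ : K → K) {g : ℕ}
    (Γ : AddSubgroup (Fin g → K)) : Prop :=
  IsPhiSub Tφ Γ ∧ ∃ s : Finset (Fin g → K), (↑s : Set (Fin g → K)) ⊆ Γ ∧
    ∀ Γ' : AddSubgroup (Fin g → K), IsPhiSub Tφ Γ' → (↑s : Set (Fin g → K)) ⊆ Γ' → Γ ≤ Γ'

/-- `Γ` is full in `K`: any `x ∈ K^g` with `Φ_a(x) ∈ Γ` for some nonzero `a ∈ 𝔽_p[t]`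
already lies in `Γ`. -/
def IsPhiFull {K : Type*} [Field K] (p : ℕ) [CharP K p] (Tφ : K → K) {g : ℕ}
    (Γ : AddSubgroup (Fin g → K)) : Prop :=
  ∀ x : Fin g → K,
    (∃ a : Polynomial (ZMod p), a ≠ 0 ∧ (fun i => phiAct Tφ a (x i)) ∈ Γ) → x ∈ Γ

/-- `x` is algebraic over the prime field `𝔽_p`. -/
def AlgebraicOverPrimeField {K : Type*} [Field K] (p : ℕ) [CharP K p] (x : K) : Prop :=
  ∃ Q : Polynomial (ZMod p), Q ≠ 0 ∧
    Polynomial.eval₂ (ZMod.castHom (dvd_refl p) K) x Q = 0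

/-- `φ = Σ_{i=d}^{D} c_i X^{p^i}` has positive modular transcendence degree: there is no
nonzero `γ` in the algebraic closure of `K` such that every coefficient of `γ⁻¹·φ(γX)`
is algebraic over `𝔽_p`. -/
def PosModularTransc {K : Type*} [Field K] (p : ℕ) [CharP K p] (d D : ℕ) (c : ℕ → K) :
    Prop :=
  ¬ ∃ γ : AlgebraicClosure K, γ ≠ 0 ∧ ∀ j : ℕ,
      AlgebraicOverPrimeField p
        ((Polynomial.C γ⁻¹ *
          ((∑ i ∈ Finset.Icc d D,
            Polynomial.C (algebraMap K (AlgebraicClosure K) (c i)) *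
              Polynomial.X ^ (p ^ i)).comp
            (Polynomial.C γ * Polynomial.X))).coeff j)

/-- `B` is a `p`-basis of `F`: the monomials `∏_{b ∈ S} b^{e_b}` (`S ⊆ B` finite,
`0 ≤ e_b ≤ p − 1`) form a basis of `F` as a vector space over the subfield `F^p` of
`p`-th powers. -/
def IsPBasis (p : ℕ) [Fact p.Prime] (F : Type*) [Field F] [CharP F p] (B : Set F) : Prop :=
  letI Fp : Subfield F := (frobenius F p).fieldRange
  letI fam : {e : ↥B →₀ ℕ // ∀ b, e b < p} → F :=
    fun e => (e : ↥B →₀ ℕ).prod fun b n => (b : F) ^ n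
  LinearIndependent ↥Fp fam ∧ Submodule.span ↥Fp (Set.range fam) = ⊤

/-- `L/K` is fully separable: some `p`-basis of `K` is also a `p`-basis of `L`. -/
def FullySeparable (p : ℕ) [Fact p.Prime] (K L : Type*) [Field K] [Field L] [CharP K p]
    [CharP L p] [Algebra K L] : Prop :=
  ∃ B : Set K, IsPBasis p K B ∧ IsPBasis p L (algebraMap K L '' B)

/-- The zero locus in `M^g` of an ideal of polynomials over `F`, via a ring hom
`F →+* M`. -/
def zeroLocusVia {F M : Type*} [Field F] [CommRing M] {g : ℕ}
    (I : Ideal (MvPolynomial (Fin g) F)) (f : F →+* M) : Set (Fin g → M) :=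
  {x | ∀ q ∈ I, MvPolynomial.eval₂ f x q = 0}

universe u v

/-- The family `b` is linearly independent over the subfield of `p`-th powers. -/
def PIndep {K : Type*} [Field K] (p : ℕ) {ι : Type*} [Fintype ι] (b : ι → K) : Prop :=
  ∀ a : ι → K, ∑ i, b i * a i ^ p = 0 → ∀ i, a i = 0

/-- Families of `K` that are linearly independent over `K^p` remain independent over the `p`-th
powers of elements of `S`. -/
def StaysPIndep (p : ℕ) (K : Type u) [Field K] {X : Type*} [CommRing X] [Algebra K X]
    (S : Set X) : Prop :=
  ∀ (ι : Type u) [Fintype ι] (b : ι → K), PIndep p b →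
    ∀ x : ι → X, (∀ i, x i ∈ S) → ∑ i, algebraMap K X (b i) * x i ^ p = 0 → ∀ i, x i = 0

theorem pIndep_subtype_of_linearIndependent {K : Type*} [Field K] (p : ℕ) [Fact p.Prime]
    [CharP K p] {ι : Type*} {fam : ι → K}
    (h : LinearIndependent (frobenius K p).fieldRange fam) (s : Finset ι) :
    PIndep p (fun e : s => fam e) := by
  intro a ha i
  have hp : p ≠ 0 := (Fact.out : p.Prime).ne_zero
  have h2 := h.comp (fun e : s => (e : ι)) Subtype.val_injective
  rw [Fintype.linearIndependent_iff] at h2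
  have h3 := h2 (fun e => ⟨a e ^ p, ⟨a e, rfl⟩⟩) (by
    rw [← ha]
    refine Finset.sum_congr rfl fun e _ => ?_
    rw [Subfield.smul_def]
    simp [mul_comm]) i
  have h4 : a i ^ p = 0 := congrArg Subtype.val h3
  exact (pow_eq_zero_iff hp).mp h4

theorem exists_expand_of_span {K : Type*} [Field K] (p : ℕ) [Fact p.Prime]
    [CharP K p] {ι : Type*} {fam : ι → K}
    (h : Submodule.span (frobenius K p).fieldRange (Set.range fam) = ⊤)
    {κ : Type*} [Fintype κ] (c : κ → K) :
    ∃ (s : Finset ι) (a : κ → s → K), ∀ i, c i = ∑ e : s, fam e * a i e ^ p := by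
  classical
  have hmem : ∀ i, ∃ l : ι →₀ (frobenius K p).fieldRange,
      Finsupp.linearCombination _ fam l = c i := by
    intro i
    have : c i ∈ Submodule.span (frobenius K p).fieldRange (Set.range fam) := by
      rw [h]; trivial
    exact (Finsupp.mem_span_range_iff_exists_finsupp).mp this
  choose l hl using hmem
  have hroot : ∀ i e, ∃ y : K, y ^ p = (l i e : K) := fun i e => by
    obtain ⟨y, hy⟩ := (l i e).2
    exact ⟨y, hy⟩
  choose r hr using hroot
  refine ⟨Finset.univ.biUnion fun i => (l i).support, fun i e => r i e, fun i => ?_⟩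
  rw [← hl i, Finsupp.linearCombination_apply, Finsupp.sum_of_support_subset
    (s := Finset.univ.biUnion fun i => (l i).support)]
  · rw [← Finset.sum_coe_sort]
    refine Finset.sum_congr rfl fun e _ => ?_
    rw [hr, Subfield.smul_def, smul_eq_mul, mul_comm]
  · intro e he
    exact Finset.mem_biUnion.mpr ⟨i, Finset.mem_univ _, he⟩
  · simp

theorem exists_pIndep_expand {K : Type u} [Field K] (p : ℕ) [Fact p.Prime] [CharP K p]
    {κ : Type*} [Fintype κ] (c : κ → K) :
    ∃ (ι : Type u) (_ : Fintype ι) (b : ι → K) (a : κ → ι → K), PIndep p b ∧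
      ∀ i, c i = ∑ e, b e * a i e ^ p := by
  let B := Module.Basis.ofVectorSpace (frobenius K p).fieldRange K
  obtain ⟨s, a, h⟩ := exists_expand_of_span p B.span_eq c
  exact ⟨s, inferInstance, fun e => B e, a,
    pIndep_subtype_of_linearIndependent p B.linearIndependent s, h⟩

theorem eq_zero_of_smul_system {K X : Type*} [Field K] [AddCommGroup X] [Module K X]
    {ι κ : Type*} [Fintype ι] (c : ι → κ → K)
    (h : ∀ a : ι → K, (∀ e, ∑ i, c i e * a i = 0) → ∀ i, a i = 0) (x : ι → X)
    (hx : ∀ e, ∑ i, c i e • x i = 0) (i : ι) : x i = 0 := by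
  rw [← Module.forall_dual_apply_eq_zero_iff K]
  intro f
  refine h (fun i => f (x i)) (fun e => ?_) i
  have := congrArg f (hx e)
  simpa using this

theorem FullySeparable.staysPIndep {K : Type u} {L : Type v} [Field K] [Field L] (p : ℕ)
    [Fact p.Prime] [CharP K p] [CharP L p] [Algebra K L] (h : FullySeparable p K L) :
    StaysPIndep p K (Set.univ : Set L) := by
  obtain ⟨B, hK, hL⟩ := h
  intro ι _ b hb x _ hx
  have hp : p ≠ 0 := (Fact.out : p.Prime).ne_zero
  obtain ⟨hK1, hK2⟩ := hK
  obtain ⟨hL1, -⟩ := hL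
  obtain ⟨s, a, ha⟩ := exists_expand_of_span p hK2 b
  let j : B ≃ (algebraMap K L '' B : Set L) :=
    Equiv.Set.image _ B (algebraMap K L).injective
  let jj : {e : B →₀ ℕ // ∀ b, e b < p} →
      {e : (algebraMap K L '' B : Set L) →₀ ℕ // ∀ b, e b < p} :=
    fun e => ⟨e.1.equivMapDomain j, fun b => by
      simpa [Finsupp.equivMapDomain_apply] using e.2 _⟩
  have hjj : Function.Injective jj := by
    intro e e' hee
    have h1 : e.1.equivMapDomain j = e'.1.equivMapDomain j := congrArg Subtype.val hee
    apply Subtype.ext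
    ext t
    have := DFunLike.congr_fun h1 (j t)
    simpa [Finsupp.equivMapDomain_apply] using this
  have hL2 := pIndep_subtype_of_linearIndependent p (hL1.comp jj hjj) s
  have hfam : ∀ e : {e : B →₀ ℕ // ∀ b, e b < p},
      ((jj e : (algebraMap K L '' B : Set L) →₀ ℕ).prod fun b n => (b : L) ^ n) =
        algebraMap K L ((e : B →₀ ℕ).prod fun b n => (b : K) ^ n) := by
    intro e
    change ((e.1.equivMapDomain j).prod fun b n => (b : L) ^ n) = _
    rw [Finsupp.prod_equivMapDomain, Finsupp.prod, Finsupp.prod, map_prod]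
    refine Finset.prod_congr rfl fun t _ => ?_
    simp [j]
  refine eq_zero_of_smul_system (fun i e => a i e) ?_ x ?_
  · intro y hy
    refine hb y ?_
    have : ∀ i, b i * y i ^ p = ∑ e : s, ((e : {e : B →₀ ℕ // ∀ b, e b < p}) : B →₀ ℕ).prod
        (fun b n => (b : K) ^ n) * (a i e * y i) ^ p := by
      intro i
      rw [ha i, Finset.sum_mul]
      exact Finset.sum_congr rfl fun e _ => by ring
    simp_rw [this]
    rw [Finset.sum_comm]
    refine Finset.sum_eq_zero fun e _ => ?_
    rw [← Finset.mul_sum, ← sum_pow_char, hy e, zero_pow hp, mul_zero]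
  · refine hL2 _ ?_
    rw [← hx]
    have : ∀ i, algebraMap K L (b i) * x i ^ p = ∑ e : s,
        algebraMap K L (((e : {e : B →₀ ℕ // ∀ b, e b < p}) : B →₀ ℕ).prod
        (fun b n => (b : K) ^ n)) * (a i e • x i) ^ p := by
      intro i
      rw [ha i, map_sum, Finset.sum_mul]
      refine Finset.sum_congr rfl fun e _ => ?_
      rw [map_mul, map_pow, Algebra.smul_def]; ring
    simp_rw [this]
    rw [Finset.sum_comm]
    refine Finset.sum_congr rfl fun e _ => ?_
    rw [← Finset.mul_sum, ← sum_pow_char]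
    congr 1
    exact hfam e

theorem exists_pIndep_expand_of_isSeparable {K : Type u} [Field K] (p : ℕ) [Fact p.Prime]
    [CharP K p] {F : Type*} [Field F] [Algebra K F] [Algebra.IsSeparable K F]
    {κ : Type*} [Fintype κ] (c : κ → F) :
    ∃ (ι : Type u) (_ : Fintype ι) (b : ι → K) (a : κ → ι → F), PIndep p b ∧
      ∀ i, c i = ∑ e, algebraMap K F (b e) * a i e ^ p := by
  classical
  have hspan : Submodule.span K (Set.range fun x : F => x ^ p ^ 1) = ⊤ :=
    Field.span_map_pow_expChar_pow_eq_top_of_isSeparable (F := K) (E := F) (v := fun x : F => x) p 1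
      (by simp)
  have : CharP F p := charP_of_injective_algebraMap (algebraMap K F).injective p
  have hmem : ∀ i, ∃ l : F →₀ K, Finsupp.linearCombination _ (fun x : F => x ^ p ^ 1) l = c i := by
    intro i
    have : c i ∈ Submodule.span K (Set.range fun x : F => x ^ p ^ 1) := by
      rw [hspan]; trivial
    exact (Finsupp.mem_span_range_iff_exists_finsupp).mp this
  choose l hl using hmem
  let s : Finset F := Finset.univ.biUnion fun i => (l i).support
  obtain ⟨ι, _, b, a, hb, ha⟩ := exists_pIndep_expand p (fun t : κ × s => l t.1 t.2)
  refine ⟨ι, inferInstance, b, fun i e => ∑ t : s, algebraMap K F (a (i, t) e) * t, hb, fun i => ?_⟩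
  rw [← hl i, Finsupp.linearCombination_apply, Finsupp.sum_of_support_subset (s := s)]
  · rw [← Finset.sum_coe_sort]
    have h1 : ∀ t : s, l i t • (t : F) ^ p ^ 1 =
        ∑ e, algebraMap K F (b e) * (algebraMap K F (a (i, t) e) * t) ^ p := by
      intro t
      rw [ha (i, t), Algebra.smul_def, map_sum, Finset.sum_mul]
      refine Finset.sum_congr rfl fun e _ => ?_
      rw [map_mul, map_pow]; ring
    simp_rw [h1]
    rw [Finset.sum_comm]
    refine Finset.sum_congr rfl fun e _ => ?_
    rw [← Finset.mul_sum, ← sum_pow_char]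
  · intro e he
    exact Finset.mem_biUnion.mpr ⟨i, Finset.mem_univ _, he⟩
  · simp

theorem StaysPIndep.linearIndependent_pow {K : Type u} [Field K] {p : ℕ} [Fact p.Prime]
    [CharP K p] {X : Type*} [CommRing X] [CharP X p] [Algebra K X] {F : Type*} [Field F]
    [Algebra K F] [Algebra.IsSeparable K F] [Algebra F X] [IsScalarTower K F X]
    {S : Subalgebra F X} (h : StaysPIndep p K (X := X) S) {ι : Type*} {w : ι → X}
    (hS : ∀ i, w i ∈ S) (hw : LinearIndependent F w) :
    LinearIndependent F (fun i => w i ^ p) := by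
  have : CharP F p := charP_of_injective_algebraMap (algebraMap K F).injective p
  have hp : p ≠ 0 := (Fact.out : p.Prime).ne_zero
  rw [linearIndependent_iff_finset_linearIndependent] at hw ⊢
  intro s
  have hws := hw s
  rw [Fintype.linearIndependent_iff] at hws ⊢
  intro c hc i
  obtain ⟨κ, _, b, a, hb, ha⟩ := exists_pIndep_expand_of_isSeparable (K := K) p c
  have h1 : ∀ e, ∑ i : s, a i e • w i = 0 := by
    refine h κ b hb _ (fun e => S.sum_mem fun i _ => S.smul_mem (hS i) _) ?_
    rw [← hc]
    have h2 : ∀ i, c i • (((fun i => w i ^ p) ∘ Subtype.val) i : X) =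
        ∑ e, algebraMap K X (b e) * (a i e • w i) ^ p := by
      intro i
      rw [ha i, Finset.sum_smul]
      refine Finset.sum_congr rfl fun e _ => ?_
      rw [Algebra.smul_def, map_mul, map_pow, Algebra.smul_def, mul_pow,
        ← IsScalarTower.algebraMap_apply K F X, mul_assoc]
      rfl
    simp_rw [h2]
    rw [Finset.sum_comm]
    exact Finset.sum_congr rfl fun e _ => by rw [← Finset.mul_sum, ← sum_pow_char]
  rw [ha i]
  refine Finset.sum_eq_zero fun e _ => ?_
  rw [hws (fun i => a i e) (h1 e) i, zero_pow hp, mul_zero]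

theorem StaysPIndep.linearIndependent_pow_pow {K : Type u} [Field K] {p : ℕ} [Fact p.Prime]
    [CharP K p] {X : Type*} [CommRing X] [CharP X p] [Algebra K X] {F : Type*} [Field F]
    [Algebra K F] [Algebra.IsSeparable K F] [Algebra F X] [IsScalarTower K F X]
    {S : Subalgebra F X} (h : StaysPIndep p K (X := X) S) {ι : Type*} {w : ι → X}
    (hS : ∀ i, w i ∈ S) (hw : LinearIndependent F w) (n : ℕ) :
    LinearIndependent F (fun i => w i ^ p ^ n) := by
  induction n with
  | zero => simpa using hw
  | succ n ih =>
    have := h.linearIndependent_pow (fun i => S.pow_mem (hS i) (p ^ n)) ih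
    simpa [pow_succ, pow_mul] using this

/-- Linear disjointness of `S` from a purely inseparable extension of `F`. -/
theorem StaysPIndep.linearIndependent_of_isPurelyInseparable {K : Type u} [Field K] {p : ℕ}
    [Fact p.Prime] [CharP K p] {X : Type*} [CommRing X] [CharP X p] [Algebra K X]
    {F : Type*} [Field F]
    [Algebra K F] [Algebra.IsSeparable K F] [Algebra F X] [IsScalarTower K F X]
    {k : Type*} [Field k] [Algebra F k] [Algebra k X] [IsScalarTower F k X]
    [IsPurelyInseparable F k]
    {S : Subalgebra F X} (h : StaysPIndep p K (X := X) S) {ι : Type*} {w : ι → X}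
    (hS : ∀ i, w i ∈ S) (hw : LinearIndependent F w) :
    LinearIndependent k w := by
  have : CharP F p := charP_of_injective_algebraMap (algebraMap K F).injective p
  have hp : p ≠ 0 := (Fact.out : p.Prime).ne_zero
  rw [linearIndependent_iff_finset_linearIndependent] at hw ⊢
  intro s
  have hws := hw s
  rw [Fintype.linearIndependent_iff]
  intro c hc i
  have h0 : ∀ i, ∃ n, c i ^ p ^ n ∈ (algebraMap F k).range := fun i =>
    IsPurelyInseparable.pow_mem F p (c i)
  choose n hn using h0
  let N := Finset.univ.sup n
  have h1 : ∀ i, ∃ y : F, algebraMap F k y = c i ^ p ^ N := by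
    intro i
    have hle : n i ≤ N := Finset.le_sup (Finset.mem_univ i)
    obtain ⟨y, hy⟩ := hn i
    refine ⟨y ^ p ^ (N - n i), ?_⟩
    rw [map_pow, hy, ← pow_mul, ← pow_add, Nat.add_sub_cancel' hle]
  choose y hy using h1
  have h2 := h.linearIndependent_pow_pow (fun i : s => hS i) hws N
  rw [Fintype.linearIndependent_iff] at h2
  have h3 := h2 y (by
    have h4 : (∑ i, c i • (w ∘ Subtype.val) i) ^ p ^ N = 0 := by
      rw [hc, zero_pow (pow_ne_zero _ hp)]
    rw [sum_pow_char_pow] at h4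
    rw [← h4]
    refine Finset.sum_congr rfl fun i _ => ?_
    simp only [Algebra.smul_def, mul_pow, Function.comp]
    rw [IsScalarTower.algebraMap_apply F k X, hy, map_pow]) i
  have h5 : c i ^ p ^ N = 0 := by rw [← hy, h3, map_zero]
  exact (pow_eq_zero_iff (pow_ne_zero _ hp)).mp h5

/-- Dual form of linear disjointness: families of `k` independent over `F` stay independent
over `S`. -/
theorem eq_zero_of_linearDisjoint {F k X : Type*} [Field F] [Field k] [CommRing X] [Algebra F k]
    [Algebra F X] [Algebra k X] [IsScalarTower F k X] {S : Subalgebra F X}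
    (h : ∀ {ι : Type} [Fintype ι] (w : ι → X), (∀ i, w i ∈ S) → LinearIndependent F w →
      LinearIndependent k w) {κ : Type*} [Fintype κ] {β : κ → k} (hβ : LinearIndependent F β)
    (x : κ → X) (hx : ∀ i, x i ∈ S) (h0 : ∑ i, β i • x i = 0) (i : κ) : x i = 0 := by
  let W := Submodule.span F (Set.range x)
  have : FiniteDimensional F W := FiniteDimensional.span_of_finite F (Set.finite_range x)
  let B := Module.finBasis F W
  have hW : W ≤ Subalgebra.toSubmodule S := Submodule.span_le.mpr (by rintro _ ⟨i, rfl⟩; exact hx i)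
  have hk := h (fun j => (B j : X)) (fun j => hW (B j).2)
    (B.linearIndependent.map' W.subtype (Submodule.ker_subtype W))
  have hxW : ∀ i, x i ∈ W := fun i => Submodule.subset_span ⟨i, rfl⟩
  have hexp : ∀ i, x i = ∑ j, B.repr ⟨x i, hxW i⟩ j • (B j : X) := by
    intro i
    have := congrArg W.subtype (B.sum_repr ⟨x i, hxW i⟩)
    rw [map_sum] at this
    exact this.symm
  rw [Fintype.linearIndependent_iff] at hk hβ
  have h1 := hk (fun j => ∑ i, B.repr ⟨x i, hxW i⟩ j • β i) (by
    rw [← h0]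
    simp_rw [Finset.sum_smul]
    rw [Finset.sum_comm]
    refine Finset.sum_congr rfl fun i _ => ?_
    conv_rhs => rw [hexp i, Finset.smul_sum]
    refine Finset.sum_congr rfl fun j _ => ?_
    rw [smul_assoc, smul_comm])
  rw [hexp i]
  exact Finset.sum_eq_zero fun j _ => by rw [hβ _ (h1 j) i, zero_smul]

/-- The relative version of `StaysPIndep` for the quotient by an ideal. -/
def StaysPIndepMod (p : ℕ) (K : Type u) [Field K] {A : Type*} [CommRing A] [Algebra K A]
    (Q : Ideal A) : Prop :=
  ∀ (ι : Type u) [Fintype ι] (b : ι → K), PIndep p b →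
    ∀ x : ι → A, ∑ i, algebraMap K A (b i) * x i ^ p ∈ Q → ∀ i, x i ∈ Q

theorem exists_notMem_mul_mem_of_mem_minimalPrimes {A : Type*} [CommRing A] {Q P : Ideal A}
    (hrad : Q.IsRadical) (hP : P ∈ Q.minimalPrimes) {f : A} (hf : f ∈ P) :
    ∃ h ∉ P, f * h ∈ Q := by
  have hPp := hP.1.1
  by_contra! hcon
  have hdisj : Disjoint (Q : Set A) (P.primeCompl ⊔ Submonoid.powers f : Submonoid A) := by
    rw [Set.disjoint_right]
    intro a ha haQ
    obtain ⟨h, hh, _, ⟨n, rfl⟩, rfl⟩ := Submonoid.mem_sup.mp ha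
    refine hcon h hh (hrad ⟨n + 1, ?_⟩)
    have := Q.mul_mem_left (h ^ n * f) haQ
    convert this using 1
    ring
  obtain ⟨P', hP', hQP', hd⟩ := Ideal.exists_le_prime_disjoint Q _ hdisj
  rw [Set.disjoint_right] at hd
  have hle : P' ≤ P := by
    intro a ha
    by_contra h
    exact hd (Submonoid.mem_sup_left (T := Submonoid.powers f) (S := P.primeCompl) h) ha
  exact hd (Submonoid.mem_sup_right (Submonoid.mem_powers f)) (hP.2 ⟨hP', hQP'⟩ hle hf)

theorem StaysPIndepMod.of_mem_minimalPrimes {p : ℕ} [Fact p.Prime] {K : Type u} [Field K]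
    {A : Type*} [CommRing A] [Algebra K A] {Q P : Ideal A}
    (hQ : StaysPIndepMod p K Q) (hrad : Q.IsRadical) (hP : P ∈ Q.minimalPrimes) :
    StaysPIndepMod p K P := by
  intro ι _ b hb x hx i
  have hp : p ≠ 0 := (Fact.out : p.Prime).ne_zero
  have hPp := hP.1.1
  obtain ⟨h, hh, h1⟩ := exists_notMem_mul_mem_of_mem_minimalPrimes hrad hP hx
  have h2 : ∑ i, algebraMap K A (b i) * (h * x i) ^ p ∈ Q := by
    have h3 : ∑ i, algebraMap K A (b i) * (h * x i) ^ p =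
        h ^ (p - 1) * ((∑ i, algebraMap K A (b i) * x i ^ p) * h) := by
      rw [Finset.sum_mul, Finset.mul_sum]
      refine Finset.sum_congr rfl fun i _ => ?_
      obtain ⟨q, rfl⟩ := Nat.exists_eq_succ_of_ne_zero hp
      simp only [Nat.succ_eq_add_one, Nat.add_sub_cancel]
      ring
    rw [h3]
    exact Q.mul_mem_left _ h1
  have h4 := hP.1.2 (hQ ι b hb _ h2 i)
  exact (hPp.mem_or_mem h4).resolve_left hh

theorem StaysPIndepMod.staysPIndep_range {p : ℕ} {K : Type u} [Field K]
    {A X : Type*} [CommRing A] [Algebra K A] [CommRing X] [Algebra K X] (f : A →ₐ[K] X)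
    (h : StaysPIndepMod p K (RingHom.ker f)) :
    StaysPIndep p K (Set.range f) := by
  intro ι _ b hb x hx h0 i
  choose y hy using hx
  rw [← hy i]
  refine h ι b hb y ?_ i
  rw [RingHom.mem_ker, ← h0]
  simp [hy]

theorem StaysPIndep.adjoin {p : ℕ} [Fact p.Prime] {K : Type u} [Field K] {X : Type*} [Field X]
    [Algebra K X] {s : Set X} (h : StaysPIndep p K (X := X) (Algebra.adjoin K s)) :
    StaysPIndep p K (X := X) (IntermediateField.adjoin K s) := by
  classical
  intro ι _ b hb x hx h0 i
  have hx' : ∀ i, ∃ r ∈ Algebra.adjoin K s, ∃ t ∈ Algebra.adjoin K s, t ≠ 0 ∧ x i * t = r := by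
    intro i
    obtain ⟨r, hr, t, ht, e⟩ := IntermediateField.mem_adjoin_iff_div.mp (hx i)
    by_cases h : t = 0
    · exact ⟨0, zero_mem _, 1, one_mem _, one_ne_zero, by simp [e, h]⟩
    · exact ⟨r, hr, t, ht, h, by rw [e, div_mul_cancel₀ _ h]⟩
  choose r hr t ht ht0 e using hx'
  let T := ∏ i, t i
  have hT : T ≠ 0 := Finset.prod_ne_zero_iff.mpr fun i _ => ht0 i
  have h1 := h ι b hb (fun i => x i * T) (fun i => by
    have : x i * T = r i * ∏ j ∈ Finset.univ.erase i, t j := by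
      rw [← e i, mul_assoc, Finset.mul_prod_erase _ _ (Finset.mem_univ i)]
    change x i * T ∈ Algebra.adjoin K s
    rw [this]
    exact mul_mem (hr i) (prod_mem fun j _ => ht j)) (by
    have : ∑ i, algebraMap K X (b i) * (x i * T) ^ p =
        (∑ i, algebraMap K X (b i) * x i ^ p) * T ^ p := by
      rw [Finset.sum_mul]
      exact Finset.sum_congr rfl fun i _ => by ring
    rw [this, h0, zero_mul]) i
  exact (mul_eq_zero.mp h1).resolve_right hT

theorem StaysPIndep.separable {p : ℕ} [Fact p.Prime] {K : Type u} [Field K] [CharP K p] {X : Type*}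
    [Field X] [Algebra K X] {E : Type*} [Field E] [Algebra K E] [Algebra E X] [IsScalarTower K E X]
    (h : StaysPIndep p K (Set.range (algebraMap E X))) :
    StaysPIndep p K {x : X | IsSeparable E x} := by
  have : CharP X p := charP_of_injective_algebraMap (algebraMap K X).injective p
  have : CharP E p := charP_of_injective_algebraMap (algebraMap K E).injective p
  intro ι _ b hb x hx h0 i
  let W := Submodule.span E (Set.range x)
  have : FiniteDimensional E W := FiniteDimensional.span_of_finite E (Set.finite_range x)
  let B := Module.finBasis E W
  have hW : W ≤ Subalgebra.toSubmodule (separableClosure E X).toSubalgebra :=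
    Submodule.span_le.mpr (by
      rintro _ ⟨i, rfl⟩
      exact mem_separableClosure_iff.mpr (hx i))
  have hk := LinearIndependent.map_pow_expChar_pow_of_isSeparable' (F := E) (E := X) p 1
    (v := fun j => (B j : X)) (fun j => mem_separableClosure_iff.mp (hW (B j).2))
    (B.linearIndependent.map' W.subtype (Submodule.ker_subtype W))
  have hxW : ∀ i, x i ∈ W := fun i => Submodule.subset_span ⟨i, rfl⟩
  have hexp : ∀ i, x i = ∑ j, B.repr ⟨x i, hxW i⟩ j • (B j : X) := by
    intro i
    have := congrArg W.subtype (B.sum_repr ⟨x i, hxW i⟩)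
    rw [map_sum] at this
    exact this.symm
  rw [Fintype.linearIndependent_iff] at hk
  have h1 := hk (fun j => ∑ i, algebraMap K E (b i) * B.repr ⟨x i, hxW i⟩ j ^ p) (by
    rw [← h0]
    simp_rw [Finset.sum_smul]
    rw [Finset.sum_comm]
    refine Finset.sum_congr rfl fun i _ => ?_
    conv_rhs => rw [hexp i, sum_pow_char, Finset.mul_sum]
    refine Finset.sum_congr rfl fun j _ => ?_
    rw [pow_one, Algebra.smul_def, Algebra.smul_def, mul_pow, map_mul, map_pow, mul_assoc,
      ← IsScalarTower.algebraMap_apply])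
  rw [hexp i]
  refine Finset.sum_eq_zero fun j _ => ?_
  have h2 := h ι b hb (fun i => algebraMap E X (B.repr ⟨x i, hxW i⟩ j)) (fun i => ⟨_, rfl⟩) (by
    have := congrArg (algebraMap E X) (h1 j)
    simpa [← IsScalarTower.algebraMap_apply] using this) i
  have h3 : B.repr ⟨x i, hxW i⟩ j = 0 := (map_eq_zero _).mp h2
  rw [h3, zero_smul]

/-- The elements of `X` separable over `E`, as an algebra over a separable extension of `K`. -/
def separableOver {K X : Type*} [Field K] [Field X] [Algebra K X] (E : IntermediateField K X)
    (F : Type*) [Field F] [Algebra K F] [Algebra.IsSeparable K F] [Algebra F X]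
    [IsScalarTower K F X] : Subalgebra F X where
  carrier := {x : X | IsSeparable E x}
  mul_mem' {a b} ha hb := by
    have := mul_mem (mem_separableClosure_iff.mpr ha) (mem_separableClosure_iff.mpr hb)
    exact mem_separableClosure_iff.mp this
  add_mem' {a b} ha hb := by
    have := add_mem (mem_separableClosure_iff.mpr ha) (mem_separableClosure_iff.mpr hb)
    exact mem_separableClosure_iff.mp this
  algebraMap_mem' r := by
    have h := Algebra.IsSeparable.isSeparable K r
    have h2 : IsSeparable K (algebraMap F X r) := by
      have := (IsScalarTower.toAlgHom K F X)
      unfold IsSeparable at h ⊢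
      rw [show algebraMap F X r = IsScalarTower.toAlgHom K F X r from rfl,
        minpoly.algHom_eq _ (algebraMap F X).injective]
      exact h
    exact IsSeparable.tower_top E h2

open scoped TensorProduct

theorem MvPolynomial.exists_eq_sum_C_mul_map {F k σ : Type*} [Field F] [Field k] [Algebra F k]
    (f : MvPolynomial σ k) :
    ∃ (n : ℕ) (β : Fin n → k) (f' : Fin n → MvPolynomial σ F), LinearIndependent F β ∧
      f = ∑ j, MvPolynomial.C (β j) * MvPolynomial.map (algebraMap F k) (f' j) := by
  classical
  let W := Submodule.span F ((fun m => f.coeff m) '' (f.support : Set (σ →₀ ℕ)))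
  have : FiniteDimensional F W :=
    FiniteDimensional.span_of_finite F (f.support.finite_toSet.image _)
  let B := Module.finBasis F W
  have hW : ∀ m ∈ f.support, f.coeff m ∈ W := fun m hm => Submodule.subset_span ⟨m, hm, rfl⟩
  refine ⟨_, fun j => (B j : k), fun j => ∑ m : f.support,
    MvPolynomial.monomial (m : σ →₀ ℕ) (B.repr ⟨f.coeff m, hW m m.2⟩ j),
    B.linearIndependent.map' W.subtype (Submodule.ker_subtype W), ?_⟩
  have hexp : ∀ m : f.support, f.coeff m = ∑ j, (B j : k) *
      algebraMap F k (B.repr ⟨f.coeff m, hW m m.2⟩ j) := by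
    intro m
    have := congrArg W.subtype (B.sum_repr ⟨f.coeff m, hW m m.2⟩)
    rw [map_sum] at this
    refine (show _ = f.coeff m from this).symm.trans ?_
    refine Finset.sum_congr rfl fun j _ => ?_
    rw [map_smul, Algebra.smul_def, mul_comm]; rfl
  conv_lhs => rw [f.as_sum, ← Finset.sum_coe_sort]
  simp_rw [map_sum, MvPolynomial.map_monomial, Finset.mul_sum, MvPolynomial.C_mul_monomial]
  rw [Finset.sum_comm]
  refine Finset.sum_congr rfl fun m _ => ?_
  rw [← map_sum, ← hexp]

theorem injective_productMap_of_linearDisjoint {F k X : Type*} [Field F] [Field k] [CommRing X]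
    [Algebra F k] [Algebra F X] [Algebra k X] [IsScalarTower F k X] {S : Subalgebra F X}
    (h : ∀ {ι : Type} [Fintype ι] (w : ι → X), (∀ i, w i ∈ S) → LinearIndependent F w →
      LinearIndependent k w) :
    Function.Injective (Algebra.TensorProduct.productMap S.val (IsScalarTower.toAlgHom F k X)) := by
  classical
  rw [injective_iff_map_eq_zero]
  intro t ht
  let B := Module.Basis.ofVectorSpace F k
  obtain ⟨l, rfl⟩ := (TensorProduct.equivFinsuppOfBasisRight (M := S) B).symm.surjective t
  rw [TensorProduct.equivFinsuppOfBasisRight_symm_apply, Finsupp.sum, map_sum,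
    ← Finset.sum_coe_sort] at ht
  have h1 := eq_zero_of_linearDisjoint (S := S) h (κ := l.support) (β := fun i => B i)
    (B.linearIndependent.comp _ Subtype.val_injective) (fun i => (l i : X))
    (fun i => SetLike.coe_mem _) (by
      rw [← ht]
      refine Finset.sum_congr rfl fun i _ => ?_
      rw [Algebra.TensorProduct.productMap_apply_tmul, Algebra.smul_def, mul_comm]; rfl)
  have : l = 0 := by
    ext i
    by_cases hi : i ∈ l.support
    · exact h1 ⟨i, hi⟩
    · rw [Finsupp.notMem_support_iff.mp hi]; rfl
  rw [this, map_zero]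

theorem aeval_tmul_add_tmul_eq_zero {F k X : Type*} [Field F] [Field k] [CommRing X]
    [Algebra F k] [Algebra F X] [Algebra k X] [IsScalarTower F k X] {S : Subalgebra F X}
    (h : ∀ {ι : Type} [Fintype ι] (w : ι → X), (∀ i, w i ∈ S) → LinearIndependent F w →
      LinearIndependent k w) {τ : Type*} (z : τ → X) (hz : ∀ i, z i ∈ S) (s : τ → k)
    (hs : ∀ f : MvPolynomial τ k, MvPolynomial.aeval z f = 0 →
      MvPolynomial.aeval (fun i => z i + algebraMap k X (s i)) f = 0)
    (f : MvPolynomial τ k) (hf : MvPolynomial.aeval z f = 0) :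
    MvPolynomial.eval₂ ((Algebra.TensorProduct.includeLeft : X →ₐ[F] X ⊗[F] k).toRingHom.comp
      (algebraMap k X)) (fun i => z i ⊗ₜ[F] 1 + 1 ⊗ₜ[F] s i) f = 0 := by
  obtain ⟨n, β, f', hβ, rfl⟩ := MvPolynomial.exists_eq_sum_C_mul_map (F := F) f
  have h1 : ∀ j, MvPolynomial.aeval z (f' j) = 0 := by
    refine eq_zero_of_linearDisjoint (S := S) h hβ _ (fun j => ?_) ?_
    · have : z = fun i => S.val (⟨z i, hz i⟩ : S) := rfl
      rw [this, ← MvPolynomial.comp_aeval_apply]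
      exact SetLike.coe_mem _
    · rw [← hf, map_sum]
      refine Finset.sum_congr rfl fun j _ => ?_
      rw [map_mul, MvPolynomial.aeval_C, MvPolynomial.aeval_map_algebraMap, Algebra.smul_def]
  have h2 : ∀ j, MvPolynomial.aeval (fun i => z i + algebraMap k X (s i)) (f' j) = 0 := by
    intro j
    have := hs (MvPolynomial.map (algebraMap F k) (f' j)) (by
      rw [MvPolynomial.aeval_map_algebraMap, h1])
    rwa [MvPolynomial.aeval_map_algebraMap] at this
  have h3 : ∀ j, MvPolynomial.aeval
      (fun i => ((⟨z i, hz i⟩ : S) ⊗ₜ[F] (1 : k) + 1 ⊗ₜ[F] s i)) (f' j) = 0 := by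
    intro j
    apply injective_productMap_of_linearDisjoint h
    rw [map_zero, MvPolynomial.comp_aeval_apply, ← h2 j]
    congr 2
    ext i
    simp
  have h4 : ∀ j, MvPolynomial.aeval
      (fun i => (z i ⊗ₜ[F] (1 : k) + 1 ⊗ₜ[F] s i)) (f' j) = 0 := by
    intro j
    have := congrArg (Algebra.TensorProduct.map S.val (AlgHom.id F k)) (h3 j)
    rw [map_zero, MvPolynomial.comp_aeval_apply] at this
    rw [← this]
    rfl
  rw [← MvPolynomial.coe_eval₂Hom, map_sum]
  refine Finset.sum_eq_zero fun j _ => ?_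
  rw [map_mul, MvPolynomial.coe_eval₂Hom, MvPolynomial.eval₂_map]
  convert mul_zero _
  rw [← h4 j, MvPolynomial.aeval_def]
  congr 1
  ext r
  simp [← IsScalarTower.algebraMap_apply]

theorem linearIndependent_of_separableOver {K : Type u} [Field K] {p : ℕ} [Fact p.Prime] [CharP K p]
    {X : Type*} [Field X] [Algebra K X] {τ : Type*} (z : τ → X)
    (h : StaysPIndepMod p K (RingHom.ker (MvPolynomial.aeval z : MvPolynomial τ K →ₐ[K] X)))
    (F : Type*) [Field F] [Algebra K F] [Algebra.IsSeparable K F] [Algebra F X]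
    [IsScalarTower K F X]
    (k : Type*) [Field k] [Algebra F k] [Algebra k X] [IsScalarTower F k X]
    [IsPurelyInseparable F k] {ι : Type*} {w : ι → X}
    (hS : ∀ i, w i ∈ separableOver (IntermediateField.adjoin K (Set.range z)) F)
    (hw : LinearIndependent F w) : LinearIndependent k w := by
  have : CharP X p := charP_of_injective_algebraMap (algebraMap K X).injective p
  have h1 := h.staysPIndep_range
  have h2 : StaysPIndep p K (X := X) (Algebra.adjoin K (Set.range z)) := by
    rw [Algebra.adjoin_range_eq_range_aeval]
    exact h1
  have h3 := h2.adjoin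
  have h4 := StaysPIndep.separable (E := IntermediateField.adjoin K (Set.range z)) (p := p)
    (by convert h3; ext; simp)
  exact StaysPIndep.linearIndependent_of_isPurelyInseparable
    (S := separableOver (IntermediateField.adjoin K (Set.range z)) F) h4 hS hw

/-- A uniform bound for the nilpotency order of infinitesimal translations preserving the ideal
of polynomial relations of `z`. -/
def NilBound {k X : Type u} [Field k] [Field X] [Algebra k X] {g : ℕ} (N : ℕ) (z : Fin g → X) :
    Prop :=
  ∀ (A C : Type u) [CommRing A] [CommRing C] (α : X →+* C) (β : A →+* C) (ι : k →+* A),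
    (∀ a, α (algebraMap k X a) = β (ι a)) →
    (∀ l : X →ₗ[k] k, ∃ e : C →+ A, ∀ x a, e (α x * β a) = ι (l x) * a) →
    ∀ η : Fin g → A, (∀ i, IsNilpotent (η i)) →
      (∀ f : MvPolynomial (Fin g) k, MvPolynomial.aeval z f = 0 →
        MvPolynomial.eval₂ (β.comp ι) (fun i => α (z i) + β (η i)) f = 0) →
      ∀ i, η i ^ N = 0

/-- The polynomial `f(z + X)` with a functional applied to its coefficients. -/
noncomputable def shiftCoord {k X : Type*} [Field k] [Field X] [Algebra k X] {g : ℕ}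
    (z : Fin g → X) (l : X →ₗ[k] k) (f : MvPolynomial (Fin g) k) : MvPolynomial (Fin g) k :=
  ∑ m ∈ (MvPolynomial.aeval (R := k) (fun i => MvPolynomial.C (z i) + MvPolynomial.X i) f :
      MvPolynomial (Fin g) X).support,
    MvPolynomial.monomial m (l ((MvPolynomial.aeval (R := k)
      (fun i => MvPolynomial.C (z i) + MvPolynomial.X i) f : MvPolynomial (Fin g) X).coeff m))

theorem eval₂_shiftCoord {k X : Type*} [Field k] [Field X] [Algebra k X] {g : ℕ}
    (z : Fin g → X) (l : X →ₗ[k] k) {A C : Type*} [CommRing A] [CommRing C] (α : X →+* C)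
    (β : A →+* C) (ι : k →+* A) (hι : ∀ a, α (algebraMap k X a) = β (ι a))
    (e : C →+ A) (he : ∀ x a, e (α x * β a) = ι (l x) * a) (η : Fin g → A)
    (f : MvPolynomial (Fin g) k) :
    MvPolynomial.eval₂ ι η (shiftCoord z l f) =
      e (MvPolynomial.eval₂ (β.comp ι) (fun i => α (z i) + β (η i)) f) := by
  have h1 : MvPolynomial.eval₂ (β.comp ι) (fun i => α (z i) + β (η i)) f =
      MvPolynomial.eval₂ α (fun i => β (η i)) (MvPolynomial.aeval (R := k)
      (fun i => MvPolynomial.C (z i) + MvPolynomial.X i) f : MvPolynomial (Fin g) X) := by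
    rw [← MvPolynomial.coe_eval₂Hom α, MvPolynomial.aeval_def, MvPolynomial.hom_eval₂]
    congr 1
    · ext a
      change β (ι a) = MvPolynomial.eval₂ α _ (MvPolynomial.C (algebraMap k X a))
      rw [MvPolynomial.eval₂_C, hι]
    · ext i; simp
  rw [h1, shiftCoord]
  set S := (MvPolynomial.aeval (R := k)
      (fun i => MvPolynomial.C (z i) + MvPolynomial.X i) f : MvPolynomial (Fin g) X)
  rw [MvPolynomial.eval₂_eq α, map_sum, ← MvPolynomial.coe_eval₂Hom, map_sum]
  refine Finset.sum_congr rfl fun m _ => ?_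
  rw [MvPolynomial.coe_eval₂Hom, MvPolynomial.eval₂_monomial]
  have : ∏ i ∈ m.support, β (η i) ^ m i = β (m.prod fun i n => η i ^ n) := by
    rw [Finsupp.prod, map_prod]; simp
  rw [this, he]

theorem eval_shiftCoord {k X : Type*} [Field k] [Field X] [Algebra k X] {g : ℕ}
    (z : Fin g → X) (l : X →ₗ[k] k) (v : Fin g → k) (f : MvPolynomial (Fin g) k) :
    MvPolynomial.eval₂ (RingHom.id k) v (shiftCoord z l f) =
      l (MvPolynomial.aeval (fun i => z i + algebraMap k X (v i)) f) := by
  rw [eval₂_shiftCoord z l (RingHom.id X) (algebraMap k X) (RingHom.id k) (fun _ => rfl)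
    l.toAddMonoidHom (fun x a => ?_) v f]
  · rfl
  · simp only [RingHom.id_apply, LinearMap.toAddMonoidHom_coe]
    rw [mul_comm, ← Algebra.smul_def, map_smul, smul_eq_mul, mul_comm]

/-- The group of translations by `k`-points preserving the ideal of relations of `z`. -/
def translationStabilizer (k : Type*) {X : Type*} [Field k] [Field X] [Algebra k X] (p : ℕ)
    [Fact p.Prime] [CharP k p] {g : ℕ} (z : Fin g → X) : AddSubgroup (Fin g → k) :=
  let M : AddSubmonoid (Fin g → k) :=
    { carrier := {v | ∀ f : MvPolynomial (Fin g) k, MvPolynomial.aeval z f = 0 →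
        MvPolynomial.aeval (fun i => z i + algebraMap k X (v i)) f = 0}
      zero_mem' := fun f hf => by simpa using hf
      add_mem' := fun {v w} hv hw f hf => by
        have h1 := hv (MvPolynomial.aeval (fun i => MvPolynomial.X i + MvPolynomial.C (w i)) f) (by
          rw [MvPolynomial.comp_aeval_apply]
          simpa using hw f hf)
        rw [MvPolynomial.comp_aeval_apply] at h1
        simpa [add_assoc] using h1 }
  { M with
    neg_mem' := fun {v} hv => by
      have : -v = (p - 1) • v := by
        have h1 : (p - 1) • v + v = 0 := by
          rw [← succ_nsmul, Nat.sub_add_cancel (Fact.out : p.Prime).one_le]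
          ext i; simp
        exact (eq_neg_of_add_eq_zero_left h1).symm
      change -v ∈ M
      rw [this]
      exact M.nsmul_mem hv _ }

theorem mem_translationStabilizer {k X : Type*} [Field k] [Field X] [Algebra k X] {p : ℕ}
    [Fact p.Prime] [CharP k p] {g : ℕ} {z : Fin g → X} {v : Fin g → k} :
    v ∈ translationStabilizer k p z ↔ ∀ f : MvPolynomial (Fin g) k, MvPolynomial.aeval z f = 0 →
        MvPolynomial.aeval (fun i => z i + algebraMap k X (v i)) f = 0 := Iff.rfl

/-- An ideal cutting out `translationStabilizer k p z`. -/
noncomputable def stabilizerIdeal (k : Type*) {X : Type*} [Field k] [Field X] [Algebra k X] {g : ℕ}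
    (z : Fin g → X) : Ideal (MvPolynomial (Fin g) k) :=
  Ideal.span {r | ∃ f, MvPolynomial.aeval z f = 0 ∧ ∃ l : X →ₗ[k] k, r = shiftCoord z l f}

theorem zeroLocusVia_stabilizerIdeal {k X : Type*} [Field k] [Field X] [Algebra k X] {p : ℕ}
    [Fact p.Prime] [CharP k p] {g : ℕ} (z : Fin g → X) :
    (translationStabilizer k p z : Set (Fin g → k)) =
      zeroLocusVia (stabilizerIdeal k z) (RingHom.id k) := by
  ext v
  constructor
  · intro hv q hq
    have hle : stabilizerIdeal k z ≤ RingHom.ker (MvPolynomial.eval₂Hom (RingHom.id k) v) := by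
      refine Ideal.span_le.mpr ?_
      rintro _ ⟨f, hf, l, rfl⟩
      rw [SetLike.mem_coe, RingHom.mem_ker, MvPolynomial.coe_eval₂Hom, eval_shiftCoord,
        mem_translationStabilizer.mp hv f hf, map_zero]
    exact hle hq
  · intro hv
    refine mem_translationStabilizer.mpr fun f hf => ?_
    rw [← Module.forall_dual_apply_eq_zero_iff k]
    intro l
    rw [← eval_shiftCoord]
    exact hv _ (Ideal.subset_span ⟨f, hf, l, rfl⟩)

theorem exists_nilBound {k X : Type u} [Field k] [IsAlgClosed k] [Field X] [Algebra k X] {p : ℕ}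
    [Fact p.Prime] [CharP k p] {g : ℕ} (z : Fin g → X)
    (hfin : (translationStabilizer k p z : Set (Fin g → k)).Finite) :
    ∃ N, NilBound (k := k) N z := by
  classical
  let H := hfin.toFinset
  let P : Fin g → MvPolynomial (Fin g) k := fun i =>
    ∏ a ∈ H, (MvPolynomial.X i - MvPolynomial.C (a i))
  have hrad : ∀ i, P i ∈ (stabilizerIdeal k z).radical := by
    intro i
    rw [← MvPolynomial.vanishingIdeal_zeroLocus_eq_radical (K := k),
      MvPolynomial.mem_vanishingIdeal_iff]
    intro v hv
    have hv' : v ∈ H := by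
      rw [Set.Finite.mem_toFinset, zeroLocusVia_stabilizerIdeal]
      exact fun q hq => hv q hq
    simp only [P, map_prod]
    exact Finset.prod_eq_zero hv' (by simp)
  choose M hM using hrad
  let M' := Finset.univ.sup M
  have hM' : ∀ i, P i ^ M' ∈ stabilizerIdeal k z := fun i =>
    Ideal.pow_mem_of_pow_mem _ (hM i) (Finset.le_sup (Finset.mem_univ i))
  refine ⟨H.card * M', ?_⟩
  intro A C _ _ α β ι hι hE η hη hf i
  have hle : stabilizerIdeal k z ≤ RingHom.ker (MvPolynomial.eval₂Hom ι η) := by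
    refine Ideal.span_le.mpr ?_
    rintro _ ⟨f, hf0, l, rfl⟩
    obtain ⟨e, he⟩ := hE l
    rw [SetLike.mem_coe, RingHom.mem_ker, MvPolynomial.coe_eval₂Hom,
      eval₂_shiftCoord z l α β ι hι e he, hf f hf0, map_zero]
  have h1 := hle (hM' i)
  rw [RingHom.mem_ker, map_pow, map_prod] at h1
  have h2 : ∏ a ∈ H, MvPolynomial.eval₂Hom ι η (MvPolynomial.X i - MvPolynomial.C (a i)) ∣
      ∏ _a ∈ H, η i := by
    refine Finset.prod_dvd_prod_of_dvd _ _ fun a _ => ?_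
    rw [map_sub, MvPolynomial.eval₂Hom_X', MvPolynomial.eval₂Hom_C]
    by_cases ha : a i = 0
    · simp [ha]
    · refine IsUnit.dvd ?_
      rw [sub_eq_add_neg, add_comm]
      exact (hη i).isUnit_add_left_of_commute ((((Ne.isUnit ha).map ι)).neg) (Commute.all _ _)
  rw [Finset.prod_const] at h2
  have h3 := pow_dvd_pow_of_dvd h2 M'
  rw [h1, zero_dvd_iff, ← pow_mul] at h3
  exact h3

theorem add_pow_prime_pow_of_ringHom {X C : Type*} [Field X] [CommRing C] (p : ℕ) [Fact p.Prime]
    [CharP X p] (α : X →+* C) (a b : C) (n : ℕ) : (a + b) ^ p ^ n = a ^ p ^ n + b ^ p ^ n := by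
  rcases subsingleton_or_nontrivial C with h | h
  · exact Subsingleton.elim _ _
  · have : CharP C p := charP_of_injective_ringHom α.injective p
    exact add_pow_char_pow a b p n

theorem NilBound.of_special {k X : Type u} [Field k] [Field X] [Algebra k X] {p : ℕ}
    [Fact p.Prime] [CharP k p] [PerfectRing k p] [PerfectField X] {g : ℕ} {N : ℕ}
    {d D : ℕ} (hdD : d ≤ D) (c : ℕ → k) (hcd : c d ≠ 0) (γ : Fin g → k) {z : Fin g → X}
    (h : NilBound (k := k) N (fun i => algebraMap k X (γ i) +
      ∑ l ∈ Finset.Icc d D, algebraMap k X (c l) * z i ^ p ^ l)) :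
    NilBound (k := k) N z := by
  have : CharP X p := charP_of_injective_algebraMap (algebraMap k X).injective p
  have : PerfectRing X p := PerfectField.toPerfectRing p
  have hp0 : ∀ n, p ^ n ≠ 0 := fun n => pow_ne_zero _ (Fact.out : p.Prime).ne_zero
  intro A C _ _ α β ι hι hE η hη hf i
  let Fk := iterateFrobeniusEquiv k p d
  let FX := iterateFrobeniusEquiv X p d
  have hFX : ∀ x, FX x = x ^ p ^ d := fun x => iterateFrobeniusEquiv_apply X p d x
  have hFk : ∀ x, Fk x = x ^ p ^ d := fun x => iterateFrobeniusEquiv_apply k p d x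
  have hcomm : ∀ a, FX.symm (algebraMap k X a) = algebraMap k X (Fk.symm a) := by
    intro a
    rw [RingEquiv.symm_apply_eq, hFX, ← map_pow, ← hFk, RingEquiv.apply_symm_apply]
  have hsymm : ∀ x l, d ≤ l → FX.symm (x ^ p ^ l) = x ^ p ^ (l - d) := by
    intro x l hl
    rw [RingEquiv.symm_apply_eq, hFX, ← pow_mul, ← pow_add, Nat.sub_add_cancel hl]
  let ι' : k →+* A := ι.comp Fk.symm.toRingHom
  let α' : X →+* C := α.comp FX.symm.toRingHom
  let η' : Fin g → A := fun i => ∑ l ∈ Finset.Icc d D, ι' (c l) * η i ^ p ^ (l - d)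
  have hη' : ∀ i, ∃ w, IsUnit w ∧ η' i = η i * w := by
    intro i
    refine ⟨∑ l ∈ Finset.Icc d D, ι' (c l) * η i ^ (p ^ (l - d) - 1), ?_, ?_⟩
    · rw [Finset.Icc_eq_cons_Ioc hdD, Finset.sum_cons, Nat.sub_self, pow_zero, Nat.sub_self,
        pow_zero, mul_one, add_comm]
      refine IsNilpotent.isUnit_add_right_of_commute ?_ ((Ne.isUnit hcd).map ι') (Commute.all _ _)
      refine isNilpotent_sum fun l hl => Commute.isNilpotent_mul_left (Commute.all _ _) ?_
      refine (hη i).pow_of_pos ?_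
      have h1 : 1 < p ^ (l - d) := Nat.one_lt_pow (by
        have := (Finset.mem_Ioc.mp hl).1
        omega) (Fact.out : p.Prime).one_lt
      omega
    · rw [Finset.mul_sum]
      refine Finset.sum_congr rfl fun l _ => ?_
      have h1 : η i ^ p ^ (l - d) = η i * η i ^ (p ^ (l - d) - 1) := by
        rw [← pow_succ', Nat.sub_add_cancel (Nat.one_le_iff_ne_zero.mpr (hp0 _))]
      rw [h1]; ring
  have hpt : ∀ i, α' (algebraMap k X (γ i) + ∑ l ∈ Finset.Icc d D, algebraMap k X (c l) * z i ^ p ^ l)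
      + β (η' i) = β (ι' (γ i)) + ∑ l ∈ Finset.Icc d D, β (ι' (c l)) *
        (α (z i) + β (η i)) ^ p ^ (l - d) := by
    intro i
    have h1 : α' (algebraMap k X (γ i) +
        ∑ l ∈ Finset.Icc d D, algebraMap k X (c l) * z i ^ p ^ l) =
        β (ι' (γ i)) + ∑ l ∈ Finset.Icc d D, β (ι' (c l)) * α (z i) ^ p ^ (l - d) := by
      change α (FX.symm _) = _
      rw [map_add, map_add, hcomm, hι, map_sum, map_sum]
      congr 1
      refine Finset.sum_congr rfl fun l hl => ?_
      rw [map_mul, hsymm _ _ (Finset.mem_Icc.mp hl).1, hcomm, map_mul, hι, map_pow]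
      rfl
    rw [h1, map_sum, add_assoc, ← Finset.sum_add_distrib]
    congr 1
    refine Finset.sum_congr rfl fun l _ => ?_
    rw [add_pow_prime_pow_of_ringHom p α, map_mul, map_pow]
    ring
  have key := h A C α' β ι' (fun a => ?_) (fun l => ?_) η' (fun i => ?_) (fun f hf0 => ?_) i
  · obtain ⟨w, hw, e⟩ := hη' i
    rw [e, mul_pow] at key
    exact (hw.pow N).mul_left_eq_zero.mp key
  · change α (FX.symm _) = _
    rw [hcomm, hι]
    rfl
  · let l' : X →ₗ[k] k :=
      { toFun := fun x => Fk.symm (l (FX x))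
        map_add' := fun x y => by simp
        map_smul' := fun a x => by
          rw [RingHom.id_apply, smul_eq_mul, RingEquiv.symm_apply_eq, map_mul,
            RingEquiv.apply_symm_apply, Algebra.smul_def, map_mul, hFX (algebraMap k X a), ← map_pow,
            ← Algebra.smul_def, map_smul, smul_eq_mul, hFk] }
    obtain ⟨e, he⟩ := hE l'
    refine ⟨e, fun x a => ?_⟩
    change e (α (FX.symm x) * _) = _
    rw [he]
    change ι (Fk.symm (l (FX (FX.symm x)))) * a = _
    rw [RingEquiv.apply_symm_apply]
    rfl
  · obtain ⟨w, -, e⟩ := hη' i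
    rw [e]
    exact Commute.isNilpotent_mul_right (Commute.all _ _) (hη i)
  · let f' : MvPolynomial (Fin g) k := MvPolynomial.eval₂ (MvPolynomial.C.comp Fk.symm.toRingHom)
      (fun i => MvPolynomial.C (Fk.symm (γ i)) + ∑ l ∈ Finset.Icc d D,
        MvPolynomial.C (Fk.symm (c l)) * MvPolynomial.X i ^ p ^ (l - d)) f
    have h1 : MvPolynomial.aeval z f' = 0 := by
      have h2 := congrArg FX.symm hf0
      rw [map_zero, MvPolynomial.aeval_def, ← RingEquiv.coe_toRingHom, MvPolynomial.hom_eval₂] at h2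
      rw [← h2, ← AlgHom.coe_toRingHom, MvPolynomial.hom_eval₂]
      congr 1
      · ext a
        simp only [RingHom.comp_apply, AlgHom.coe_toRingHom, RingEquiv.toRingHom_eq_coe,
          RingEquiv.coe_toRingHom, MvPolynomial.aeval_C]
        exact (hcomm a).symm
      · ext i
        simp only [AlgHom.coe_toRingHom, RingEquiv.coe_toRingHom, map_add, map_sum, map_mul, map_pow,
          MvPolynomial.aeval_C,
          MvPolynomial.aeval_X, hcomm]
        congr 1
        refine Finset.sum_congr rfl fun l hl => ?_
        rw [← map_pow FX.symm, hsymm _ _ (Finset.mem_Icc.mp hl).1]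
    rw [← hf f' h1, ← MvPolynomial.coe_eval₂Hom (β.comp ι), MvPolynomial.hom_eval₂]
    congr 1
    · ext a
      simp [ι']
    · ext i
      rw [hpt]
      simp [ι']

theorem mem_range_of_tmul_one_eq {F k : Type*} [Field F] [Field k] [Algebra F k] {x : k}
    (h : (1 : k) ⊗ₜ[F] x = x ⊗ₜ[F] 1) : x ∈ (algebraMap F k).range := by
  by_contra hx
  have hx' : x ∉ Submodule.span F {(1 : k)} := by
    intro h1
    obtain ⟨a, ha⟩ := Submodule.mem_span_singleton.mp h1
    exact hx ⟨a, by rw [← ha, Algebra.smul_def, mul_one]⟩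
  obtain ⟨f, hf, hle⟩ := Submodule.exists_le_ker_of_notMem hx'
  have h1 : f 1 = 0 := hle (Submodule.mem_span_singleton_self _)
  have h2 := congrArg (fun t => TensorProduct.lid F k (LinearMap.rTensor k f t)) h
  simp [h1] at h2
  exact hf ((smul_eq_zero.mp h2.symm).resolve_right one_ne_zero)

theorem NilBound.exists_pow_mem {k X F : Type u} [Field k] [Field X] [Algebra k X] {p : ℕ}
    [Fact p.Prime] [CharP k p] [Field F] [Algebra F k] [Algebra F X] [IsScalarTower F k X]
    [IsPurelyInseparable F k] {S : Subalgebra F X}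
    (hS : ∀ {ι : Type} [Fintype ι] (w : ι → X), (∀ i, w i ∈ S) → LinearIndependent F w →
      LinearIndependent k w) {g : ℕ} {z : Fin g → X} (hz : ∀ i, z i ∈ S) {N : ℕ}
    (hN : NilBound (k := k) N z) {s : Fin g → k} (hs : s ∈ translationStabilizer k p z) {n : ℕ}
    (hn : N ≤ p ^ n) (i : Fin g) : s i ^ p ^ n ∈ (algebraMap F k).range := by
  have : CharP F p := (algebraMap F k).charP (algebraMap F k).injective p
  have hfrob : ∀ (x : k) (m : ℕ), ((1 : k) ⊗ₜ[F] x - x ⊗ₜ[F] 1) ^ p ^ m =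
      (1 : k) ⊗ₜ[F] (x ^ p ^ m) - (x ^ p ^ m) ⊗ₜ[F] 1 := by
    intro x m
    have h1 := add_pow_prime_pow_of_ringHom p
      (Algebra.TensorProduct.includeLeft : k →ₐ[F] k ⊗[F] k).toRingHom
      ((1 : k) ⊗ₜ[F] x - x ⊗ₜ[F] 1) (x ⊗ₜ[F] 1) m
    rw [sub_add_cancel, Algebra.TensorProduct.tmul_pow, Algebra.TensorProduct.tmul_pow, one_pow] at h1
    exact eq_sub_of_add_eq h1.symm
  refine mem_range_of_tmul_one_eq ?_
  rw [← sub_eq_zero, ← hfrob]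
  refine pow_eq_zero_of_le hn ?_
  refine hN (k ⊗[F] k) (X ⊗[F] k)
    (Algebra.TensorProduct.includeLeft : X →ₐ[F] X ⊗[F] k).toRingHom
    (Algebra.TensorProduct.map (IsScalarTower.toAlgHom F k X) (AlgHom.id F k)).toRingHom
    (Algebra.TensorProduct.includeLeft : k →ₐ[F] k ⊗[F] k).toRingHom
    (fun a => ?_) (fun l => ?_) (fun i => (1 : k) ⊗ₜ[F] s i - s i ⊗ₜ[F] 1) (fun i => ?_)
    (fun f hf => ?_) i
  · simp
  · refine ⟨(LinearMap.rTensor k (l.restrictScalars F)).toAddMonoidHom, fun x a => ?_⟩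
    induction a with
    | zero => simp
    | tmul a b =>
      simp only [AlgHom.toRingHom_eq_coe, RingHom.coe_coe, Algebra.TensorProduct.includeLeft_apply,
        Algebra.TensorProduct.map_tmul, Algebra.TensorProduct.tmul_mul_tmul, one_mul]
      simp only [LinearMap.toAddMonoidHom_coe, LinearMap.rTensor_tmul, AlgHom.id_apply]
      congr 1
      change l (x * algebraMap k X a) = _
      rw [mul_comm, ← Algebra.smul_def, map_smul, smul_eq_mul, mul_comm]
    | add a b ha hb => rw [map_add, mul_add, map_add, ha, hb, mul_add]
  · obtain ⟨m, y, hy⟩ := IsPurelyInseparable.pow_mem F p (s i)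
    refine ⟨p ^ m, ?_⟩
    rw [hfrob, ← hy, Algebra.algebraMap_eq_smul_one, TensorProduct.tmul_smul,
      ← TensorProduct.smul_tmul', sub_self]
  · have hs' := neg_mem hs
    let f' := MvPolynomial.aeval (R := k) (fun i => MvPolynomial.X i + MvPolynomial.C (-s i)) f
    have hf' : MvPolynomial.aeval z f' = 0 := by
      rw [MvPolynomial.comp_aeval_apply]
      simpa using mem_translationStabilizer.mp hs' f hf
    have h1 := aeval_tmul_add_tmul_eq_zero hS z hz s (mem_translationStabilizer.mp hs) f' hf'
    simp only [f', MvPolynomial.aeval_def] at h1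
    rw [← MvPolynomial.coe_eval₂Hom, MvPolynomial.hom_eval₂] at h1
    rw [← h1]
    congr 1
    · ext a
      simp
    · ext i
      simp
      ring

def specialAdditiveMap {A : Type*} [CommRing A] (p d D : ℕ) (c : ℕ → A) (x : A) : A :=
  ∑ i ∈ Finset.Icc d D, c i * x ^ p ^ i

theorem specialAdditiveMap_add {A : Type*} [CommRing A] (p d D : ℕ) [Fact p.Prime] [CharP A p]
    (c : ℕ → A) (x y : A) :
    specialAdditiveMap p d D c (x + y) =
      specialAdditiveMap p d D c x + specialAdditiveMap p d D c y := by
  simp [specialAdditiveMap, add_pow_char_pow, mul_add, Finset.sum_add_distrib]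

theorem iterate_specialAdditiveMap_add {A : Type*} [CommRing A] (p d D : ℕ) [Fact p.Prime]
    [CharP A p] (c : ℕ → A) (n : ℕ) (x y : A) :
    (specialAdditiveMap p d D c)^[n] (x + y) =
      (specialAdditiveMap p d D c)^[n] x + (specialAdditiveMap p d D c)^[n] y :=
  iterate_map_add (AddMonoidHom.mk' _ (specialAdditiveMap_add p d D c)) n x y

theorem iterate_specialAdditiveMap_zero {A : Type*} [CommRing A] (p d D : ℕ) [Fact p.Prime]
    [CharP A p] (c : ℕ → A) (n : ℕ) : (specialAdditiveMap p d D c)^[n] 0 = 0 :=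
  iterate_map_zero (AddMonoidHom.mk' _ (specialAdditiveMap_add p d D c)) n

theorem iterate_specialAdditiveMap_sub {A : Type*} [CommRing A] (p d D : ℕ) [Fact p.Prime]
    [CharP A p] (c : ℕ → A) (n : ℕ) (x y : A) :
    (specialAdditiveMap p d D c)^[n] (x - y) =
      (specialAdditiveMap p d D c)^[n] x - (specialAdditiveMap p d D c)^[n] y :=
  iterate_map_sub (AddMonoidHom.mk' _ (specialAdditiveMap_add p d D c)) n x y

theorem map_iterate_specialAdditiveMap {A B : Type*} [CommRing A] [CommRing B] (p d D : ℕ)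
    (c : ℕ → A) (f : A →+* B) (n : ℕ) (x : A) :
    f ((specialAdditiveMap p d D c)^[n] x) =
      (specialAdditiveMap p d D fun i => f (c i))^[n] (f x) := by
  induction n generalizing x with
  | zero => rfl
  | succ n ih =>
    rw [Function.iterate_succ_apply, Function.iterate_succ_apply, ih]
    simp [specialAdditiveMap]

open Polynomial in
theorem exists_polynomial_iterate_specialAdditiveMap {k : Type*} [Field k] (p d D : ℕ)
    [Fact p.Prime] [CharP k p] (hdD : d ≤ D) (c : ℕ → k) (hcd : c d ≠ 0) (hcD : c D ≠ 0) (n : ℕ) :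
    ∃ P : k[X], P.natDegree = p ^ ((D - d) * n) ∧ (∃ a : k, a ≠ 0 ∧ derivative P = C a) ∧
      ∀ {X : Type u} [CommRing X] [Nontrivial X] [Algebra k X] (x : X),
        (specialAdditiveMap p d D fun i => algebraMap k X (c i))^[n] x =
          aeval (x ^ p ^ (d * n)) P := by
  induction n with
  | zero => exact ⟨X, by simp, ⟨1, by simp⟩, by simp⟩
  | succ n ih =>
    obtain ⟨P, hdeg, ⟨a, ha, hder⟩, hP⟩ := ih
    have hp := (Fact.out : p.Prime)
    let ψ : k[X] := ∑ i ∈ Finset.Icc d D, C (c i ^ p ^ (d * n)) * X ^ p ^ (i - d)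
    have hψd : ψ.natDegree = p ^ (D - d) := by
      refine natDegree_eq_of_le_of_coeff_ne_zero ?_ ?_
      · refine natDegree_sum_le_of_forall_le _ _ fun i hi => ?_
        refine (natDegree_C_mul_X_pow_le _ _).trans (Nat.pow_le_pow_right hp.pos ?_)
        have := (Finset.mem_Icc.mp hi).2
        omega
      · rw [finsetSum_coeff, Finset.sum_eq_single D]
        · rw [coeff_C_mul_X_pow, if_pos rfl]
          exact pow_ne_zero _ hcD
        · intro i hi hne
          rw [coeff_C_mul_X_pow, if_neg]
          intro h
          have := Nat.pow_right_injective hp.two_le h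
          have := Finset.mem_Icc.mp hi
          omega
        · simp [hdD]
    have hψ' : derivative ψ = C (c d ^ p ^ (d * n)) := by
      rw [derivative_sum, Finset.sum_eq_single d]
      · rw [Nat.sub_self, pow_zero, pow_one, derivative_C_mul, derivative_X, mul_one]
      · intro i hi hne
        have : i - d ≠ 0 := by have := Finset.mem_Icc.mp hi; omega
        rw [derivative_C_mul_X_pow, Nat.cast_pow, CharP.cast_eq_zero, zero_pow this]
        simp
      · simp [hdD]
    refine ⟨P.comp ψ, ?_, ⟨a * c d ^ p ^ (d * n), mul_ne_zero ha (pow_ne_zero _ hcd), ?_⟩, ?_⟩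
    · rw [natDegree_comp, hdeg, hψd, ← pow_add, mul_add, mul_one]
    · rw [derivative_comp, hder, hψ', C_comp, ← C_mul, mul_comm]
    · intro X _ _ _ x
      have : CharP X p := charP_of_injective_algebraMap (algebraMap k X).injective p
      rw [Function.iterate_succ_apply, hP, aeval_comp]
      congr 2
      simp only [specialAdditiveMap, ψ, map_sum, map_mul, aeval_C, map_pow, aeval_X]
      rw [sum_pow_char_pow]
      refine Finset.sum_congr rfl fun i hi => ?_
      rw [mul_pow, ← pow_mul, ← pow_mul, ← pow_add, ← pow_add]
      congr 3
      have := Finset.mem_Icc.mp hi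
      rw [mul_add, mul_one]
      omega

theorem lt_of_posModularTransc {K : Type u} [Field K] (p : ℕ) [Fact p.Prime] [CharP K p]
    (d D : ℕ) (hd : 1 ≤ d) (hdD : d ≤ D) (c : ℕ → K) (hcd : c d ≠ 0)
    (hmod : PosModularTransc p d D c) : d < D := by
  refine lt_of_le_of_ne hdD fun h => hmod ?_
  subst h
  have hp := (Fact.out : p.Prime)
  have h0 : p ^ d - 1 ≠ 0 := by
    have := Nat.one_lt_pow (by omega : d ≠ 0) hp.one_lt
    omega
  obtain ⟨γ, hγ⟩ := IsAlgClosed.exists_pow_nat_eq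
    (algebraMap K (AlgebraicClosure K) (c d))⁻¹ (Nat.pos_of_ne_zero h0)
  have hcd' : algebraMap K (AlgebraicClosure K) (c d) ≠ 0 := by simpa using hcd
  have hγ0 : γ ≠ 0 := by
    rintro rfl
    rw [zero_pow h0] at hγ
    exact inv_ne_zero hcd' hγ.symm
  refine ⟨γ, hγ0, fun j => ?_⟩
  have h1 : (Polynomial.C γ⁻¹ *
          ((∑ i ∈ Finset.Icc d d,
            Polynomial.C (algebraMap K (AlgebraicClosure K) (c i)) *
              Polynomial.X ^ (p ^ i)).comp
            (Polynomial.C γ * Polynomial.X))) = Polynomial.X ^ p ^ d := by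
    have h2 : γ⁻¹ * (algebraMap K (AlgebraicClosure K) (c d) * γ ^ p ^ d) = 1 := by
      rw [← Nat.sub_one_add_one (pow_ne_zero d hp.ne_zero), pow_succ, hγ]
      field_simp
    simp only [Finset.Icc_self, Finset.sum_singleton, Polynomial.mul_comp, Polynomial.C_comp,
      Polynomial.X_pow_comp, mul_pow]
    rw [← Polynomial.C_pow, ← mul_assoc, ← mul_assoc, ← Polynomial.C_mul, ← Polynomial.C_mul,
      mul_assoc, h2, Polynomial.C_1, one_mul]
  rw [h1, Polynomial.coeff_X_pow]
  split_ifs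
  · exact ⟨Polynomial.X - 1, Polynomial.X_sub_C_ne_zero 1, by simp⟩
  · exact ⟨Polynomial.X, Polynomial.X_ne_zero, by simp⟩

open scoped IntermediateField.algebraAdjoinAdjoin

theorem Polynomial.eq_zero_of_sum_comp_mul_X_pow_eq_zero {E : Type*} [Field E] (P : Polynomial E)
    (A : Fin P.natDegree → Polynomial E)
    (h : ∑ j, (A j).comp P * Polynomial.X ^ (j : ℕ) = 0) (j : Fin P.natDegree) : A j = 0 := by
  classical
  have hn : 0 < P.natDegree := j.pos
  have hcomp : ∀ j, A j ≠ 0 → (A j).comp P * Polynomial.X ^ (j : ℕ) ≠ 0 := by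
    intro j hj
    refine mul_ne_zero ?_ (pow_ne_zero _ Polynomial.X_ne_zero)
    intro h0
    rcases Polynomial.comp_eq_zero_iff.mp h0 with h1 | ⟨-, h1⟩
    · exact hj h1
    · rw [h1, Polynomial.natDegree_C] at hn
      exact hn.false
  have hdeg : ∀ j, ((A j).comp P * Polynomial.X ^ (j : ℕ)) ≠ 0 →
      ((A j).comp P * Polynomial.X ^ (j : ℕ)).natDegree = (A j).natDegree * P.natDegree + j := by
    intro j hj
    rw [Polynomial.natDegree_mul_X_pow _ (left_ne_zero_of_mul hj), Polynomial.natDegree_comp]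
  have h1 := Polynomial.degree_sum_eq_of_disjoint
    (fun j => (A j).comp P * Polynomial.X ^ (j : ℕ)) Finset.univ (by
      intro i hi j hj hij h0
      refine hij (Fin.ext ?_)
      have h2 := Polynomial.natDegree_eq_of_degree_eq h0
      simp only at h2
      rw [hdeg i hi.2, hdeg j hj.2] at h2
      have h3 := congrArg (· % P.natDegree) h2
      simpa [Nat.mul_add_mod_self_right, Nat.mod_eq_of_lt] using h3)
  rw [h, Polynomial.degree_zero] at h1
  by_contra hj
  have h2 := Finset.le_sup (f := fun j => ((A j).comp P * Polynomial.X ^ (j : ℕ)).degree)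
    (Finset.mem_univ j)
  rw [← h1, le_bot_iff, Polynomial.degree_eq_bot] at h2
  exact hcomp j hj h2

theorem Polynomial.linearIndependent_pow_adjoin_aeval {E Ω : Type*} [Field E] [Field Ω]
    [Algebra E Ω] {w : Ω} (hw : Transcendental E w) (P : Polynomial E) :
    LinearIndependent (IntermediateField.adjoin E {Polynomial.aeval w P})
      (fun j : Fin P.natDegree => w ^ (j : ℕ)) := by
  rw [← LinearIndependent.iff_fractionRing (Algebra.adjoin E {Polynomial.aeval w P})
    (IntermediateField.adjoin E {Polynomial.aeval w P})]
  rw [Fintype.linearIndependent_iff]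
  intro r hr j
  have h1 : ∀ j, ∃ A : Polynomial E, Polynomial.aeval (Polynomial.aeval w P) A = (r j : Ω) := by
    intro j
    exact (Algebra.adjoin_singleton_eq_range_aeval E _).le (r j).2
  choose A hA using h1
  have h2 : ∑ j, (A j).comp P * Polynomial.X ^ (j : ℕ) = 0 := by
    refine (transcendental_iff.mp hw) _ ?_
    rw [map_sum, ← hr]
    refine Finset.sum_congr rfl fun j _ => ?_
    rw [map_mul, Polynomial.aeval_comp, hA, map_pow, Polynomial.aeval_X, Algebra.smul_def]
    rfl
  have h3 := Polynomial.eq_zero_of_sum_comp_mul_X_pow_eq_zero P A h2 j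
  apply Subtype.ext
  rw [← hA, h3, map_zero]
  rfl

theorem exists_natDegree_bound {k Ω : Type*} [Field k] [Field Ω] [Algebra k Ω] {g : ℕ}
    (y : Fin g → Ω) [Algebra.IsAlgebraic (Algebra.adjoin k (Set.range y)) Ω] (i : Fin g)
    (hi : Transcendental k (y i)) :
    ∃ B : ℕ, ∀ (P : Polynomial k) (w : Ω), w ∈ IntermediateField.adjoin k (Set.range y) →
      Polynomial.aeval w P = y i → P.natDegree ≤ B := by
  obtain ⟨T, hiT, hTy, hT⟩ := exists_isTranscendenceBasis_between (R := k) {y i} (Set.range y)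
    (by simp) (by
      rw [AlgebraicIndepOn, algebraicIndependent_unique_type_iff]
      exact hi)
  have hyT : y i ∈ T := hiT rfl
  let E₁ := IntermediateField.adjoin k (T \ {y i})
  let E₂ := IntermediateField.adjoin E₁ {y i}
  have htr : Transcendental E₁ (y i) := by
    have h1 : AlgebraicIndepOn k id (insert (y i) (T \ {y i})) := by
      rw [Set.insert_sdiff_singleton, Set.insert_eq_of_mem hyT]
      exact hT.1
    have h2 := ((AlgebraicIndepOn.insert_iff (by simp)).mp h1).2
    rw [Set.image_id] at h2
    intro h3
    exact h2 ((IsFractionRing.isAlgebraic_iff (Algebra.adjoin k (T \ {y i})) E₁ Ω).mpr h3)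
  let M := IntermediateField.adjoin E₂ (Set.range y)
  have hE₂ : E₂.restrictScalars k = IntermediateField.adjoin k T := by
    rw [IntermediateField.adjoin_adjoin_left, Set.sdiff_union_of_subset hiT]
  have halg : ∀ x : Ω, IsIntegral E₂ x := by
    intro x
    have h1 := hT.isAlgebraic_field
    rw [Subtype.range_coe] at h1
    have h2 := (Algebra.IsAlgebraic.isAlgebraic (R := IntermediateField.adjoin k T) x).isIntegral
    refine IsIntegral.map_of_comp_eq (T := E₂) (U := Ω) (RingHom.codRestrict
      (algebraMap (IntermediateField.adjoin k T) Ω) E₂ fun a => ?_) (RingHom.id Ω) ?_ h2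
    · rw [← IntermediateField.mem_restrictScalars k, hE₂]
      exact a.2
    · ext a
      rfl
  have hfin : FiniteDimensional E₂ M :=
    IntermediateField.finiteDimensional_adjoin fun x _ => halg x
  refine ⟨Module.finrank E₂ M, fun P w hw hP => ?_⟩
  have hwM : w ∈ M := by
    have h1 : IntermediateField.adjoin k (Set.range y) ≤
        (M.restrictScalars E₁).restrictScalars k :=
      IntermediateField.adjoin_le_iff.mpr (IntermediateField.subset_adjoin E₂ _)
    exact h1 hw
  have hP' : Polynomial.aeval w (P.map (algebraMap k E₁)) = y i := by
    rw [Polynomial.aeval_map_algebraMap, hP]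
  have hw' : Transcendental E₁ w := by
    rw [← hP', transcendental_aeval_iff] at htr
    exact htr.1
  have h1 := Polynomial.linearIndependent_pow_adjoin_aeval hw' (P.map (algebraMap k E₁))
  rw [hP', Polynomial.natDegree_map] at h1
  have h2 : LinearIndependent E₂ (fun j : Fin P.natDegree => (⟨w, hwM⟩ : M) ^ (j : ℕ)) :=
    LinearIndependent.of_comp M.val.toLinearMap h1
  simpa using h2.fintype_card_le_finrank

theorem iterate_eq_zero_of_le {A : Type*} [CommRing A] (p d D : ℕ) [Fact p.Prime] [CharP A p]
    (c : ℕ → A) {m n : ℕ} (h : m ≤ n) {x : A} (hx : (specialAdditiveMap p d D c)^[m] x = 0) :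
    (specialAdditiveMap p d D c)^[n] x = 0 := by
  rw [← Nat.sub_add_cancel h, Function.iterate_add_apply, hx, iterate_specialAdditiveMap_zero]

theorem iterate_specialAdditiveMap_mem {K k : Type*} [Field K] [Field k] [Algebra K k] (p d D : ℕ)
    [Fact p.Prime] [CharP k p] (hd : 1 ≤ d) (c : ℕ → K) (F : IntermediateField K k) (h : ℕ) (x : k)
    (hx : x ^ p ^ h ∈ F) :
    (specialAdditiveMap p d D fun i => algebraMap K k (c i))^[h] x ∈ F := by
  induction h generalizing x with
  | zero => simpa using hx
  | succ h ih =>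
    rw [Function.iterate_succ_apply]
    refine ih _ ?_
    rw [specialAdditiveMap, sum_pow_char_pow]
    refine sum_mem fun i hi => ?_
    rw [mul_pow]
    refine mul_mem (pow_mem (F.algebraMap_mem _) _) ?_
    have h1 : p ^ i * p ^ h = p ^ (h + 1) * p ^ (i - 1) := by
      rw [← pow_add, ← pow_add]
      have := (Finset.mem_Icc.mp hi).1
      congr 1
      omega
    rw [← pow_mul, h1, pow_mul]
    exact pow_mem hx _

theorem exists_iterate_eq_zero_of_finite {K k : Type*} [Field K] [Field k] [Algebra K k] (p d D : ℕ)
    [Fact p.Prime] [CharP k p] (hd : 1 ≤ d) (c : ℕ → K) (F : IntermediateField K k)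
    (htor : {x : k | x ∈ F ∧
      ∃ n : ℕ, (specialAdditiveMap p d D fun i => algebraMap K k (c i))^[n] x = 0}.Finite) :
    ∃ κ : ℕ, ∀ (h j : ℕ) (x : k), x ^ p ^ h ∈ F →
      (specialAdditiveMap p d D fun i => algebraMap K k (c i))^[j] x = 0 →
      (specialAdditiveMap p d D fun i => algebraMap K k (c i))^[κ + h] x = 0 := by
  have h1 : ∃ κ : ℕ, ∀ x ∈ htor.toFinset,
      (specialAdditiveMap p d D fun i => algebraMap K k (c i))^[κ] x = 0 := by
    have h2 : ∀ x : k, ∃ n, x ∈ htor.toFinset →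
        (specialAdditiveMap p d D fun i => algebraMap K k (c i))^[n] x = 0 := by
      intro x
      by_cases hx : x ∈ htor.toFinset
      · obtain ⟨-, n, hn⟩ := htor.mem_toFinset.mp hx
        exact ⟨n, fun _ => hn⟩
      · exact ⟨0, fun h => absurd h hx⟩
    choose n hn using h2
    exact ⟨htor.toFinset.sup n, fun x hx => iterate_eq_zero_of_le p d D _
      (Finset.le_sup hx) (hn x hx)⟩
  obtain ⟨κ, hκ⟩ := h1
  refine ⟨κ, fun h j x hx hj => ?_⟩
  rw [Function.iterate_add_apply]
  refine hκ _ (htor.mem_toFinset.mpr ⟨iterate_specialAdditiveMap_mem p d D hd c F h x hx, j, ?_⟩)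
  rw [← Function.iterate_add_apply]
  exact iterate_eq_zero_of_le p d D _ (Nat.le_add_right j h) hj

theorem mem_of_forall_algEquiv_eq {M Ω : Type*} [Field M] [Field Ω] [Algebra M Ω] [Normal M Ω]
    {w : Ω} {f : Polynomial M} (hf : f.Separable) (hw : Polynomial.aeval w f = 0)
    (h : ∀ τ : Ω ≃ₐ[M] Ω, τ w = w) : w ∈ (algebraMap M Ω).range := by
  have hsep : IsSeparable M w := hf.of_dvd (minpoly.dvd M w hw)
  by_contra hmem
  have h1 : w ∉ (⊥ : Subalgebra M Ω) := by
    rwa [Algebra.mem_bot]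
  obtain ⟨y, hne, hy⟩ := (notMem_iff_exists_ne_and_isConjRoot hsep
    (Normal.splits inferInstance w)).mp h1
  obtain ⟨σ, hσ⟩ := hy.exists_algEquiv
  exact hne (σ.injective ((h σ).trans hσ.symm))

theorem NilBound.of_add {k X : Type u} [Field k] [Field X] [Algebra k X] {g N : ℕ} {z : Fin g → X}
    (γ : Fin g → k) (h : NilBound (k := k) N (fun i => algebraMap k X (γ i) + z i)) :
    NilBound (k := k) N z := by
  intro A C _ _ α β ι hι hE η hη hf i
  refine h A C α β ι hι hE η hη (fun f hf' => ?_) i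
  have h1 := hf (MvPolynomial.aeval (R := k) (fun i => MvPolynomial.C (γ i) + MvPolynomial.X i) f)
    (by
      rw [MvPolynomial.comp_aeval_apply, ← hf']
      congr 2
      ext i
      simp)
  rw [MvPolynomial.aeval_def, ← MvPolynomial.coe_eval₂Hom, MvPolynomial.hom_eval₂] at h1
  rw [← h1]
  congr 1
  · ext a
    simp
  · ext i
    simp [hι, add_assoc]

theorem NilBound.of_iterate {k X : Type u} [Field k] [Field X] [Algebra k X] {p d D : ℕ}
    [Fact p.Prime] [CharP k p] [PerfectRing k p] [PerfectField X]
    (hdD : d ≤ D) {c : ℕ → k} (hcd : c d ≠ 0) {g N : ℕ} (j : ℕ) {z : Fin g → X} (γ : Fin g → k)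
    (h : NilBound (k := k) N (fun i => algebraMap k X (γ i) +
      (specialAdditiveMap p d D fun i => algebraMap k X (c i))^[j] (z i))) :
    NilBound (k := k) N z := by
  induction j generalizing γ with
  | zero =>
    have hN := h
    simp only [Function.iterate_zero, id_eq] at hN
    exact hN.of_add γ
  | succ j ih =>
    refine ih 0 ?_
    simp only [Function.iterate_succ_apply'] at h
    simpa using NilBound.of_special hdD c hcd γ h

theorem mem_range_of_iterate_eq_zero {k X : Type u} [Field k] [IsAlgClosed k] [Field X]
    [Algebra k X] {p d D : ℕ} [Fact p.Prime] [CharP k p]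
    (hdD : d ≤ D) {c : ℕ → k} (hcd : c d ≠ 0) (hcD : c D ≠ 0) (j : ℕ) {x : X}
    (h : (specialAdditiveMap p d D fun i => algebraMap k X (c i))^[j] x = 0) :
    x ∈ (algebraMap k X).range := by
  obtain ⟨P, hdeg, -, hP⟩ := exists_polynomial_iterate_specialAdditiveMap.{u} p d D hdD c hcd hcD j
  have hp := (Fact.out : p.Prime)
  rw [hP] at h
  have h0 : P ≠ 0 := by
    rintro rfl
    rw [Polynomial.natDegree_zero] at hdeg
    exact (pow_pos hp.pos _).ne hdeg
  have h1 : IsIntegral k (x ^ p ^ (d * j)) := IsAlgebraic.isIntegral ⟨P, h0, h⟩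
  have h2 : IsIntegral k x := h1.of_pow (pow_pos hp.pos _)
  exact minpoly.mem_range_of_degree_eq_one k x
    (IsAlgClosed.degree_eq_one_of_irreducible k (minpoly.irreducible h2))

theorem exists_forall_ne_add_iterate {K : Type u} [Field K] {p : ℕ} [Fact p.Prime] [CharP K p]
    {d D : ℕ} (hd : 1 ≤ d) (hdD : d < D) {c : ℕ → K} (hcd : c d ≠ 0) (hcD : c D ≠ 0)
    {k Ω : Type u} [Field k] [IsAlgClosed k] [Algebra K k] [Algebra.IsAlgebraic K k]
    [CharP k p]
    (htor : {x : k | x ∈ separableClosure K k ∧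
      ∃ n : ℕ, (specialAdditiveMap p d D fun i => algebraMap K k (c i))^[n] x = 0}.Finite)
    [Field Ω] [IsAlgClosed Ω] [Algebra K Ω] [Algebra k Ω] [IsScalarTower K k Ω] {g : ℕ}
    (y : Fin g → Ω) [Algebra.IsAlgebraic (Algebra.adjoin k (Set.range y)) Ω] (i : Fin g)
    (hi : Transcendental k (y i))
    (hfin : (translationStabilizer k p y : Set (Fin g → k)).Finite) :
    ∃ n₀ : ℕ, ∀ j ≥ n₀, ∀ (γ : Fin g → K) (z : Fin g → Ω),
      StaysPIndepMod p K (RingHom.ker (MvPolynomial.aeval z : MvPolynomial (Fin g) K →ₐ[K] Ω)) →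
      y ≠ fun i => algebraMap K Ω (γ i) +
        (specialAdditiveMap p d D fun i => algebraMap K Ω (c i))^[j] (z i) := by
  have hp := (Fact.out : p.Prime)
  obtain ⟨N, hN⟩ := exists_nilBound y hfin
  obtain ⟨κ, hκ⟩ := exists_iterate_eq_zero_of_finite p d D hd c (separableClosure K k) htor
  obtain ⟨B, hB⟩ := exists_natDegree_bound y i hi
  refine ⟨κ + N + B, fun j hj γ z hz hy => ?_⟩
  have hcd' : algebraMap K k (c d) ≠ 0 := by simpa using hcd
  have hcD' : algebraMap K k (c D) ≠ 0 := by simpa using hcD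
  have hc : (fun i => algebraMap K Ω (c i)) = fun i => algebraMap k Ω (algebraMap K k (c i)) := by
    ext i
    exact IsScalarTower.algebraMap_apply K k Ω (c i)
  rw [hc] at hy
  obtain ⟨n, rfl⟩ := Nat.exists_eq_add_of_le (show κ + N ≤ j by omega)
  have : CharP Ω p := charP_of_injective_algebraMap (algebraMap k Ω).injective p
  have hNz : NilBound (k := k) N z := by
    refine NilBound.of_iterate (c := fun i => algebraMap K k (c i)) hdD.le hcd' (κ + N + n)
      (fun i => algebraMap K k (γ i)) ?_
    convert hN using 1
    rw [hy]
    ext i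
    rw [← IsScalarTower.algebraMap_apply]
  let M := IntermediateField.adjoin k (Set.range y)
  have hyM : ∀ i, y i ∈ M := fun i => IntermediateField.subset_adjoin _ _ ⟨i, rfl⟩
  have hnormal : Normal M Ω := by
    have : Algebra.IsAlgebraic M Ω := ⟨fun x => (IsFractionRing.isAlgebraic_iff
      (Algebra.adjoin k (Set.range y)) M Ω).mp (Algebra.IsAlgebraic.isAlgebraic x)⟩
    have : IsAlgClosure M Ω := ⟨inferInstance, inferInstance⟩
    exact IsAlgClosure.normal M Ω
  have hfix : ∀ τ : Ω ≃ₐ[M] Ω, τ ((specialAdditiveMap p d D fun i =>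
      algebraMap k Ω (algebraMap K k (c i)))^[κ + N] (z i)) = (specialAdditiveMap p d D fun i =>
      algebraMap k Ω (algebraMap K k (c i)))^[κ + N] (z i) := by
    intro τ
    have hτk : ∀ a : k, τ (algebraMap k Ω a) = algebraMap k Ω a :=
      fun a => τ.commutes (algebraMap k M a)
    have hτφ : ∀ (m : ℕ) (x : Ω), τ ((specialAdditiveMap p d D fun i =>
        algebraMap k Ω (algebraMap K k (c i)))^[m] x) = (specialAdditiveMap p d D fun i =>
        algebraMap k Ω (algebraMap K k (c i)))^[m] (τ x) := by
      intro m x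
      have := map_iterate_specialAdditiveMap p d D
        (fun i => algebraMap k Ω (algebraMap K k (c i))) (τ : Ω →+* Ω) m x
      simpa [hτk] using this
    have h1 : ∀ i, (specialAdditiveMap p d D fun i =>
        algebraMap k Ω (algebraMap K k (c i)))^[κ + N + n] (τ (z i) - z i) = 0 := by
      intro i
      rw [iterate_specialAdditiveMap_sub, ← hτφ]
      have h2 := congrFun hy i
      have h3 : τ (y i) = y i := τ.commutes ⟨y i, hyM i⟩
      rw [h2, map_add, IsScalarTower.algebraMap_apply K k Ω, hτk] at h3
      rw [add_left_cancel h3, sub_self]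
    choose s hs using fun i => mem_range_of_iterate_eq_zero hdD.le hcd' hcD' _ (h1 i)
    have hsz : ∀ i, z i + algebraMap k Ω (s i) = τ (z i) := by
      intro i
      rw [hs, add_sub_cancel]
    have hstab : s ∈ translationStabilizer k p z := by
      rw [mem_translationStabilizer]
      intro f hf
      simp only [hsz]
      have := congrArg (τ.restrictScalars k).toAlgHom hf
      rwa [map_zero, MvPolynomial.comp_aeval_apply] at this
    have hpow := NilBound.exists_pow_mem (F := separableClosure K k)
      (S := separableOver (IntermediateField.adjoin K (Set.range z)) (separableClosure K k))
      (fun w hw hw' => linearIndependent_of_separableOver z hz (separableClosure K k) k hw hw')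
      (fun i => isSeparable_algebraMap
        (⟨z i, IntermediateField.subset_adjoin _ _ ⟨i, rfl⟩⟩ :
          IntermediateField.adjoin K (Set.range z))) hNz hstab (Nat.lt_pow_self hp.one_lt).le i
    have h2 : (specialAdditiveMap p d D fun i => algebraMap K k (c i))^[κ + N] (s i) = 0 := by
      refine hκ N (κ + N + n) (s i) ?_ ?_
      · obtain ⟨a, ha⟩ := hpow
        rw [← ha]
        exact a.2
      · apply (algebraMap k Ω).injective
        rw [map_iterate_specialAdditiveMap, hs, h1, map_zero]
    rw [hτφ, ← hsz, iterate_specialAdditiveMap_add, ← map_iterate_specialAdditiveMap, h2, map_zero,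
      add_zero]
  obtain ⟨P, hdeg, ⟨a, ha, hder⟩, hP⟩ := exists_polynomial_iterate_specialAdditiveMap.{u} p d D
    hdD.le (fun i => algebraMap K k (c i)) hcd' hcD' n
  have hPy := congrFun hy i
  rw [add_comm (κ + N) n, Function.iterate_add_apply, hP, IsScalarTower.algebraMap_apply K k Ω]
    at hPy
  set x := (specialAdditiveMap p d D fun i =>
      algebraMap k Ω (algebraMap K k (c i)))^[κ + N] (z i)
  let P' : Polynomial k := P + Polynomial.C (algebraMap K k (γ i))
  have hP' : Polynomial.aeval (x ^ p ^ (d * n)) P' = y i := by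
    rw [hPy, map_add, Polynomial.aeval_C, add_comm]
  have hwM : x ^ p ^ (d * n) ∈ M := by
    have h1 := mem_of_forall_algEquiv_eq (M := M) (w := x ^ p ^ (d * n))
      (f := P'.map (algebraMap k M) - Polynomial.C ⟨y i, hyM i⟩) ?_ ?_
      (fun τ => by rw [map_pow, hfix])
    · obtain ⟨b, hb⟩ := h1
      rw [← hb]
      exact b.2
    · rw [Polynomial.separable_def]
      have h2 : Polynomial.derivative (P'.map (algebraMap k M) - Polynomial.C ⟨y i, hyM i⟩) =
          Polynomial.C (algebraMap k M a) := by
        simp [P', hder, Polynomial.derivative_map]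
      rw [h2]
      refine ⟨0, Polynomial.C (algebraMap k M a)⁻¹, ?_⟩
      rw [zero_mul, zero_add, ← Polynomial.C_mul, inv_mul_cancel₀ (by simpa using ha),
        Polynomial.C_1]
    · rw [map_sub, Polynomial.aeval_map_algebraMap, hP', Polynomial.aeval_C]
      exact sub_self _
  have hle := hB P' _ hwM hP'
  rw [Polynomial.natDegree_add_C, hdeg] at hle
  have h1 : n < p ^ n := Nat.lt_pow_self hp.one_lt
  have h2 : p ^ n ≤ p ^ ((D - d) * n) :=
    Nat.pow_le_pow_right hp.pos (Nat.le_mul_of_pos_left n (by omega))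
  omega

noncomputable def translateIterate {K : Type*} [Field K] (p d D : ℕ) (c : ℕ → K) (j : ℕ) {g : ℕ}
    (γ : Fin g → K) : MvPolynomial (Fin g) K →ₐ[K] MvPolynomial (Fin g) K :=
  MvPolynomial.aeval fun i => MvPolynomial.C (γ i) +
    (specialAdditiveMap p d D fun i => MvPolynomial.C (c i))^[j] (MvPolynomial.X i)

theorem aeval_translateIterate {K A : Type*} [Field K] [CommRing A] [Algebra K A] (p d D : ℕ)
    (c : ℕ → K) (j : ℕ) {g : ℕ} (γ : Fin g → K) (z : Fin g → A) (f : MvPolynomial (Fin g) K) :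
    MvPolynomial.aeval z (translateIterate p d D c j γ f) =
      MvPolynomial.aeval (fun i => algebraMap K A (γ i) +
        (specialAdditiveMap p d D fun i => algebraMap K A (c i))^[j] (z i)) f := by
  rw [translateIterate, MvPolynomial.comp_aeval_apply]
  congr 2
  ext i
  have h := map_iterate_specialAdditiveMap p d D (fun i => MvPolynomial.C (c i))
    (MvPolynomial.aeval z : MvPolynomial (Fin g) K →ₐ[K] A).toRingHom j (MvPolynomial.X i)
  simp only [AlgHom.toRingHom_eq_coe, RingHom.coe_coe, MvPolynomial.aeval_X,
    MvPolynomial.aeval_C] at h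
  rw [map_add, h, MvPolynomial.aeval_C]

theorem IsIntegral.of_aeval_field {K R S : Type*} [Field K] [CommRing R] [Nontrivial R]
    [CommRing S] [Algebra K R] [Algebra K S] [Algebra R S] [IsScalarTower K R S] {P : Polynomial K}
    (hP : P.natDegree ≠ 0) {x : S} (hx : IsIntegral R (Polynomial.aeval x P)) : IsIntegral R x := by
  have h0 : P ≠ 0 := by
    rintro rfl
    exact hP Polynomial.natDegree_zero
  have hmon := Polynomial.monic_mul_leadingCoeff_inv h0
  refine IsIntegral.of_aeval_monic (hmon.map (algebraMap K R)) ?_ ?_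
  · rw [hmon.natDegree_map, Polynomial.natDegree_mul_leadingCoeff_inv _ h0]
    exact hP
  · rw [Polynomial.aeval_map_algebraMap, map_mul, Polynomial.aeval_C,
      IsScalarTower.algebraMap_apply K R S]
    exact hx.mul isIntegral_algebraMap

theorem isIntegral_translateIterate {K : Type u} [Field K] {p d D : ℕ} [Fact p.Prime] [CharP K p]
    (hdD : d ≤ D) {c : ℕ → K} (hcd : c d ≠ 0) (hcD : c D ≠ 0) (j : ℕ) {g : ℕ} (γ : Fin g → K) :
    (translateIterate p d D c j γ).toRingHom.IsIntegral := by
  obtain ⟨P, hdeg, -, hP⟩ := exists_polynomial_iterate_specialAdditiveMap.{u} p d D hdD c hcd hcD j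
  have hp := (Fact.out : p.Prime)
  let : Algebra (MvPolynomial (Fin g) K) (MvPolynomial (Fin g) K) :=
    (translateIterate p d D c j γ).toRingHom.toAlgebra
  have hC : ∀ a : K, algebraMap (MvPolynomial (Fin g) K) (MvPolynomial (Fin g) K)
    (MvPolynomial.C a) = MvPolynomial.C a := fun a => (translateIterate p d D c j γ).commutes a
  have hCint : ∀ a : K, IsIntegral (MvPolynomial (Fin g) K)
      (MvPolynomial.C a : MvPolynomial (Fin g) K) := by
    intro a
    rw [← hC]
    exact isIntegral_algebraMap
  have hX : ∀ i, IsIntegral (MvPolynomial (Fin g) K)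
      (MvPolynomial.X i : MvPolynomial (Fin g) K) := by
    intro i
    refine IsIntegral.of_pow (n := p ^ (d * j)) (pow_pos hp.pos _) ?_
    have : @IsScalarTower K (MvPolynomial (Fin g) K) (MvPolynomial (Fin g) K) _
        Algebra.toSMul _ := IsScalarTower.of_algebraMap_eq fun a => (hC a).symm
    refine IsIntegral.of_aeval_field (P := P) ?_ ?_
    · rw [hdeg]
      exact (pow_pos hp.pos _).ne'
    · rw [← hP]
      have h : algebraMap (MvPolynomial (Fin g) K) (MvPolynomial (Fin g) K) (MvPolynomial.X i) =
          MvPolynomial.C (γ i) +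
            (specialAdditiveMap p d D fun i => MvPolynomial.C (c i))^[j] (MvPolynomial.X i) :=
        MvPolynomial.aeval_X _ i
      have h' := (isIntegral_algebraMap (R := MvPolynomial (Fin g) K)
        (A := MvPolynomial (Fin g) K) (x := MvPolynomial.X i)).sub (hCint (γ i))
      rw [h, add_sub_cancel_left] at h'
      exact h'
  intro f
  change IsIntegral (MvPolynomial (Fin g) K) f
  induction f using MvPolynomial.induction_on with
  | C a => exact hCint a
  | add f f' hf hf' => exact hf.add hf'
  | mul_X f i hf => exact hf.mul (hX i)

theorem exists_point_lift {K : Type u} [Field K] {g : ℕ}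
    (θ : MvPolynomial (Fin g) K →ₐ[K] MvPolynomial (Fin g) K) (hθ : θ.toRingHom.IsIntegral)
    {P P' : Ideal (MvPolynomial (Fin g) K)} [P.IsPrime] [P'.IsPrime]
    (hP : Ideal.comap θ P' = P) {Ω : Type u} [Field Ω] [IsAlgClosed Ω] [Algebra K Ω]
    (y : Fin g → Ω) (hy : RingHom.ker (MvPolynomial.aeval y : MvPolynomial (Fin g) K →ₐ[K] Ω) = P) :
    ∃ z : Fin g → Ω, RingHom.ker (MvPolynomial.aeval z : MvPolynomial (Fin g) K →ₐ[K] Ω) = P' ∧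
      ∀ i, y i = MvPolynomial.aeval z (θ (MvPolynomial.X i)) := by
  let A := MvPolynomial (Fin g) K ⧸ P
  let B := MvPolynomial (Fin g) K ⧸ P'
  let : Algebra A Ω := (Ideal.Quotient.lift P
    (MvPolynomial.aeval y : MvPolynomial (Fin g) K →ₐ[K] Ω).toRingHom
    (fun a ha => by rw [← hy] at ha; exact ha)).toAlgebra
  let : Algebra A B := (Ideal.quotientMap P' θ.toRingHom hP.ge).toAlgebra
  have hAΩmk (f : MvPolynomial (Fin g) K) :
      algebraMap A Ω (Ideal.Quotient.mk P f) = MvPolynomial.aeval y f := rfl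
  have hABmk (f : MvPolynomial (Fin g) K) :
      algebraMap A B (Ideal.Quotient.mk P f) = Ideal.Quotient.mk P' (θ f) := rfl
  have hAΩ : Function.Injective (algebraMap A Ω) := by
    rw [injective_iff_map_eq_zero]
    intro a ha
    obtain ⟨f, rfl⟩ := Ideal.Quotient.mk_surjective a
    rw [Ideal.Quotient.eq_zero_iff_mem, ← hy]
    exact ha
  have hAB : Function.Injective (algebraMap A B) := by
    rw [injective_iff_map_eq_zero]
    intro a ha
    obtain ⟨f, rfl⟩ := Ideal.Quotient.mk_surjective a
    rw [hABmk, Ideal.Quotient.eq_zero_iff_mem] at ha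
    rw [Ideal.Quotient.eq_zero_iff_mem, ← hP]
    exact ha
  have : FaithfulSMul A Ω := (faithfulSMul_iff_algebraMap_injective A Ω).2 hAΩ
  have : FaithfulSMul A B := (faithfulSMul_iff_algebraMap_injective A B).2 hAB
  have : Module.IsTorsionFree A Ω := inferInstance
  have : Module.IsTorsionFree A B := inferInstance
  have hAint : Algebra.IsIntegral A B := by
    refine ⟨fun b => ?_⟩
    obtain ⟨f, rfl⟩ := Ideal.Quotient.mk_surjective b
    obtain ⟨q, hq, hqf⟩ := hθ f
    refine ⟨q.map (Ideal.Quotient.mk P), hq.map _, ?_⟩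
    rw [Polynomial.eval₂_map]
    have h : (algebraMap A B).comp (Ideal.Quotient.mk P) =
        (Ideal.Quotient.mk P').comp θ.toRingHom := rfl
    rw [h, ← Polynomial.hom_eval₂, hqf, map_zero]
  let ψ : B →ₐ[A] Ω := IsAlgClosed.lift
  have hψ : RingHom.ker ψ.toRingHom = ⊥ := by
    refine Ideal.eq_bot_of_comap_eq_bot (R := A) ?_
    rw [RingHom.comap_ker, eq_bot_iff]
    intro a ha
    have h : ψ (algebraMap A B a) = 0 := ha
    rw [ψ.commutes] at h
    exact hAΩ (h.trans (map_zero _).symm)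
  have hz (f : MvPolynomial (Fin g) K) :
      MvPolynomial.aeval (fun i => ψ (Ideal.Quotient.mk P' (MvPolynomial.X i))) f =
        ψ (Ideal.Quotient.mk P' f) := by
    induction f using MvPolynomial.induction_on with
    | C a =>
      have h : (Ideal.Quotient.mk P' (MvPolynomial.C a) : B) =
          algebraMap A B (Ideal.Quotient.mk P (MvPolynomial.C a)) := by
        rw [hABmk]
        exact congrArg _ (θ.commutes a).symm
      rw [h, ψ.commutes, hAΩmk, MvPolynomial.aeval_C, MvPolynomial.aeval_C]
    | add f f' hf hf' => rw [map_add, hf, hf', map_add, map_add]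
    | mul_X f i hf => rw [map_mul, hf, MvPolynomial.aeval_X, map_mul, map_mul]
  refine ⟨fun i => ψ (Ideal.Quotient.mk P' (MvPolynomial.X i)), ?_, fun i => ?_⟩
  · ext f
    rw [RingHom.mem_ker, hz, ← Ideal.Quotient.eq_zero_iff_mem]
    refine ⟨fun h => ?_, fun h => ?_⟩
    · have h' : Ideal.Quotient.mk P' f ∈ RingHom.ker ψ.toRingHom := h
      rw [hψ] at h'
      exact h'
    · rw [h, map_zero]
  · rw [hz, ← hABmk, ψ.commutes, hAΩmk, MvPolynomial.aeval_X]

theorem exists_isAlgClosed_isAlgebraic (K A : Type u) [Field K] [CommRing A] [IsDomain A]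
    [Algebra K A] : ∃ (Ω : Type u) (_ : Field Ω) (_ : IsAlgClosed Ω) (_ : Algebra K Ω)
      (_ : Algebra A Ω), IsScalarTower K A Ω ∧ Algebra.IsAlgebraic A Ω ∧
      Function.Injective (algebraMap A Ω) :=
  ⟨AlgebraicClosure (FractionRing A), inferInstance, inferInstance, inferInstance, inferInstance,
    inferInstance, (IsFractionRing.comap_isAlgebraic_iff (K := FractionRing A)).2 inferInstance, by
      rw [IsScalarTower.algebraMap_eq A (FractionRing A) (AlgebraicClosure (FractionRing A))]
      exact (algebraMap (FractionRing A) _).injective.comp (IsFractionRing.injective A _)⟩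

theorem exists_generic_point {K : Type u} [Field K] {g : ℕ} (P : Ideal (MvPolynomial (Fin g) K))
    [P.IsPrime] : ∃ (Ω : Type u) (_ : Field Ω) (_ : IsAlgClosed Ω) (_ : Algebra K Ω)
      (y : Fin g → Ω),
      RingHom.ker (MvPolynomial.aeval y : MvPolynomial (Fin g) K →ₐ[K] Ω) = P ∧
      Algebra.IsAlgebraic (Algebra.adjoin K (Set.range y)) Ω := by
  let A := MvPolynomial (Fin g) K ⧸ P
  obtain ⟨Ω, _, _, _, _, _, hA, hinj⟩ := exists_isAlgClosed_isAlgebraic K A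
  let y : Fin g → Ω := fun i => algebraMap A Ω (Ideal.Quotient.mk P (MvPolynomial.X i))
  have hy (f : MvPolynomial (Fin g) K) :
      MvPolynomial.aeval y f = algebraMap A Ω (Ideal.Quotient.mk P f) := by
    have h : MvPolynomial.aeval y =
        (IsScalarTower.toAlgHom K A Ω).comp (Ideal.Quotient.mkₐ K P) :=
      MvPolynomial.algHom_ext fun i => MvPolynomial.aeval_X _ i
    rw [h]
    rfl
  refine ⟨Ω, inferInstance, inferInstance, inferInstance, y, ?_, ⟨fun x => ?_⟩⟩
  · ext f
    rw [RingHom.mem_ker, hy, ← Ideal.Quotient.eq_zero_iff_mem, map_eq_zero_iff _ hinj]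
  · obtain ⟨q, hq, hqx⟩ := hA.isAlgebraic x
    have hmem (a : A) : algebraMap A Ω a ∈ Algebra.adjoin K (Set.range y) := by
      obtain ⟨f, rfl⟩ := Ideal.Quotient.mk_surjective a
      rw [← hy]
      exact Algebra.adjoin_range_eq_range_aeval K y ▸ AlgHom.mem_range_self _ f
    let h : A →+* Algebra.adjoin K (Set.range y) := (algebraMap A Ω).codRestrict _ hmem
    have hh : Function.Injective h := fun a b hab => hinj (congrArg Subtype.val hab)
    refine ⟨q.map h, (Polynomial.map_ne_zero_iff hh).2 hq, ?_⟩
    rw [Polynomial.aeval_def, Polynomial.eval₂_map]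
    exact hqx

theorem finite_translationStabilizer {K k Ω : Type*} [Field K] [Field k] [IsAlgClosed k]
    [Algebra K k] [Field Ω] [Algebra K Ω] [Algebra k Ω] [IsScalarTower K k Ω] {p : ℕ} [Fact p.Prime] [CharP k p]
    {g : ℕ} (I : Ideal (MvPolynomial (Fin g) K))
    (hV : ¬ ∃ (a : Fin g → k) (H : AddSubgroup (Fin g → k)), (H : Set (Fin g → k)).Infinite ∧
      (∃ J : Ideal (MvPolynomial (Fin g) k),
        (H : Set (Fin g → k)) = zeroLocusVia J (RingHom.id k)) ∧
      (fun h => a + h) '' (H : Set (Fin g → k)) ⊆ zeroLocusVia I (algebraMap K k))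
    (y : Fin g → Ω) (hy : ∀ q ∈ I, MvPolynomial.aeval y q = 0) :
    (translationStabilizer k p y : Set (Fin g → k)).Finite := by
  by_contra hinf
  have hker : RingHom.ker (MvPolynomial.aeval y : MvPolynomial (Fin g) k →ₐ[k] Ω) ≠ ⊤ :=
    RingHom.ker_ne_top _
  obtain ⟨a, ha⟩ : (MvPolynomial.zeroLocus k
      (RingHom.ker (MvPolynomial.aeval y : MvPolynomial (Fin g) k →ₐ[k] Ω))).Nonempty := by
    by_contra he
    rw [Set.not_nonempty_iff_eq_empty] at he
    apply hker
    rw [← Ideal.radical_eq_top, ← MvPolynomial.vanishingIdeal_zeroLocus_eq_radical (K := k), he,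
      eq_top_iff]
    exact fun _ _ _ h => h.elim
  refine hV ⟨a, translationStabilizer k p y, hinf, ⟨_, zeroLocusVia_stabilizerIdeal y⟩, ?_⟩
  rintro _ ⟨h, hh, rfl⟩ q hq
  have h1 := mem_translationStabilizer.1 hh (MvPolynomial.map (algebraMap K k) q) (by
    rw [MvPolynomial.aeval_map_algebraMap]
    exact hy q hq)
  have h2 := ha (MvPolynomial.aeval (fun i => MvPolynomial.X i + MvPolynomial.C (h i))
      (MvPolynomial.map (algebraMap K k) q)) (by
    rw [RingHom.mem_ker, MvPolynomial.comp_aeval_apply]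
    simpa using h1)
  rw [MvPolynomial.comp_aeval_apply, MvPolynomial.aeval_map_algebraMap] at h2
  change MvPolynomial.eval₂ _ (fun i => a i + h i) q = 0
  simpa [MvPolynomial.aeval_def] using h2

theorem exists_transcendental_of_infinite {K k Ω : Type*} [Field K] [Field k] [Algebra K k]
    [Algebra.IsAlgebraic K k] [Field Ω] [Algebra K Ω] [Algebra k Ω] [IsScalarTower K k Ω]
    {g : ℕ} (y : Fin g → Ω) (hinf : (zeroLocusVia
      (RingHom.ker (MvPolynomial.aeval y : MvPolynomial (Fin g) K →ₐ[K] Ω))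
      (algebraMap K k)).Infinite) : ∃ i, Transcendental k (y i) := by
  by_contra! halg
  apply hinf
  have hK (i : Fin g) : IsAlgebraic K (y i) := by
    have h := halg i
    rw [Transcendental, not_not] at h
    exact h.restrictScalars K
  refine (Set.Finite.pi (t := fun i => (minpoly K (y i)).rootSet k)
    fun i => Polynomial.rootSet_finite _ _).subset ?_
  intro v hv i _
  rw [Polynomial.mem_rootSet_of_ne (minpoly.ne_zero (hK i).isIntegral)]
  have h := hv (Polynomial.aeval (MvPolynomial.X i) (minpoly K (y i))) (by
    rw [RingHom.mem_ker, ← Polynomial.aeval_algHom_apply, MvPolynomial.aeval_X, minpoly.aeval])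
  rw [← MvPolynomial.aeval_def, ← Polynomial.aeval_algHom_apply, MvPolynomial.aeval_X] at h
  exact h

theorem exists_forall_comap_translateIterate_ne {K : Type u} [Field K] {p : ℕ} [Fact p.Prime]
    [CharP K p] {d D : ℕ} (hd : 1 ≤ d) (hdD : d < D) {c : ℕ → K} (hcd : c d ≠ 0) (hcD : c D ≠ 0)
    {k : Type u} [Field k] [IsAlgClosed k] [Algebra K k] [Algebra.IsAlgebraic K k]
    (htor : {x : k | x ∈ separableClosure K k ∧
      ∃ n : ℕ, (specialAdditiveMap p d D fun i => algebraMap K k (c i))^[n] x = 0}.Finite)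
    {g : ℕ} (I : Ideal (MvPolynomial (Fin g) K))
    (hV : ¬ ∃ (a : Fin g → k) (H : AddSubgroup (Fin g → k)), (H : Set (Fin g → k)).Infinite ∧
      (∃ J : Ideal (MvPolynomial (Fin g) k),
        (H : Set (Fin g → k)) = zeroLocusVia J (RingHom.id k)) ∧
      (fun h => a + h) '' (H : Set (Fin g → k)) ⊆ zeroLocusVia I (algebraMap K k))
    (P : Ideal (MvPolynomial (Fin g) K)) [P.IsPrime] (hIP : I ≤ P)
    (hinf : (zeroLocusVia P (algebraMap K k)).Infinite) :
    ∃ n₀ : ℕ, ∀ j ≥ n₀, ∀ (γ : Fin g → K) (P' : Ideal (MvPolynomial (Fin g) K)), P'.IsPrime →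
      StaysPIndepMod p K P' → Ideal.comap (translateIterate p d D c j γ) P' ≠ P := by
  have : CharP k p := charP_of_injective_algebraMap (algebraMap K k).injective p
  obtain ⟨Ω, _, _, _, y, hy, hyalg⟩ := exists_generic_point P
  let : Algebra k Ω := (IsAlgClosed.lift : k →ₐ[K] Ω).toRingHom.toAlgebra
  have : IsScalarTower K k Ω :=
    IsScalarTower.of_algebraMap_eq fun a => ((IsAlgClosed.lift : k →ₐ[K] Ω).commutes a).symm
  have : Algebra.IsAlgebraic (Algebra.adjoin k (Set.range y)) Ω := by
    have hle : Algebra.adjoin K (Set.range y) ≤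
        (Algebra.adjoin k (Set.range y)).restrictScalars K :=
      Algebra.adjoin_le Algebra.subset_adjoin
    exact ⟨fun x => (hyalg.isAlgebraic x).tower_top_of_subalgebra_le hle⟩
  obtain ⟨i, hi⟩ := exists_transcendental_of_infinite (k := k) y (hy ▸ hinf)
  have hfin := finite_translationStabilizer (p := p) I hV y fun q hq => by
    have h := hIP hq
    rwa [← hy] at h
  obtain ⟨n₀, hn₀⟩ := exists_forall_ne_add_iterate hd hdD hcd hcD htor y i hi hfin
  refine ⟨n₀, fun j hj γ P' hP' hstay hcomap => ?_⟩
  obtain ⟨z, hz, hyz⟩ := exists_point_lift (translateIterate p d D c j γ)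
    (isIntegral_translateIterate hdD.le hcd hcD j γ) hcomap y hy
  refine hn₀ j hj γ z (hz ▸ hstay) ?_
  ext i
  rw [hyz, aeval_translateIterate, MvPolynomial.aeval_X]

/-- The ideal of polynomials over `K` vanishing at all `z ∈ L^g` with `γ + φ^m(z)` in the zero locus
of `I`, for all extensions `L` of `K` preserving `K^p`-linear independence. -/
def preimageIdeal {K : Type u} [Field K] (p d D : ℕ) (c : ℕ → K) {g : ℕ}
    (I : Ideal (MvPolynomial (Fin g) K)) (m : ℕ) (γ : Fin g → K) :
    Ideal (MvPolynomial (Fin g) K) where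
  carrier := {f | ∀ (L : Type v) [Field L] [Algebra K L], StaysPIndep p K (Set.univ : Set L) →
    ∀ z : Fin g → L, (fun i => algebraMap K L (γ i) +
      (specialAdditiveMap p d D fun i => algebraMap K L (c i))^[m] (z i)) ∈
        zeroLocusVia I (algebraMap K L) → MvPolynomial.aeval z f = 0}
  zero_mem' := fun _ _ _ _ _ _ => map_zero _
  add_mem' := fun ha hb L _ _ hL z hz => by rw [map_add, ha L hL z hz, hb L hL z hz, add_zero]
  smul_mem' := fun a b hb L _ _ hL z hz => by
    rw [smul_eq_mul, map_mul, hb L hL z hz, mul_zero]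

theorem isRadical_preimageIdeal {K : Type u} [Field K] (p d D : ℕ) (c : ℕ → K) {g : ℕ}
    (I : Ideal (MvPolynomial (Fin g) K)) (m : ℕ) (γ : Fin g → K) :
    (preimageIdeal.{u, v} p d D c I m γ).IsRadical := by
  rintro f ⟨n, hn⟩ L _ _ hL z hz
  have h := hn L hL z hz
  rw [map_pow] at h
  exact eq_zero_of_pow_eq_zero h

theorem staysPIndepMod_preimageIdeal {K : Type u} [Field K] (p d D : ℕ) (c : ℕ → K) {g : ℕ}
    (I : Ideal (MvPolynomial (Fin g) K)) (m : ℕ) (γ : Fin g → K) :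
    StaysPIndepMod p K (preimageIdeal.{u, v} p d D c I m γ) := by
  intro ι _ b hb x hx i L _ _ hL z hz
  refine hL ι b hb (fun i => MvPolynomial.aeval z (x i)) (fun _ => Set.mem_univ _) ?_ i
  have h := hx L hL z hz
  simpa using h

/-- The ideal of polynomials over `K` vanishing at the `L`-points of the zero locus of `I` in
`γ + φ^m(L^g)`, for all extensions `L` of `K` preserving `K^p`-linear independence. -/
noncomputable def cosetIdeal {K : Type u} [Field K] (p d D : ℕ) (c : ℕ → K) {g : ℕ}
    (I : Ideal (MvPolynomial (Fin g) K)) (m : ℕ) (γ : Fin g → K) :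
    Ideal (MvPolynomial (Fin g) K) :=
  Ideal.comap (translateIterate p d D c m γ) (preimageIdeal.{u, v} p d D c I m γ)

theorem mem_cosetIdeal {K : Type u} [Field K] {p d D : ℕ} {c : ℕ → K} {g : ℕ}
    {I : Ideal (MvPolynomial (Fin g) K)} {m : ℕ} {γ : Fin g → K} {f : MvPolynomial (Fin g) K} :
    f ∈ cosetIdeal.{u, v} p d D c I m γ ↔
      ∀ (L : Type v) [Field L] [Algebra K L], StaysPIndep p K (Set.univ : Set L) →
        ∀ z : Fin g → L, (fun i => algebraMap K L (γ i) +
          (specialAdditiveMap p d D fun i => algebraMap K L (c i))^[m] (z i)) ∈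
            zeroLocusVia I (algebraMap K L) →
        MvPolynomial.aeval (fun i => algebraMap K L (γ i) +
          (specialAdditiveMap p d D fun i => algebraMap K L (c i))^[m] (z i)) f = 0 := by
  simp_rw [← aeval_translateIterate]
  exact Iff.rfl

theorem le_cosetIdeal {K : Type u} [Field K] (p d D : ℕ) (c : ℕ → K) {g : ℕ}
    (I : Ideal (MvPolynomial (Fin g) K)) (m : ℕ) (γ : Fin g → K) :
    I ≤ cosetIdeal.{u, v} p d D c I m γ :=
  fun f hf => mem_cosetIdeal.2 fun _ _ _ _ _ hz => hz f hf

theorem cosetIdeal_le {K : Type u} [Field K] (p d D : ℕ) [Fact p.Prime] [CharP K p] (c : ℕ → K)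
    {g : ℕ} (I : Ideal (MvPolynomial (Fin g) K)) (m r : ℕ) (γ δ : Fin g → K) :
    cosetIdeal.{u, v} p d D c I m γ ≤ cosetIdeal.{u, v} p d D c I (m + r)
      (γ + fun i => (specialAdditiveMap p d D c)^[m] (δ i)) := by
  intro f hf
  rw [mem_cosetIdeal] at hf ⊢
  intro L _ _ hL z hz
  have : CharP L p := charP_of_injective_algebraMap (algebraMap K L).injective p
  have h := hf L hL (fun i => algebraMap K L (δ i) +
    (specialAdditiveMap p d D fun i => algebraMap K L (c i))^[r] (z i))
  simp only [iterate_specialAdditiveMap_add, ← map_iterate_specialAdditiveMap, ← add_assoc,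
    ← Function.iterate_add_apply, ← map_add] at h
  exact h hz

theorem finite_zeroLocusVia_finset_inf {F M ι : Type*} [Field F] [Field M] {g : ℕ} (f : F →+* M)
    (S : Finset ι) (J : ι → Ideal (MvPolynomial (Fin g) F))
    (h : ∀ i ∈ S, (zeroLocusVia (J i) f).Finite) : (zeroLocusVia (S.inf J) f).Finite := by
  refine (S.finite_toSet.biUnion h).subset fun x hx => ?_
  have hp : (RingHom.ker (MvPolynomial.eval₂Hom f x)).IsPrime := RingHom.ker_isPrime _
  obtain ⟨i, hi, hle⟩ := (hp.inf_le' (f := J) (s := S)).1 fun q hq => hx q hq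
  exact Set.mem_biUnion (Finset.mem_coe.2 hi) fun q hq => hle hq

theorem exists_minimalPrimes_infinite {F M : Type*} [Field F] [Field M] {g : ℕ} (f : F →+* M)
    (J : Ideal (MvPolynomial (Fin g) F)) (h : (zeroLocusVia J f).Infinite) :
    ∃ P ∈ J.minimalPrimes, (zeroLocusVia P f).Infinite := by
  by_contra! hfin
  refine h (((Ideal.finite_minimalPrimes_of_isNoetherianRing _ J).biUnion
    hfin).subset fun x hx => ?_)
  have hp : (RingHom.ker (MvPolynomial.eval₂Hom f x)).IsPrime := RingHom.ker_isPrime _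
  obtain ⟨P, hP, hle⟩ := Ideal.exists_minimalPrimes_le (I := J)
    (J := RingHom.ker (MvPolynomial.eval₂Hom f x)) fun q hq => hx q hq
  exact Set.mem_biUnion hP fun q hq => hle hq

theorem exists_finset_forall_exists_add_iterate {M : Type*} [AddCommGroup M] (T : M →+ M)
    (Γ : AddSubgroup M) (hT : ∀ x ∈ Γ, T x ∈ Γ) {F : Set M} (hF : F.Finite) (hFΓ : F ⊆ Γ)
    (h : ∀ x ∈ Γ, ∃ a ∈ F, ∃ y ∈ Γ, x = a + T y) (n : ℕ) :
    ∃ S : Finset M, ↑S ⊆ (Γ : Set M) ∧ ∀ x ∈ Γ, ∃ a ∈ S, ∃ y ∈ Γ, x = a + T^[n] y := by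
  classical
  induction n with
  | zero => exact ⟨{0}, by simp, fun x hx => ⟨0, by simp, x, hx, by simp⟩⟩
  | succ n ih =>
    obtain ⟨S, hS, hS'⟩ := ih
    have hTn (x) (hx : x ∈ Γ) : T^[n] x ∈ Γ :=
      (Set.MapsTo.iterate (s := (Γ : Set M)) (fun x hx => hT x hx) n) hx
    refine ⟨Finset.image₂ (fun a b => a + T^[n] b) S hF.toFinset, ?_, fun x hx => ?_⟩
    · intro x hx
      simp only [Finset.coe_image₂, Set.mem_image2, Finset.mem_coe, Set.Finite.mem_toFinset] at hx
      obtain ⟨a, ha, b, hb, rfl⟩ := hx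
      exact Γ.add_mem (hS ha) (hTn b (hFΓ hb))
    · obtain ⟨a, ha, y, hy, rfl⟩ := hS' x hx
      obtain ⟨b, hb, w, hw, rfl⟩ := h y hy
      refine ⟨a + T^[n] b, Finset.mem_image₂_of_mem ha (hF.mem_toFinset.2 hb), w, hw, ?_⟩
      rw [iterate_map_add, add_assoc, Function.iterate_succ_apply]

theorem exists_seq_of_forall_exists {M : Type*} [AddCommGroup M] (T : M →+ M)
    (Γ : AddSubgroup M) {F : Set M} (hF : F.Finite)
    (h : ∀ x ∈ Γ, ∃ a ∈ F, ∃ y ∈ Γ, x = a + T y) (Q : ℕ → M → Prop)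
    (hmono : ∀ n m x, n ≤ m → Q m x → Q n x)
    (hadd : ∀ n x y, Q n (x + T^[n] y) → Q n x) (hQ : ∀ n, ∃ x ∈ Γ, Q n x) :
    ∃ x : ℕ → M, (∀ n, Q n (x n)) ∧ ∀ n, ∃ y, x (n + 1) = x n + T^[n] y := by
  let B : ℕ → M → Prop := fun m x => ∀ n ≥ m, ∃ y ∈ Γ, Q n (x + T^[m] y)
  have hstep : ∀ m x, B m x → ∃ a, B (m + 1) (x + T^[m] a) := by
    intro m x hB
    by_contra! hno
    have hno' : ∀ a ∈ F, ∃ n ≥ m + 1, ∀ y ∈ Γ, ¬ Q n (x + T^[m] a + T^[m + 1] y) := by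
      intro a ha
      have := hno a
      simp only [B] at this
      push Not at this
      exact this
    choose! N hN hNQ using hno'
    obtain ⟨n, hn⟩ := (hF.image N).bddAbove
    obtain ⟨y, hy, hQy⟩ := hB (max m n) (le_max_left _ _)
    obtain ⟨a, ha, w, hw, rfl⟩ := h y hy
    refine hNQ a ha w hw
      (hmono _ _ _ ((hn (Set.mem_image_of_mem _ ha)).trans (le_max_right m n)) ?_)
    rwa [iterate_map_add, ← add_assoc, ← Function.iterate_succ_apply] at hQy
  choose! A hA using hstep
  let x : ℕ → M := Nat.rec 0 fun m x => x + T^[m] (A m x)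
  have hx : ∀ m, B m (x m) := by
    intro m
    induction m with
    | zero =>
      intro n _
      obtain ⟨y, hy, hQy⟩ := hQ n
      exact ⟨y, hy, by simpa [x] using hQy⟩
    | succ m ih => exact hA m _ ih
  refine ⟨x, fun n => ?_, fun n => ⟨A n (x n), rfl⟩⟩
  obtain ⟨y, -, hQy⟩ := hx n n le_rfl
  exact hadd _ _ _ hQy

theorem IsPhiFG.exists_finite {K : Type*} [Field K] {p : ℕ} [Fact p.Prime] [CharP K p] {g : ℕ}
    {φ : K → K} (T : (Fin g → K) →+ (Fin g → K)) (hT : ∀ x, T x = fun i => φ (x i))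
    {Γ : AddSubgroup (Fin g → K)} (hfg : IsPhiFG φ Γ) :
    ∃ F : Set (Fin g → K), F.Finite ∧ F ⊆ Γ ∧ ∀ x ∈ Γ, ∃ a ∈ F, ∃ y ∈ Γ, x = a + T y := by
  obtain ⟨hsub, s, hs, hmin⟩ := hfg
  have hcl : AddSubgroup.closure (s : Set (Fin g → K)) ≤ Γ := (AddSubgroup.closure_le _).2 hs
  have hfin : (AddSubgroup.closure (s : Set (Fin g → K)) : Set (Fin g → K)).Finite := by
    have : AddGroup.FG (AddSubgroup.closure (s : Set (Fin g → K))) := inferInstance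
    have htors : IsAddTorsion (AddSubgroup.closure (s : Set (Fin g → K))) := by
      intro x
      rw [isOfFinAddOrder_iff_nsmul_eq_zero]
      refine ⟨p, (Fact.out : p.Prime).pos, Subtype.ext ?_⟩
      ext i
      simp
    have := AddCommGroup.finite_of_fg_isAddTorsion _ htors
    exact Set.toFinite _
  refine ⟨_, hfin, hcl, fun x hx => ?_⟩
  have hle := hmin (AddSubgroup.closure s ⊔ Γ.map T) (fun y hy => ?_)
    (AddSubgroup.subset_closure.trans (SetLike.coe_subset_coe.2 le_sup_left))
  · obtain ⟨a, ha, b, hb, rfl⟩ := AddSubgroup.mem_sup.1 (hle hx)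
    obtain ⟨y, hy, rfl⟩ := hb
    exact ⟨a, ha, y, hy, rfl⟩
  · refine le_sup_right (a := AddSubgroup.closure (s : Set (Fin g → K))) ?_
    rw [← hT]
    refine AddSubgroup.mem_map_of_mem T (sup_le hcl ?_ hy)
    rintro _ ⟨w, hw, rfl⟩
    rw [hT]
    exact hsub w hw

theorem zeroLocusVia_anti {F M : Type*} [Field F] [CommRing M] {g : ℕ} (f : F →+* M)
    {I J : Ideal (MvPolynomial (Fin g) F)} (h : I ≤ J) : zeroLocusVia J f ⊆ zeroLocusVia I f :=
  fun _ hx q hq => hx q (h hq)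

/-- The coordinatewise action of `φ` on `K^g`. -/
def coordinatewiseAdditiveMap {K : Type*} [Field K] (p d D : ℕ) [Fact p.Prime] [CharP K p]
    (c : ℕ → K) (g : ℕ) : (Fin g → K) →+ (Fin g → K) :=
  AddMonoidHom.mk' (fun x i => specialAdditiveMap p d D c (x i)) fun x y =>
    funext fun i => specialAdditiveMap_add p d D c (x i) (y i)

theorem iterate_coordinatewiseAdditiveMap {K : Type*} [Field K] (p d D : ℕ) [Fact p.Prime]
    [CharP K p] (c : ℕ → K) (g n : ℕ) (x : Fin g → K) :
    (coordinatewiseAdditiveMap p d D c g)^[n] x =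
      fun i => (specialAdditiveMap p d D c)^[n] (x i) := by
  induction n generalizing x with
  | zero => rfl
  | succ n ih =>
    rw [Function.iterate_succ_apply, ih]
    rfl

theorem cosetIdeal_add_iterate {K : Type u} [Field K] (p d D : ℕ) [Fact p.Prime] [CharP K p]
    (c : ℕ → K) {g : ℕ} (I : Ideal (MvPolynomial (Fin g) K)) (m : ℕ) (γ δ : Fin g → K) :
    cosetIdeal.{u, v} p d D c I m (γ + (coordinatewiseAdditiveMap p d D c g)^[m] δ) =
      cosetIdeal.{u, v} p d D c I m γ := by
  have h (γ δ : Fin g → K) : cosetIdeal.{u, v} p d D c I m γ ≤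
      cosetIdeal.{u, v} p d D c I m (γ + (coordinatewiseAdditiveMap p d D c g)^[m] δ) := by
    rw [iterate_coordinatewiseAdditiveMap]
    exact cosetIdeal_le p d D c I m 0 γ δ
  refine le_antisymm ?_ (h γ δ)
  have h' := h (γ + (coordinatewiseAdditiveMap p d D c g)^[m] δ) (-δ)
  rwa [iterate_map_neg, add_neg_cancel_right] at h'

theorem cosetIdeal_mono {K : Type u} [Field K] (p d D : ℕ) [Fact p.Prime] [CharP K p]
    (c : ℕ → K) {g : ℕ} (I : Ideal (MvPolynomial (Fin g) K)) (γ : Fin g → K) :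
    Monotone fun m => cosetIdeal.{u, v} p d D c I m γ := by
  refine monotone_nat_of_le_succ fun m => ?_
  have h := cosetIdeal_le.{u, v} p d D c I m 1 γ 0
  simp only [Pi.zero_apply, iterate_specialAdditiveMap_zero] at h
  rwa [← Pi.zero_def, add_zero] at h

theorem exists_forall_finite_zeroLocusVia_cosetIdeal {K : Type u} [Field K] {p : ℕ} [Fact p.Prime]
    [CharP K p] {d D : ℕ} (hd : 1 ≤ d) (hdD : d < D) {c : ℕ → K} (hcd : c d ≠ 0) (hcD : c D ≠ 0)
    {k : Type u} [Field k] [IsAlgClosed k] [Algebra K k] [Algebra.IsAlgebraic K k]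
    (htor : {x : k | x ∈ separableClosure K k ∧
      ∃ n : ℕ, (specialAdditiveMap p d D fun i => algebraMap K k (c i))^[n] x = 0}.Finite)
    {g : ℕ} (I : Ideal (MvPolynomial (Fin g) K))
    (hV : ¬ ∃ (a : Fin g → k) (H : AddSubgroup (Fin g → k)), (H : Set (Fin g → k)).Infinite ∧
      (∃ J : Ideal (MvPolynomial (Fin g) k),
        (H : Set (Fin g → k)) = zeroLocusVia J (RingHom.id k)) ∧
      (fun h => a + h) '' (H : Set (Fin g → k)) ⊆ zeroLocusVia I (algebraMap K k))
    (Γ : AddSubgroup (Fin g → K)) {F : Set (Fin g → K)} (hF : F.Finite)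
    (hΓ : ∀ x ∈ Γ, ∃ a ∈ F, ∃ y ∈ Γ, x = a + coordinatewiseAdditiveMap p d D c g y) :
    ∃ m, ∀ γ ∈ Γ, (zeroLocusVia (cosetIdeal.{u, v} p d D c I m γ) (algebraMap K k)).Finite := by
  by_contra! hinf
  obtain ⟨x, hx, hxs⟩ := exists_seq_of_forall_exists (coordinatewiseAdditiveMap p d D c g) Γ hF hΓ
    (fun m γ => (zeroLocusVia (cosetIdeal.{u, v} p d D c I m γ) (algebraMap K k)).Infinite)
    (fun n m γ hnm h => h.mono (zeroLocusVia_anti _ (cosetIdeal_mono p d D c I γ hnm)))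
    (fun n γ δ h => by rwa [cosetIdeal_add_iterate] at h) hinf
  have hmono : Monotone fun m => cosetIdeal.{u, v} p d D c I m (x m) := by
    refine monotone_nat_of_le_succ fun m => ?_
    obtain ⟨δ, hδ⟩ := hxs m
    rw [hδ, ← cosetIdeal_add_iterate p d D c I m (x m) δ]
    exact cosetIdeal_mono p d D c I _ (Nat.le_succ m)
  obtain ⟨m₀, hm₀⟩ := monotone_stabilizes_iff_noetherian.2 inferInstance ⟨_, hmono⟩
  obtain ⟨P, hP, hPinf⟩ := exists_minimalPrimes_infinite _ _ (hx m₀)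
  have := hP.1.1
  obtain ⟨n₀, hn₀⟩ := exists_forall_comap_translateIterate_ne hd hdD hcd hcD htor I hV P
    ((le_cosetIdeal p d D c I m₀ (x m₀)).trans hP.1.2) hPinf
  let j := max m₀ n₀
  have hj : cosetIdeal p d D c I m₀ (x m₀) = cosetIdeal p d D c I j (x j) :=
    hm₀ j (le_max_left _ _)
  rw [hj] at hP
  obtain ⟨P', hP', hcomap⟩ := Ideal.exists_minimalPrimes_comap_eq
    (translateIterate p d D c j (x j)).toRingHom P hP
  exact hn₀ j (le_max_right _ _) (x j) P' hP'.1.1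
    ((staysPIndepMod_preimageIdeal p d D c I j (x j)).of_mem_minimalPrimes
      (isRadical_preimageIdeal p d D c I j (x j)) hP') hcomap

/-- Let `φ` be a Drinfeld module of special characteristic over `K` with
positive modular transcendence degree and `Φ[t^∞](K^sep)` finite, let `Γ ⊆ K^g` be a
finitely generated full `Φ(R)`-submodule, and let `V` be a Zariski-closed subset of affine
`g`-space over `K` whose `K̄`-points contain no translate of an infinite Zariski-closed
additive subgroup of `K̄^g`.  Then there are `m ∈ ℕ` and a zero-dimensional Zariski-closed
`W ⊆ V` over `K` such that for every fully separable extension `L/K` and every `γ ∈ Γ`,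
`V(L) ∩ (γ + Φ_{t^m}(L^g)) ⊆ W(L)`. -/
theorem stmt12 {K : Type u} [Field K] (p : ℕ) [Fact p.Prime] [CharP K p]
    (d D : ℕ) (hd : 1 ≤ d) (hdD : d ≤ D) (c : ℕ → K)
    (hcd : c d ≠ 0) (hcD : c D ≠ 0)
    (hmod : PosModularTransc p d D c)
    -- `Φ[t^∞](K^sep)` is finite:
    (htor : {x : AlgebraicClosure K | x ∈ separableClosure K (AlgebraicClosure K) ∧
      ∃ n : ℕ, (specialTphi p d D (fun i => algebraMap K (AlgebraicClosure K) (c i)))^[n] x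
        = 0}.Finite)
    (g : ℕ) (hg : 1 ≤ g) (Γ : AddSubgroup (Fin g → K))
    (hfg : IsPhiFG (specialTphi p d D c) Γ)
    (hfull : IsPhiFull p (specialTphi p d D c) Γ)
    (I : Ideal (MvPolynomial (Fin g) K))
    -- `V(K̄)` contains no translate of an infinite Zariski-closed additive subgroup:
    (hV : ¬ ∃ (a : Fin g → AlgebraicClosure K)
        (H : AddSubgroup (Fin g → AlgebraicClosure K)),
      (H : Set (Fin g → AlgebraicClosure K)).Infinite ∧
      (∃ J : Ideal (MvPolynomial (Fin g) (AlgebraicClosure K)),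
        (H : Set (Fin g → AlgebraicClosure K)) =
          zeroLocusVia J (RingHom.id (AlgebraicClosure K))) ∧
      (fun h => a + h) '' (H : Set (Fin g → AlgebraicClosure K)) ⊆
        zeroLocusVia I (algebraMap K (AlgebraicClosure K))) :
    ∃ (m : ℕ) (J : Ideal (MvPolynomial (Fin g) K)),
      -- `W` is zero-dimensional:
      (zeroLocusVia J (algebraMap K (AlgebraicClosure K))).Finite ∧
      -- `W(K̄) ⊆ V(K̄)`:
      zeroLocusVia J (algebraMap K (AlgebraicClosure K)) ⊆
        zeroLocusVia I (algebraMap K (AlgebraicClosure K)) ∧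
      ∀ (L : Type v) [Field L] [Algebra K L],
        (haveI : CharP L p := charP_of_injective_ringHom (algebraMap K L).injective p;
          FullySeparable p K L) →
        ∀ γ ∈ Γ,
          zeroLocusVia I (algebraMap K L) ∩
            {y : Fin g → L | ∃ z : Fin g → L,
              y = (fun i => algebraMap K L (γ i)) + fun i =>
                (specialTphi p d D (fun i => algebraMap K L (c i)))^[m] (z i)} ⊆
          zeroLocusVia J (algebraMap K L) := by
  have hdD' := lt_of_posModularTransc p d D hd hdD c hcd hmod
  obtain ⟨F, hF, hFΓ, hΓ⟩ := hfg.exists_finite (p := p) (coordinatewiseAdditiveMap p d D c g)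
    fun _ => rfl
  obtain ⟨m, hm⟩ := exists_forall_finite_zeroLocusVia_cosetIdeal.{u, v} hd hdD' hcd hcD htor I hV Γ
    hF hΓ
  obtain ⟨S, hSΓ, hS⟩ := exists_finset_forall_exists_add_iterate
    (coordinatewiseAdditiveMap p d D c g) Γ hfg.1 hF hFΓ hΓ m
  refine ⟨m, S.inf (cosetIdeal.{u, v} p d D c I m), ?_, ?_, ?_⟩
  · exact finite_zeroLocusVia_finset_inf _ S _ fun γ hγ => hm γ (hSΓ hγ)
  · exact zeroLocusVia_anti _ (Finset.le_inf fun γ _ => le_cosetIdeal p d D c I m γ)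
  · rintro L _ _ hL γ hγ y ⟨hyI, z, rfl⟩ q hq
    have : CharP L p := charP_of_injective_algebraMap (algebraMap K L).injective p
    obtain ⟨a, ha, δ, -, rfl⟩ := hS γ hγ
    have hq' := (Finset.inf_le ha : S.inf (cosetIdeal.{u, v} p d D c I m) ≤ _) hq
    rw [← cosetIdeal_add_iterate p d D c I m a δ, mem_cosetIdeal] at hq'
    exact hq' L (FullySeparable.staysPIndep p hL) z hyI
end

section
/- Let p be a prime, K a field of characteristic p, and φ(X) = Σ_{i=d}^{D} c_i X^{p^i} ∈ K[X] a Drinfeld module of special characteristic (1 ≤ d ≤ D, c_d ≠ 0, c_D ≠ 0). Assume φ has positive modular transcendence degree and that Φ[t^∞](K^sep) is finite. Let g ≥ 1, let Γ ⊆ K^g be a finitely generated Φ(R)-submodule, and let V be a Zariski-closed subset of affine g-space defined over K such that V(K̄) contains no translate of any infinite Zariski-closed additive subgroup of K̄^g. Then the set V(K) ∩ Γ is finite. -/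
universe u

namespace DrinfeldML

section SepPart
open Polynomial

/-- The separable additive polynomial `∑ c_i^{p^{ds}} X^{p^{i-d}}`, a Frobenius twist of the
separable part of `φ`. -/
noncomputable def twist {L : Type*} [Field L] (p d D : ℕ) (c : ℕ → L) (s : ℕ) : L[X] :=
  ∑ i ∈ Finset.Icc d D, C (c i ^ p ^ (d * s)) * X ^ p ^ (i - d)

/-- The composition of the `n` consecutive twists starting with the `s`-th one; for `s = 0` this
is the separable part of the `n`-th iterate of `φ`. -/
noncomputable def sepPart {L : Type*} [Field L] (p d D : ℕ) (c : ℕ → L) : ℕ → ℕ → L[X]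
  | _, 0 => X
  | s, n + 1 => (twist p d D c s).comp (sepPart p d D c (s + 1) n)

variable {L : Type*} [Field L] (p : ℕ) {d D : ℕ} {c : ℕ → L}

lemma derivative_twist [CharP L p] (hdD : d ≤ D) (s : ℕ) :
    derivative (twist p d D c s) = C (c d ^ p ^ (d * s)) := by
  simp only [twist, derivative_sum, derivative_C_mul, derivative_X_pow]
  rw [Finset.sum_eq_single d]
  · simp
  · intro i hi hne
    have := Finset.mem_Icc.1 hi
    obtain ⟨j, hj⟩ : ∃ j, i - d = j + 1 := ⟨i - d - 1, by omega⟩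
    simp [hj, pow_succ]
  · simp [hdD]

lemma exists_derivative_sepPart [CharP L p] (hdD : d ≤ D) (hcd : c d ≠ 0) (s n : ℕ) :
    ∃ u : L, u ≠ 0 ∧ derivative (sepPart p d D c s n) = C u := by
  induction n generalizing s with
  | zero => exact ⟨1, one_ne_zero, by simp [sepPart]⟩
  | succ n ih =>
    obtain ⟨u, hu, h⟩ := ih (s + 1)
    refine ⟨u * c d ^ p ^ (d * s), mul_ne_zero hu (pow_ne_zero _ hcd), ?_⟩
    rw [sepPart, derivative_comp, derivative_twist p hdD, h, C_comp, C_mul]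

variable [Fact p.Prime]

lemma aeval_sepPart_add (d D : ℕ) (c : ℕ → L) {A : Type*} [CommRing A] [Algebra L A]
    [CharP A p] (s n : ℕ) (a b : A) :
    aeval (a + b) (sepPart p d D c s n) =
      aeval a (sepPart p d D c s n) + aeval b (sepPart p d D c s n) := by
  have h (s : ℕ) (a b : A) : aeval (a + b) (twist p d D c s) =
      aeval a (twist p d D c s) + aeval b (twist p d D c s) := by
    simp [twist, add_pow_char_pow, mul_add, Finset.sum_add_distrib]
  induction n generalizing s with
  | zero => simp [sepPart]
  | succ n ih => simp [sepPart, aeval_comp, ih, h]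

lemma natDegree_twist (hdD : d ≤ D) (hcD : c D ≠ 0) (s : ℕ) :
    (twist p d D c s).natDegree = p ^ (D - d) := by
  have hp : 1 < p := (Fact.out : p.Prime).one_lt
  have key : (twist p d D c s).coeff (p ^ (D - d)) ≠ 0 := by
    simp only [twist, finsetSum_coeff, coeff_C_mul, coeff_X_pow]
    rw [Finset.sum_eq_single D]
    · simp [hcD]
    · intro i hi hne
      have := Finset.mem_Icc.1 hi
      rw [if_neg, mul_zero]
      intro h
      have := Nat.pow_right_injective hp h
      omega
    · simp [hdD]
  refine le_antisymm ?_ (le_natDegree_of_ne_zero key)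
  refine natDegree_sum_le_of_forall_le _ _ fun i hi => ?_
  refine (natDegree_C_mul_X_pow_le _ _).trans ?_
  have := Finset.mem_Icc.1 hi
  exact Nat.pow_le_pow_right hp.le (by omega)

lemma natDegree_sepPart (hdD : d ≤ D) (hcD : c D ≠ 0) (s n : ℕ) :
    (sepPart p d D c s n).natDegree = p ^ ((D - d) * n) := by
  induction n generalizing s with
  | zero => simp [sepPart]
  | succ n ih =>
    rw [sepPart, natDegree_comp, natDegree_twist p hdD hcD, ih, ← pow_add]
    congr 1; ring

variable [CharP L p]

lemma eval_twist_pow (s : ℕ) (z : L) :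
    (eval z (twist p d D c s)) ^ p ^ d = eval (z ^ p ^ d) (twist p d D c (s + 1)) := by
  simp only [twist, eval_finsetSum, eval_mul, eval_C, eval_pow, eval_X]
  rw [sum_pow_char_pow]
  refine Finset.sum_congr rfl fun i _ => ?_
  rw [mul_pow, ← pow_mul, ← pow_mul, ← pow_mul, ← pow_add, mul_comm (p ^ d)]
  rfl

lemma eval_sepPart_pow (s n : ℕ) (z : L) :
    (eval z (sepPart p d D c s n)) ^ p ^ d = eval (z ^ p ^ d) (sepPart p d D c (s + 1) n) := by
  induction n generalizing s with
  | zero => simp [sepPart]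
  | succ n ih => rw [sepPart, sepPart, eval_comp, eval_comp, eval_twist_pow, ih]

lemma specialTphi_eval_sepPart (n : ℕ) (z : L) :
    specialTphi p d D c (eval z (sepPart p d D c 0 n)) =
      eval (z ^ p ^ d) (sepPart p d D c 0 (n + 1)) := by
  rw [sepPart, eval_comp, ← eval_sepPart_pow]
  simp only [specialTphi, twist, eval_finsetSum, eval_mul, eval_C, eval_pow, eval_X]
  refine Finset.sum_congr rfl fun i hi => ?_
  have := Finset.mem_Icc.1 hi
  rw [← pow_mul, ← pow_add, Nat.add_sub_cancel' this.1]
  simp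

lemma iterate_specialTphi_eval_sepPart (m n : ℕ) (z : L) :
    (specialTphi p d D c)^[m] (eval z (sepPart p d D c 0 n)) =
      eval (z ^ p ^ (d * m)) (sepPart p d D c 0 (n + m)) := by
  induction m with
  | zero => simp
  | succ m ih =>
    rw [Function.iterate_succ_apply', ih, specialTphi_eval_sepPart, ← pow_mul, ← pow_add]
    rfl

lemma iterate_specialTphi (m : ℕ) (z : L) :
    (specialTphi p d D c)^[m] z = eval (z ^ p ^ (d * m)) (sepPart p d D c 0 m) := by
  simpa [sepPart] using iterate_specialTphi_eval_sepPart p (c := c) (d := d) (D := D) m 0 z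

/-- A polynomial without constant term and with nonzero linear term detects the order of
nilpotency. -/
lemma pow_eq_zero_of_aeval_pow_eq_zero {A : Type*} [CommRing A] [Algebra L A] {f : L[X]}
    (h0 : f.coeff 0 = 0) (h1 : f.coeff 1 ≠ 0) {e : A} (he : IsNilpotent e) {N : ℕ}
    (h : (aeval e f) ^ N = 0) : e ^ N = 0 := by
  obtain ⟨f₁, rfl⟩ := X_dvd_iff.2 h0
  obtain ⟨f₂, hf₂⟩ : X ∣ f₁ - C (f₁.coeff 0) := X_dvd_iff.2 (by simp)
  have hu : IsUnit (aeval e f₁) := by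
    rw [sub_eq_iff_eq_add'.1 hf₂]
    simp only [map_add, map_mul, aeval_C, aeval_X]
    refine IsNilpotent.isUnit_add_left_of_commute ?_ ?_ (Commute.all _ _)
    · exact (Commute.all _ _).isNilpotent_mul_right he
    · exact (IsUnit.mk0 _ (by simpa using h1)).map _
  rw [map_mul, aeval_X, mul_pow] at h
  exact (hu.pow N).mul_left_eq_zero.1 h
end SepPart

section Degrees
open Polynomial IntermediateField

variable {L Ω ι : Type*} [Field L] [Field Ω] [Algebra L Ω]

lemma relfinrank_adjoin_ne_zero {B : IntermediateField L Ω} {S : Set Ω} [Finite S]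
    (hS : ∀ z ∈ S, IsAlgebraic B z) (h : B ≤ adjoin L S) : relfinrank B (adjoin L S) ≠ 0 := by
  rw [relfinrank_eq_finrank_of_le h, extendScalars_adjoin h]
  have := finiteDimensional_adjoin (K := B) (S := S) fun z hz => (hS z hz).isIntegral
  exact Module.finrank_pos.ne'

lemma relfinrank_adjoin_aeval {t : Ω} (ht : Transcendental L t) (f : L[X]) :
    relfinrank L⟮aeval t f⟯ L⟮t⟯ = f.natDegree := by
  let e : RatFunc L →ₐ[L] Ω := L⟮t⟯.val.comp (RatFunc.algEquivOfTranscendental t ht).toAlgHom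
  let r : RatFunc L := algebraMap L[X] (RatFunc L) f
  have he : e r = aeval t f := by
    simp [e, r]
  have hr : relfinrank L⟮r⟯ ⊤ = f.natDegree := by
    rw [relfinrank_top_right, RatFunc.finrank_eq_max_natDegree]
    simp [r]
  rw [← hr, ← relfinrank_map_map _ _ e]
  congr 1
  · rw [adjoin_map, Set.image_singleton, he]
  · rw [← AlgHom.fieldRange_eq_map]
    ext z
    simp [e, AlgHom.mem_fieldRange]
    constructor
    · intro hz
      obtain ⟨a, ha⟩ := (RatFunc.algEquivOfTranscendental t ht).surjective ⟨z, hz⟩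
      exact ⟨a, by rw [ha]⟩
    · rintro ⟨a, rfl⟩
      exact SetLike.coe_mem _

lemma isAlgebraic_of_eq_add_aeval {B : IntermediateField L Ω} {x y : Ω} {γ : L} {ψ : L[X]}
    (hψ : 0 < ψ.natDegree) (hx : x ∈ B) (h : x = algebraMap L Ω γ + aeval y ψ) :
    IsAlgebraic B y := by
  refine ⟨ψ.map (algebraMap L B) - C (⟨x, hx⟩ - algebraMap L B γ), ?_, ?_⟩
  · intro h0
    have := congrArg natDegree h0
    rw [natDegree_sub_C, natDegree_map] at this
    simp at this
    omega
  · simp [h, ← IsScalarTower.algebraMap_apply]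

lemma aeval_mem_of_mem {B : IntermediateField L Ω} {y : Ω} (hy : y ∈ B) (f : L[X]) :
    aeval y f ∈ B := by
  have h := IntermediateField.aeval_coe B ⟨y, hy⟩ f
  exact h ▸ SetLike.coe_mem _

lemma adjoin_range_le_of_eq_add_aeval {x y : ι → Ω} {γ : ι → L} {ψ : L[X]}
    (hxy : ∀ i, x i = algebraMap L Ω (γ i) + aeval (y i) ψ) :
    adjoin L (Set.range x) ≤ adjoin L (Set.range y) := by
  rw [adjoin_le_iff]
  rintro _ ⟨j, rfl⟩
  rw [hxy]
  exact add_mem (IntermediateField.algebraMap_mem _ _)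
    (aeval_mem_of_mem (subset_adjoin L (Set.range y) (Set.mem_range_self j)) ψ)

lemma exists_natDegree_le_mul_relfinrank [Finite ι] (x : ι → Ω)
    (hx : ∃ i, Transcendental L (x i)) :
    ∃ e : ℕ, ∀ (ψ : L[X]) (y : ι → Ω) (γ : ι → L), 0 < ψ.natDegree →
      (∀ i, x i = algebraMap L Ω (γ i) + aeval (y i) ψ) →
      ψ.natDegree ≤ e * relfinrank (adjoin L (Set.range x)) (adjoin L (Set.range y)) := by
  let Pr : Set ι → Prop := fun s => ∃ i, Transcendental (adjoin L (x '' s)) (x i)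
  have h0 : Pr ∅ := by
    obtain ⟨i, hi⟩ := hx
    refine ⟨i, fun h => hi ?_⟩
    rw [Set.image_empty] at h
    have : Algebra.IsAlgebraic L (adjoin L (∅ : Set Ω)) := by
      rw [adjoin_empty]; infer_instance
    exact h.restrictScalars L
  obtain ⟨s, -, ⟨i, hi⟩, hs⟩ := Finite.exists_le_maximal h0
  let N := adjoin L (x '' s)
  let B : IntermediateField L Ω := adjoin L (x '' insert i s)
  have hBN : (adjoin N {x i}).restrictScalars L = B := by
    rw [adjoin_adjoin_left, Set.union_comm, ← Set.insert_eq, ← Set.image_insert_eq]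
  have hB (j : ι) : IsAlgebraic B (x j) := by
    by_contra hj
    have := hs ⟨j, hj⟩ (Set.subset_insert i s) (Set.mem_insert i s)
    exact hi (isAlgebraic_algebraMap (⟨x i, subset_adjoin _ _ ⟨i, this, rfl⟩⟩ : N))
  have hBx : B ≤ adjoin L (Set.range x) := adjoin.mono _ _ _ (Set.image_subset_range _ _)
  refine ⟨relfinrank B (adjoin L (Set.range x)), fun ψ y γ hψ hxy => ?_⟩
  have hxL : adjoin L (Set.range x) ≤ adjoin L (Set.range y) := adjoin_range_le_of_eq_add_aeval hxy
  have hxmem (j : ι) : x j ∈ adjoin L (Set.range x) := subset_adjoin _ _ ⟨j, rfl⟩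
  rw [relfinrank_mul_relfinrank hBx hxL]
  have hne : relfinrank B (adjoin L (Set.range y)) ≠ 0 := by
    rw [← relfinrank_mul_relfinrank hBx hxL]
    refine mul_ne_zero (relfinrank_adjoin_ne_zero ?_ hBx) (relfinrank_adjoin_ne_zero ?_ hxL)
    · rintro _ ⟨j, rfl⟩
      exact hB j
    · rintro _ ⟨j, rfl⟩
      exact isAlgebraic_of_eq_add_aeval hψ (hxmem j) (hxy j)
  let f : N[X] := ψ.map (algebraMap L N) + C (algebraMap L N (γ i))
  have hf : aeval (y i) f = x i := by
    simp [f, hxy, ← IsScalarTower.algebraMap_apply, add_comm]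
  have hfdeg : f.natDegree = ψ.natDegree := by
    rw [natDegree_add_C, natDegree_map]
  have hyi : Transcendental N (y i) :=
    (transcendental_aeval_iff.1 (by rwa [hf] : Transcendental N (aeval (y i) f))).1
  let By : IntermediateField L Ω := (adjoin N {y i}).restrictScalars L
  have hdeg : relfinrank B By = ψ.natDegree := by
    rw [← hfdeg, ← relfinrank_adjoin_aeval hyi f, hf, ← hBN]
    rfl
  have hBBy : B ≤ By := by
    rw [← hBN]
    change (adjoin N {x i}) ≤ adjoin N {y i}
    rw [adjoin_le_iff, Set.singleton_subset_iff, ← hf]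
    exact aeval_mem_of_mem (mem_adjoin_simple_self N (y i)) f
  have hByy : By ≤ adjoin L (Set.range y) := by
    change (adjoin N {y i}).restrictScalars L ≤ _
    rw [adjoin_adjoin_left, adjoin_le_iff]
    rintro _ (⟨j, -, rfl⟩ | rfl)
    · exact hxL (hxmem j)
    · exact subset_adjoin _ _ ⟨i, rfl⟩
  rw [← hdeg]
  refine Nat.le_of_dvd (Nat.pos_of_ne_zero hne) ⟨_, (relfinrank_mul_relfinrank hBBy hByy).symm⟩

/-- The number of `L`-rational translations by zeros of `ψ` preserving the locus of `y` over `L`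
is at least the degree of `L(y)` over `L(ψ(y))`. -/
lemma relfinrank_le_ncard [Finite ι] [IsSepClosed L] {ψ : L[X]} {u : L} (hu : u ≠ 0)
    (hψ' : derivative ψ = C u) (hψ : 0 < ψ.natDegree)
    (hadd : ∀ a b : AlgebraicClosure Ω, aeval (a + b) ψ = aeval a ψ + aeval b ψ)
    (x y : ι → Ω) (γ : ι → L) (hxy : ∀ i, x i = algebraMap L Ω (γ i) + aeval (y i) ψ) :
    relfinrank (adjoin L (Set.range x)) (adjoin L (Set.range y)) ≤
      {k : ι → L | (∀ i, eval (k i) ψ = 0) ∧ ∀ f : MvPolynomial ι L, MvPolynomial.aeval y f = 0 →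
        MvPolynomial.aeval (y + fun i => algebraMap L Ω (k i)) f = 0}.ncard := by
  classical
  set H := {k : ι → L | (∀ i, eval (k i) ψ = 0) ∧ ∀ f : MvPolynomial ι L,
    MvPolynomial.aeval y f = 0 → MvPolynomial.aeval (y + fun i => algebraMap L Ω (k i)) f = 0}
    with hH
  have hψ0 : ψ ≠ 0 := by rintro rfl; simp at hψ
  have hHfin : H.Finite := by
    refine (Set.Finite.pi' fun _ : ι => (ψ.roots.toFinset.finite_toSet)).subset ?_
    rintro k ⟨hk, -⟩ i
    simpa [hψ0] using hk i
  let F₀ := adjoin L (Set.range x)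
  have hxmem (j : ι) : x j ∈ F₀ := subset_adjoin _ _ ⟨j, rfl⟩
  have hxL : F₀ ≤ adjoin L (Set.range y) := adjoin_range_le_of_eq_add_aeval hxy
  rw [relfinrank_eq_finrank_of_le hxL, extendScalars_adjoin hxL]
  let M := adjoin F₀ (Set.range y)
  have : FiniteDimensional F₀ M := by
    refine finiteDimensional_adjoin ?_
    rintro _ ⟨j, rfl⟩
    exact (isAlgebraic_of_eq_add_aeval hψ (hxmem j) (hxy j)).isIntegral
  have : Algebra.IsSeparable F₀ M := by
    rw [isSeparable_adjoin_iff_isSeparable]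
    rintro _ ⟨j, rfl⟩
    let q : F₀[X] := ψ.map (algebraMap L F₀) - C (⟨x j, hxmem j⟩ - algebraMap L F₀ (γ j))
    have hq : q.Separable := by
      rw [separable_def]
      have : derivative q = C (algebraMap L F₀ u) := by
        simp [q, derivative_map, hψ']
      rw [this]
      exact ⟨0, C (algebraMap L F₀ u)⁻¹, by rw [← C_mul]; simp [hu]⟩
    refine hq.of_dvd (minpoly.dvd _ _ ?_)
    simp [q, hxy, ← IsScalarTower.algebraMap_apply]
  let Kb := AlgebraicClosure Ω
  rw [← AlgHom.card F₀ M Kb, ← Nat.card_eq_fintype_card]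
  have : IsScalarTower L M Ω := IsScalarTower.of_algebraMap_eq fun _ => rfl
  have hyM (i : ι) : y i ∈ M := subset_adjoin _ _ ⟨i, rfl⟩
  let yM : ι → M := fun i => ⟨y i, hyM i⟩
  have hsplit : ψ.Splits := by
    refine IsSepClosed.splits_of_separable _ ?_
    rw [separable_def, hψ']
    exact ⟨0, C u⁻¹, by rw [zero_mul, zero_add, ← C_mul, inv_mul_cancel₀ hu, C_1]⟩
  have hσ (σ : M →ₐ[F₀] Kb) (i : ι) :
      ∃ k : L, eval k ψ = 0 ∧ σ (yM i) = algebraMap Ω Kb (y i) + algebraMap L Kb k := by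
    let z : F₀ := ⟨x i, hxmem i⟩ - algebraMap L F₀ (γ i)
    have hz : algebraMap F₀ Ω z = aeval (y i) ψ := by
      simp [z, hxy]
    have h1 : aeval (yM i) ψ = algebraMap F₀ M z := by
      apply (algebraMap M Ω).injective
      rw [← aeval_algebraMap_apply, ← IsScalarTower.algebraMap_apply, hz]
      rfl
    have h2 : aeval (σ (yM i)) ψ = aeval (algebraMap Ω Kb (y i)) ψ := by
      rw [aeval_algebraMap_apply, ← hz, ← IsScalarTower.algebraMap_apply F₀ Ω Kb,
        ← σ.commutes, ← h1]
      exact aeval_algHom_apply (σ.restrictScalars L) _ _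
    have h3 : aeval (σ (yM i) - algebraMap Ω Kb (y i)) ψ = 0 := by
      have := hadd (σ (yM i) - algebraMap Ω Kb (y i)) (algebraMap Ω Kb (y i))
      rw [sub_add_cancel, h2] at this
      simpa using this
    obtain ⟨k, hk⟩ := hsplit.mem_range_of_isRoot hψ0 (i := algebraMap L Kb)
      (x := σ (yM i) - algebraMap Ω Kb (y i)) (by rwa [IsRoot.def, eval_map_algebraMap])
    refine ⟨k, ?_, by rw [hk]; ring⟩
    rw [← hk, aeval_algebraMap_apply] at h3
    simpa using h3
  choose k hk0 hk using hσ
  have hkH (σ : M →ₐ[F₀] Kb) : k σ ∈ H := by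
    refine ⟨hk0 σ, fun f hf => ?_⟩
    apply (algebraMap Ω Kb).injective
    have hyM0 : MvPolynomial.aeval yM f = 0 := by
      apply (algebraMap M Ω).injective
      rw [← MvPolynomial.aeval_algebraMap_apply, map_zero]
      exact hf
    rw [map_zero, ← MvPolynomial.aeval_algebraMap_apply]
    have h4 : MvPolynomial.aeval (fun i => σ (yM i)) f = 0 := by
      have := MvPolynomial.comp_aeval_apply (σ.restrictScalars L) (f := yM) f
      rw [hyM0, map_zero] at this
      exact this.symm
    rw [← h4]
    congr 2
    funext i
    simp [hk, ← IsScalarTower.algebraMap_apply]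
  have hinj : Function.Injective fun σ : M →ₐ[F₀] Kb => (⟨k σ, hkH σ⟩ : H) := by
    intro σ τ hστ
    refine algHom_ext_of_eq_adjoin _ rfl ?_
    rintro _ ⟨i, rfl⟩
    have : k σ = k τ := congrArg Subtype.val hστ
    exact (hk σ i).trans (by rw [this]; exact (hk τ i).symm)
  have := hHfin.to_subtype
  exact Nat.card_le_card_of_injective _ hinj
end Degrees

section Shifts
open MvPolynomial

variable {σ E A : Type*} [Field E] [CommRing A] [Algebra E A]

/-- A polynomial with coefficients in an extension ring which vanishes on a set of `E`-rational
points is a combination of polynomials over `E` vanishing there. -/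
lemma mem_map_vanishingIdeal {V : Set (σ → E)} {f : MvPolynomial σ A}
    (hf : ∀ v ∈ V, eval (fun i => algebraMap E A (v i)) f = 0) :
    f ∈ (vanishingIdeal E V).map (MvPolynomial.map (algebraMap E A)) := by
  classical
  let b := Module.Free.chooseBasis E A
  let F (j) : MvPolynomial σ E := ∑ m ∈ f.support, monomial m (b.coord j (coeff m f))
  have hF (j) : F j ∈ vanishingIdeal E V := by
    rw [mem_vanishingIdeal_iff]
    intro v hv
    have h := congrArg (b.coord j) (hf v hv)
    rw [eval_eq, map_zero, map_sum] at h
    simp only [F, map_sum, aeval_monomial, Algebra.algebraMap_self, RingHom.id_apply]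
    rw [← h]
    refine Finset.sum_congr rfl fun m _ => ?_
    have h2 : coeff m f * ∏ i ∈ m.support, algebraMap E A (v i) ^ m i =
        (∏ i ∈ m.support, v i ^ m i) • coeff m f := by
      rw [Algebra.smul_def, mul_comm, map_prod]
      simp
    rw [h2, map_smul, smul_eq_mul, mul_comm]
    rfl
  let J := f.support.biUnion fun m => (b.repr (coeff m f)).support
  have hsum : f = ∑ j ∈ J, C (b j) * MvPolynomial.map (algebraMap E A) (F j) := by
    conv_lhs => rw [← support_sum_monomial_coeff f]
    simp only [F, map_sum, Finset.mul_sum, map_monomial, C_mul_monomial]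
    rw [Finset.sum_comm]
    refine Finset.sum_congr rfl fun m hm => ?_
    rw [← map_sum]
    congr 1
    conv_lhs => rw [← b.linearCombination_repr (coeff m f)]
    rw [Finsupp.linearCombination_apply, Finsupp.sum_of_support_subset (s := J)]
    · refine Finset.sum_congr rfl fun j _ => ?_
      rw [Algebra.smul_def, mul_comm]
      rfl
    · exact Finset.subset_biUnion_of_mem (fun m => (b.repr (coeff m f)).support) hm
    · simp
  rw [hsum]
  exact Ideal.sum_mem _ fun j _ => Ideal.mul_mem_left _ _ (Ideal.mem_map_of_mem _ (hF j))

variable (A) in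
/-- The `A`-rational translations mapping a set `V` of `E`-rational points into its Zariski
closure. -/
def shifts (V : Set (σ → E)) : Set (σ → A) :=
  {e | ∀ f ∈ vanishingIdeal E V, ∀ v ∈ V, aeval (fun i => algebraMap E A (v i) + e i) f = 0}

lemma eval_add_eq_zero_of_mem_shifts {V : Set (σ → E)} {e : σ → A} (he : e ∈ shifts A V)
    {f : MvPolynomial σ A} (hf : ∀ v ∈ V, eval (fun i => algebraMap E A (v i)) f = 0)
    {v : σ → E} (hv : v ∈ V) : eval (fun i => algebraMap E A (v i) + e i) f = 0 := by
  have h : (vanishingIdeal E V).map (MvPolynomial.map (algebraMap E A)) ≤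
      RingHom.ker (eval (fun i => algebraMap E A (v i) + e i)) := by
    refine Ideal.map_le_iff_le_comap.2 fun f' hf' => ?_
    rw [Ideal.mem_comap, RingHom.mem_ker, eval_map, ← aeval_def]
    exact he f' hf' v hv
  exact h (mem_map_vanishingIdeal hf)

/-- The polynomial `f(X + e)`. -/
noncomputable def translate (e : σ → A) : MvPolynomial σ A →ₐ[A] MvPolynomial σ A :=
  aeval fun i => X i + C (e i)

lemma eval_translate (e x : σ → A) (f : MvPolynomial σ A) :
    eval x (translate e f) = eval (fun i => x i + e i) f := by
  have h := comp_aeval_apply (fun i => X i + C (e i)) (aeval x : MvPolynomial σ A →ₐ[A] A) f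
  simpa [coe_aeval_eq_eval, translate] using h

lemma add_mem_shifts {V : Set (σ → E)} {e₁ e₂ : σ → A} (h₁ : e₁ ∈ shifts A V)
    (h₂ : e₂ ∈ shifts A V) : e₁ + e₂ ∈ shifts A V := by
  intro f hf v hv
  have h := eval_add_eq_zero_of_mem_shifts h₂
    (f := translate e₁ (MvPolynomial.map (algebraMap E A) f)) (fun v hv => ?_) hv
  · rw [eval_translate, eval_map, ← aeval_def] at h
    convert h using 3
    simp [add_assoc, add_comm]
  · rw [eval_translate, eval_map, ← aeval_def]
    exact h₁ f hf v hv

lemma zero_mem_shifts (V : Set (σ → E)) : (0 : σ → A) ∈ shifts A V := by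
  intro f hf v hv
  have := (mem_vanishingIdeal_iff.1 hf) v hv
  have h := aeval_algebraMap_apply A v f
  rw [this, map_zero] at h
  simpa [Function.comp_def] using h

lemma neg_mem_shifts (p : ℕ) [Fact p.Prime] [CharP A p] {V : Set (σ → E)} {e : σ → A}
    (he : e ∈ shifts A V) : -e ∈ shifts A V := by
  have h (n : ℕ) : n • e ∈ shifts A V := by
    induction n with
    | zero => simpa using zero_mem_shifts V
    | succ n ih => rw [succ_nsmul]; exact add_mem_shifts ih he
  have h1 : (p - 1) • e = -e := by
    rw [eq_neg_iff_add_eq_zero, ← succ_nsmul, Nat.sub_add_cancel (Fact.out : p.Prime).one_lt.le]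
    funext i
    simp
  exact h1 ▸ h (p - 1)

lemma map_mem_shifts {B : Type*} [CommRing B] [Algebra E B] (a : A →ₐ[E] B) {V : Set (σ → E)}
    {e : σ → A} (he : e ∈ shifts A V) : (fun i => a (e i)) ∈ shifts B V := by
  intro f hf v hv
  have h := comp_aeval_apply (fun i => algebraMap E A (v i) + e i) a f
  rw [he f hf v hv, map_zero] at h
  simpa using h.symm

lemma mem_shifts_of_subset {V V' : Set (σ → E)} {e : σ → A} (he : e ∈ shifts A V')
    (hV : V' ⊆ V) (hVV' : vanishingIdeal E V' ≤ vanishingIdeal E V) : e ∈ shifts A V := by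
  intro f hf v hv
  have hf' := vanishingIdeal_anti_mono hV hf
  have h1 : translate e (MvPolynomial.map (algebraMap E A) f) ∈
      (vanishingIdeal E V').map (MvPolynomial.map (algebraMap E A)) := by
    refine mem_map_vanishingIdeal fun v hv => ?_
    rw [eval_translate, eval_map, ← aeval_def]
    exact he f hf' v hv
  have h2 : (vanishingIdeal E V').map (MvPolynomial.map (algebraMap E A)) ≤
      RingHom.ker (eval (fun i => algebraMap E A (v i))) := by
    refine Ideal.map_le_iff_le_comap.2 fun f' hf' => ?_
    have := zero_mem_shifts (A := A) V f' (hVV' hf') v hv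
    simpa [eval_map, ← aeval_def] using this
  have h3 := h2 h1
  rwa [RingHom.mem_ker, eval_translate, eval_map, ← aeval_def] at h3

variable (A) in
/-- The group of translations mapping a set into its Zariski closure, in characteristic `p`. -/
def shiftGroup (p : ℕ) [Fact p.Prime] [CharP A p] (V : Set (σ → E)) : AddSubgroup (σ → A) where
  carrier := shifts A V
  add_mem' := add_mem_shifts
  zero_mem' := zero_mem_shifts V
  neg_mem' := neg_mem_shifts p

variable (A) in
/-- The ideal of equations of `shifts A V`. -/
noncomputable def shiftIdeal (V : Set (σ → E)) : Ideal (MvPolynomial σ A) :=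
  Ideal.span {h | ∃ f ∈ vanishingIdeal E V, ∃ v ∈ V,
    h = aeval (fun i => C (algebraMap E A (v i)) + X i) f}

lemma forall_mem_shiftIdeal_iff {B : Type*} [CommRing B] [Algebra E B] [Algebra A B]
    [IsScalarTower E A B] (V : Set (σ → E)) (e : σ → B) :
    (∀ h ∈ shiftIdeal A V, aeval e h = 0) ↔ e ∈ shifts B V := by
  have key (f : MvPolynomial σ E) (v : σ → E) :
      aeval e (aeval (fun i => C (algebraMap E A (v i)) + X i) f : MvPolynomial σ A) =
        aeval (fun i => algebraMap E B (v i) + e i) f := by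
    have := comp_aeval_apply (fun i => C (algebraMap E A (v i)) + X i)
      ((aeval e : MvPolynomial σ A →ₐ[A] B).restrictScalars E) f
    simpa [← IsScalarTower.algebraMap_apply] using this
  constructor
  · intro h f hf v hv
    rw [← key]
    exact h _ (Ideal.subset_span ⟨f, hf, v, hv, rfl⟩)
  · intro he
    have : shiftIdeal A V ≤ RingHom.ker (aeval (R := A) e) := by
      refine Ideal.span_le.2 ?_
      rintro _ ⟨f, hf, v, hv, rfl⟩
      exact (key f v).trans (he f hf v hv)
    exact fun h hh => this hh

/-- If only finitely many points of an algebraically closed field are shifts of `V`, then the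
nilpotent shifts have bounded order of nilpotency. -/
lemma exists_pow_eq_zero_of_finite_shifts [Finite σ] {C : Type*} [Field C] [IsAlgClosed C]
    [Algebra E C] {V : Set (σ → E)} (hV : (shifts C V).Finite) :
    ∃ N : ℕ, ∀ (B : Type*) [CommRing B] [Algebra E B] [Algebra C B] [IsScalarTower E C B]
      (e : σ → B), (∀ i, IsNilpotent (e i)) → e ∈ shifts B V → ∀ i, e i ^ N = 0 := by
  classical
  have hzl : zeroLocus C (shiftIdeal C V) = shifts C V := by
    ext z
    exact forall_mem_shiftIdeal_iff V z
  have h (i : σ) : ∃ r : ℕ,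
      (∏ z ∈ hV.toFinset, (X i - MvPolynomial.C (z i))) ^ r ∈ shiftIdeal C V := by
    rw [← Ideal.mem_radical_iff, ← vanishingIdeal_zeroLocus_eq_radical (K := C), hzl,
      mem_vanishingIdeal_iff]
    intro z hz
    rw [map_prod]
    exact Finset.prod_eq_zero (hV.mem_toFinset.2 hz) (by simp)
  choose r hr using h
  obtain ⟨M, hM⟩ := (Set.finite_range r).bddAbove
  refine ⟨hV.toFinset.card * M, fun B _ _ _ _ e he heV i => ?_⟩
  have h0 := (forall_mem_shiftIdeal_iff V e).2 heV _ (hr i)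
  rw [map_pow, map_prod] at h0
  have hdvd : ∏ z ∈ hV.toFinset, aeval e (X i - MvPolynomial.C (z i)) ∣
      e i ^ hV.toFinset.card := by
    rw [← Finset.prod_const]
    refine Finset.prod_dvd_prod_of_dvd _ _ fun z _ => ?_
    rw [map_sub, aeval_X, aeval_C]
    by_cases hz : z i = 0
    · simp [hz]
    · refine IsUnit.dvd ?_
      rw [sub_eq_neg_add]
      exact IsNilpotent.isUnit_add_left_of_commute (he i)
        ((IsUnit.mk0 _ hz).map (algebraMap C B)).neg (Commute.all _ _)
  have h1 : e i ^ (hV.toFinset.card * r i) = 0 := by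
    rw [pow_mul]
    exact zero_dvd_iff.1 (h0 ▸ pow_dvd_pow_of_dvd hdvd (r i))
  exact pow_eq_zero_of_le (Nat.mul_le_mul_left _ (hM ⟨i, rfl⟩)) h1

open TensorProduct in
lemma mem_range_of_one_tmul_eq {E L C : Type*} [Field E] [Field L] [Field C] [Algebra E L]
    [Algebra L C] [Algebra E C] [IsScalarTower E L C] {x : L}
    (h : (1 : C) ⊗ₜ[E] x = algebraMap L C x ⊗ₜ[E] (1 : L)) : x ∈ (algebraMap E L).range := by
  by_contra hx
  have hx' : x ∉ Submodule.span E {(1 : L)} := by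
    rw [Submodule.mem_span_singleton]
    rintro ⟨a, rfl⟩
    exact hx ⟨a, Algebra.algebraMap_eq_smul_one a⟩
  obtain ⟨l, hlx, hl⟩ := Submodule.exists_dual_map_eq_bot_of_notMem hx' inferInstance
  have hl1 : l 1 = 0 := by
    have : l 1 ∈ (Submodule.span E {(1 : L)}).map l :=
      Submodule.mem_map_of_mem (Submodule.mem_span_singleton_self 1)
    rwa [hl] at this
  have h2 := congrArg (fun z => TensorProduct.rid E C (l.lTensor C z)) h
  simp [hl1] at h2
  exact hlx h2

lemma exists_mem_forall_eval_eq_zero {α : Type*} [Finite σ] (𝒰 : Filter α) (v : α → σ → E) :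
    ∃ S ∈ 𝒰, ∀ f : MvPolynomial σ E, (∀ᶠ a in 𝒰, eval (v a) f = 0) →
      ∀ a ∈ S, eval (v a) f = 0 := by
  let P : Ideal (MvPolynomial σ E) :=
    { carrier := {f | ∀ᶠ a in 𝒰, eval (v a) f = 0}
      add_mem' := fun hf hg => by filter_upwards [hf, hg] with a h1 h2; simp [h1, h2]
      zero_mem' := by simp
      smul_mem' := fun c f hf => by filter_upwards [hf] with a h1; simp [h1] }
  obtain ⟨T, hT⟩ := (isNoetherianRing_iff_ideal_fg _).1 inferInstance P
  refine ⟨{a | ∀ f ∈ T, eval (v a) f = 0}, ?_, fun f hf a ha => ?_⟩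
  · refine (Filter.eventually_all_finset T).2 fun f hf => ?_
    exact (hT ▸ Ideal.subset_span hf : f ∈ P)
  · have : P ≤ RingHom.ker (eval (v a)) := hT ▸ Ideal.span_le.2 fun f hf => ha f hf
    exact this hf
end Shifts

section Infinitesimal
open MvPolynomial TensorProduct

lemma isNilpotent_aeval {L A : Type*} [Field L] [CommRing A] [Algebra L A] {f : Polynomial L}
    (h0 : f.coeff 0 = 0) {e : A} (he : IsNilpotent e) : IsNilpotent (Polynomial.aeval e f) := by
  obtain ⟨f₁, rfl⟩ := Polynomial.X_dvd_iff.2 h0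
  rw [map_mul, Polynomial.aeval_X]
  exact (Commute.all _ _).isNilpotent_mul_right he

/-- Adding `aeval e ψ` to points `γ + ψ(v)` corresponds to adding `e` to `v`. -/
lemma aeval_mem_shifts {σ E L A : Type*} [Field E] [Field L] [CommRing A] [Algebra E L]
    [Algebra L A] [Algebra E A] [IsScalarTower E L A] {ψ : Polynomial L}
    (hadd : ∀ x y : A, Polynomial.aeval (x + y) ψ = Polynomial.aeval x ψ + Polynomial.aeval y ψ)
    {V : Set (σ → E)} {e : σ → A} (he : e ∈ shifts A V) (γ : σ → L) :
    (fun i => Polynomial.aeval (e i) ψ) ∈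
      shifts A ((fun v i => γ i + Polynomial.aeval (algebraMap E L (v i)) ψ) '' V) := by
  rintro f hf _ ⟨v, hv, rfl⟩
  let F : MvPolynomial σ A :=
    aeval (fun i => C (algebraMap L A (γ i)) +
      Polynomial.aeval (X i : MvPolynomial σ A) ψ) f
  have hF (x : σ → A) :
      eval x F = aeval (fun i => algebraMap L A (γ i) + Polynomial.aeval (x i) ψ) f := by
    have h := comp_aeval_apply (fun i => C (algebraMap L A (γ i)) +
      Polynomial.aeval (X i : MvPolynomial σ A) ψ)
      ((aeval x : MvPolynomial σ A →ₐ[A] A).restrictScalars L) f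
    refine h.trans ?_
    congr 2
    funext i
    have h2 := Polynomial.aeval_algHom_apply
      ((aeval x : MvPolynomial σ A →ₐ[A] A).restrictScalars L) (X i) ψ
    simpa using h2.symm
  have h := eval_add_eq_zero_of_mem_shifts he (f := F) (fun v hv => ?_) hv
  · rw [hF] at h
    convert h using 3
    funext i
    simp only [hadd, ← add_assoc, map_add, IsScalarTower.algebraMap_apply E L A,
      Polynomial.aeval_algebraMap_apply]
  · rw [hF]
    have h2 := (mem_vanishingIdeal_iff.1 hf) _ ⟨v, hv, rfl⟩
    have h3 := aeval_algebraMap_apply A (fun i => γ i +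
      Polynomial.aeval (algebraMap E L (v i)) ψ) f
    rw [h2, map_zero] at h3
    convert h3 using 3
    funext i
    simp only [Function.comp, map_add, IsScalarTower.algebraMap_apply E L A,
      Polynomial.aeval_algebraMap_apply]

/-- A purely inseparable shift of the preimages under `γ + ψ` of points of `W` becomes rational
after a bounded power of Frobenius. -/
lemma pow_mem_range_of_mem_shifts {σ : Type*} {E L C : Type u} [Field E] [Field L] [Field C]
    [Algebra E L] [Algebra L C] [Algebra E C] [IsScalarTower E L C]
    (p : ℕ) [Fact p.Prime] [CharP L p] {ψ : Polynomial L}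
    (hadd : ∀ (A : Type u) [CommRing A] [Algebra L A] [CharP A p] (x y : A),
      Polynomial.aeval (x + y) ψ = Polynomial.aeval x ψ + Polynomial.aeval y ψ)
    (h0 : ψ.coeff 0 = 0) (h1 : ψ.coeff 1 ≠ 0) {W : Set (σ → L)} {m : ℕ}
    (hW : ∀ (B : Type u) [CommRing B] [Algebra L B] [Algebra C B] [IsScalarTower L C B]
      (e : σ → B), (∀ i, IsNilpotent (e i)) → e ∈ shifts B W → ∀ i, e i ^ p ^ m = 0)
    {V : Set (σ → E)} {γ : σ → L}
    (hVW : (fun v i => γ i + Polynomial.aeval (algebraMap E L (v i)) ψ) '' V ⊆ W)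
    (hVW' : vanishingIdeal L
        ((fun v i => γ i + Polynomial.aeval (algebraMap E L (v i)) ψ) '' V) ≤
      vanishingIdeal L W)
    {k : σ → L} (hk : k ∈ shifts L V) {M : ℕ}
    (hkE : ∀ i, k i ^ p ^ M ∈ (algebraMap E L).range) (i : σ) :
    k i ^ p ^ m ∈ (algebraMap E L).range := by
  let A := C ⊗[E] L
  have : CharP A p := charP_of_injective_algebraMap (algebraMap L A).injective p
  let a : L →ₐ[E] A := Algebra.TensorProduct.includeRight
  let b : L →ₐ[E] A := IsScalarTower.toAlgHom E L A
  let e : σ → A := fun i => a (k i) - b (k i)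
  have he : e ∈ shifts A V := by
    have := add_mem_shifts (map_mem_shifts a hk) (neg_mem_shifts p (map_mem_shifts b hk))
    convert this using 1
    funext i
    exact sub_eq_add_neg _ _
  have hpow (i : σ) (r : ℕ) : e i ^ p ^ r = a (k i ^ p ^ r) - b (k i ^ p ^ r) := by
    rw [map_pow, map_pow]
    exact sub_pow_char_pow ..
  have hnil (i : σ) : IsNilpotent (e i) := by
    obtain ⟨z, hz⟩ := hkE i
    refine ⟨p ^ M, ?_⟩
    rw [hpow, ← hz, a.commutes, b.commutes, sub_self]
  have h2 := mem_shifts_of_subset (aeval_mem_shifts (hadd A) he γ) hVW hVW'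
  have h3 := pow_eq_zero_of_aeval_pow_eq_zero h0 h1 (hnil i)
    (hW A _ (fun i => isNilpotent_aeval h0 (hnil i)) h2 i)
  rw [hpow, sub_eq_zero] at h3
  exact mem_range_of_one_tmul_eq h3
end Infinitesimal

section Core
open MvPolynomial

lemma exists_ultrapower {α L : Type u} [Field L] (𝒰 : Ultrafilter α) :
    ∃ (Ω : Type u) (_ : Field Ω) (_ : Algebra L Ω) (π : (α → L) →ₐ[L] Ω),
      ∀ u, π u = 0 ↔ ∀ᶠ a in 𝒰, u a = 0 := by
  let π : (α → L) →+* (𝒰 : Filter α).Germ L := Filter.Germ.coeRingHom (𝒰 : Filter α)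
  let alg : Algebra L ((𝒰 : Filter α).Germ L) := (π.comp (algebraMap L (α → L))).toAlgebra
  refine ⟨(𝒰 : Filter α).Germ L, inferInstance, alg, { π with commutes' := fun _ => rfl }, ?_⟩
  exact fun u => Filter.Germ.coe_eq

lemma aeval_ultrapower_eq_zero_iff {α L Ω σ : Type*} [Field L] [Field Ω] [Algebra L Ω]
    {𝒰 : Filter α} {π : (α → L) →ₐ[L] Ω} (hπ : ∀ u, π u = 0 ↔ ∀ᶠ a in 𝒰, u a = 0)
    (u : σ → α → L) (f : MvPolynomial σ L) :
    aeval (fun i => π (u i)) f = 0 ↔ ∀ᶠ a in 𝒰, eval (fun i => u i a) f = 0 := by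
  rw [← comp_aeval_apply, hπ]
  refine Filter.eventually_congr (Filter.Eventually.of_forall fun a => ?_)
  have := comp_aeval_apply u (Pi.evalAlgHom L (fun _ : α => L) a) f
  exact Eq.congr_left (this.trans (RingHom.congr_fun (coe_aeval_eq_eval _) f))

lemma exists_transcendental_of_le_cofinite {σ L Ω : Type*} [Finite σ] [Field L] [Field Ω]
    [Algebra L Ω] {𝒰 : Ultrafilter (σ → L)} (h𝒰 : (𝒰 : Filter (σ → L)) ≤ Filter.cofinite)
    {π : ((σ → L) → L) →ₐ[L] Ω} (hπ : ∀ u, π u = 0 ↔ ∀ᶠ a in 𝒰, u a = 0) :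
    ∃ i, Transcendental L (π fun w => w i) := by
  by_contra! h
  have h1 (i : σ) : ∃ F : Set L, F.Finite ∧ ∀ᶠ w : σ → L in 𝒰, w i ∈ F := by
    classical
    obtain ⟨f, hf0, hf⟩ := not_not.1 (h i)
    refine ⟨f.roots.toFinset, Finset.finite_toSet _, ?_⟩
    rw [Polynomial.aeval_algHom_apply, hπ] at hf
    filter_upwards [hf] with w hw
    have := Polynomial.aeval_algHom_apply (Pi.evalAlgHom L (fun _ : σ → L => L) w)
      (fun w => w i) f
    have h2 : Polynomial.aeval (w i) f = 0 := this.trans hw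
    simpa [hf0] using h2
  choose F hF hF' using h1
  have h2 : {w : σ → L | ∀ i, w i ∈ F i} ∈ (𝒰 : Filter (σ → L)) := Filter.eventually_all.2 hF'
  have h3 := h𝒰 (Set.Finite.pi' hF).compl_mem_cofinite
  exact 𝒰.compl_mem_iff_notMem.1 h3 h2

/-- An infinite set of points which for every `n` is covered by finitely many translates of the
image of `φ^n` contains a nonempty subset whose Zariski closure is invariant under infinitely many
translations. -/
theorem exists_infinite_shifts {L C : Type u} [Field L] [IsSepClosed L] [Field C] [IsAlgClosed C]
    [Algebra L C] (p : ℕ) [Fact p.Prime] [CharP L p] {d D : ℕ} (hd : 1 ≤ d) (hdD : d < D)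
    {c : ℕ → L} (hcd : c d ≠ 0) (hcD : c D ≠ 0)
    (hT : {x : L | ∃ n, (specialTphi p d D c)^[n] x = 0}.Finite)
    {σ : Type} [Finite σ] {W₀ : Set (σ → L)} (hW₀ : W₀.Infinite)
    (hcover : ∀ n, ∃ R : Set (σ → L), R.Finite ∧ ∀ w ∈ W₀, ∃ r ∈ R, ∃ y : σ → L,
      w = fun i => r i + (specialTphi p d D c)^[n] (y i)) :
    ∃ W ⊆ W₀, W.Nonempty ∧ (shifts C W).Infinite := by
  have hne : (Filter.cofinite ⊓ Filter.principal W₀).NeBot := hW₀.cofinite_inf_principal_neBot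
  let 𝒰 := Ultrafilter.of (Filter.cofinite ⊓ Filter.principal W₀)
  have h𝒰 := Ultrafilter.of_le (Filter.cofinite ⊓ Filter.principal W₀)
  have h𝒰c : (𝒰 : Filter (σ → L)) ≤ Filter.cofinite := h𝒰.trans inf_le_left
  have h𝒰W : W₀ ∈ (𝒰 : Filter (σ → L)) :=
    (h𝒰.trans inf_le_right) (Filter.mem_principal_self W₀)
  obtain ⟨S₀, hS₀, hS₀'⟩ := exists_mem_forall_eval_eq_zero (𝒰 : Filter (σ → L)) id
  let W := S₀ ∩ W₀
  have hW : W ∈ (𝒰 : Filter (σ → L)) := Filter.inter_mem hS₀ h𝒰W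
  refine ⟨W, Set.inter_subset_right, Filter.nonempty_of_mem hW, fun hfin => ?_⟩
  obtain ⟨N, hN⟩ := exists_pow_eq_zero_of_finite_shifts hfin
  have hp := (Fact.out : p.Prime).one_lt
  have hN' : N ≤ p ^ (d * N) :=
    (Nat.lt_pow_self hp).le.trans (Nat.pow_le_pow_right hp.le (Nat.le_mul_of_pos_left N hd))
  obtain ⟨Ω, _, _, π, hπ⟩ := exists_ultrapower (L := L) 𝒰
  obtain ⟨e, he⟩ := exists_natDegree_le_mul_relfinrank (fun i => π fun w => w i)
    (exists_transcendental_of_le_cofinite h𝒰c hπ)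
  let T' : Set L := {l | ∃ n, (specialTphi p d D c)^[n] ((sepPart p d D c 0 N).eval l) = 0}
  have hT' : T'.Finite := by
    classical
    refine Set.Finite.preimage' (f := fun l => (sepPart p d D c 0 N).eval l) hT fun t _ => ?_
    have hq : sepPart p d D c 0 N - Polynomial.C t ≠ 0 := fun h => by
      have := congrArg Polynomial.natDegree h
      rw [Polynomial.natDegree_sub_C, natDegree_sepPart p hdD.le hcD, Polynomial.natDegree_zero]
        at this
      exact (pow_pos (zero_lt_one.trans hp) _).ne' this
    refine (sepPart p d D c 0 N - Polynomial.C t).roots.toFinset.finite_toSet.subset ?_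
    intro l hl
    rw [Set.mem_preimage, Set.mem_singleton_iff] at hl
    simp [hq, hl]
  have hTg : {l : σ → L | ∀ i, l i ∈ T'}.Finite := Set.Finite.pi' fun _ => hT'
  suffices H : ∀ n, N ≤ n → p ^ ((D - d) * n) ≤ e * {l : σ → L | ∀ i, l i ∈ T'}.ncard by
    have h1 := H (N + e * {l : σ → L | ∀ i, l i ∈ T'}.ncard) (Nat.le_add_right _ _)
    have h2 := Nat.lt_pow_self (n := (D - d) * (N + e * {l : σ → L | ∀ i, l i ∈ T'}.ncard)) hp
    have h3 := Nat.le_mul_of_pos_left (N + e * {l : σ → L | ∀ i, l i ∈ T'}.ncard)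
      (Nat.sub_pos_of_lt hdD)
    omega
  intro n hn
  let ψ := sepPart p d D c 0 n
  have hψdeg : ψ.natDegree = p ^ ((D - d) * n) := natDegree_sepPart p hdD.le hcD 0 n
  have hψpos : 0 < ψ.natDegree := hψdeg ▸ pow_pos (zero_lt_one.trans hp) _
  obtain ⟨u, hu, hψu⟩ := exists_derivative_sepPart (p := p) hdD.le hcd 0 n
  have hadd (A : Type u) [CommRing A] [Algebra L A] [CharP A p] (x y : A) :
      Polynomial.aeval (x + y) ψ = Polynomial.aeval x ψ + Polynomial.aeval y ψ :=
    aeval_sepPart_add p d D c 0 n x y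
  have hψ0 : ψ.coeff 0 = 0 := by
    have := hadd L 0 0
    rw [add_zero, left_eq_add] at this
    rwa [Polynomial.coeff_zero_eq_eval_zero, ← Polynomial.coe_aeval_eq_eval]
  have hψ1 : ψ.coeff 1 ≠ 0 := by
    have := congrArg (Polynomial.coeff · 0) hψu
    simp only [Polynomial.coeff_derivative, Polynomial.coeff_C_zero] at this
    simpa [ψ, ← this] using hu
  let E := (iterateFrobenius L p (d * n)).fieldRange
  obtain ⟨R, hR, hRW⟩ := hcover n
  obtain ⟨γ, hγ⟩ : ∃ γ : σ → L, ∀ᶠ w in 𝒰, ∃ v : σ → E,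
      (fun i => γ i + Polynomial.aeval (algebraMap E L (v i)) ψ) = w := by
    have : (⋃ γ ∈ R, {w : σ → L | ∃ v : σ → E,
        (fun i => γ i + Polynomial.aeval (algebraMap E L (v i)) ψ) = w}) ∈ 𝒰 := by
      filter_upwards [h𝒰W] with w hw
      obtain ⟨r, hr, y, rfl⟩ := hRW w hw
      refine Set.mem_biUnion hr ⟨fun i => ⟨iterateFrobenius L p (d * n) (y i), y i, rfl⟩, ?_⟩
      funext i
      rw [iterate_specialTphi, ← iterateFrobenius_def]
      rfl
    obtain ⟨γ, -, h⟩ := (Ultrafilter.finite_biUnion_mem_iff hR).1 this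
    exact ⟨γ, h⟩
  obtain ⟨v, hv⟩ : ∃ v : (σ → L) → σ → E, ∀ᶠ w in 𝒰,
      (fun i => γ i + Polynomial.aeval (algebraMap E L (v w i)) ψ) = w := by
    classical
    refine ⟨fun w => if h : _ then Classical.choose (p := fun v : σ → E =>
      (fun i => γ i + Polynomial.aeval (algebraMap E L (v i)) ψ) = w) h else 0, ?_⟩
    filter_upwards [hγ] with w hw
    rw [dif_pos hw]
    exact Classical.choose_spec hw
  let y : σ → Ω := fun i => π fun w => (v w i : L)
  have hxy (i : σ) : (π fun w => w i) = algebraMap L Ω (γ i) + Polynomial.aeval (y i) ψ := by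
    rw [Polynomial.aeval_algHom_apply, ← π.commutes, ← map_add, ← sub_eq_zero, ← map_sub, hπ]
    filter_upwards [hv] with w hw
    have h1 := congrFun hw i
    have h2 := Polynomial.aeval_algHom_apply (Pi.evalAlgHom L (fun _ : σ → L => L) w)
      (fun w => (v w i : L)) ψ
    rw [Pi.sub_apply, sub_eq_zero, ← h1]
    exact congrArg (γ i + ·) h2
  have hΩ : CharP (AlgebraicClosure Ω) p :=
    charP_of_injective_algebraMap (algebraMap L (AlgebraicClosure Ω)).injective p
  rw [← hψdeg]
  refine (he ψ y γ hψpos hxy).trans (Nat.mul_le_mul_left e ?_)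
  refine (relfinrank_le_ncard hu hψu hψpos (hadd _) _ y γ hxy).trans ?_
  refine (Set.ncard_le_ncard ?_ (hTg.image fun l i => l i ^ p ^ (d * (n - N)))).trans
    (Set.ncard_image_le hTg)
  rintro k ⟨hk0, hk⟩
  obtain ⟨S, hS, hS'⟩ := exists_mem_forall_eval_eq_zero (𝒰 : Filter (σ → L))
    fun w i => (v w i : L)
  let S₁ := S ∩ W ∩ {w | (fun i => γ i + Polynomial.aeval (algebraMap E L (v w i)) ψ) = w}
  have hS₁ : S₁ ∈ (𝒰 : Filter (σ → L)) := Filter.inter_mem (Filter.inter_mem hS hW) hv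
  have hkV : k ∈ shifts L (v '' S₁) := by
    rintro f hf _ ⟨w, hw, rfl⟩
    let f' := MvPolynomial.map (algebraMap E L) f
    have h1 : aeval y f' = 0 := by
      refine (aeval_ultrapower_eq_zero_iff hπ (fun i w => (v w i : L)) f').2 ?_
      filter_upwards [hS₁] with w hw
      have h2 := (mem_vanishingIdeal_iff.1 hf) _ ⟨w, hw, rfl⟩
      have h3 := aeval_algebraMap_apply L (v w) f
      rw [h2, map_zero] at h3
      rw [eval_map]
      exact h3
    have h2 := hk f' h1
    have h3 := (aeval_ultrapower_eq_zero_iff hπ (fun i w => (v w i : L) + k i) f').1 (by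
      convert h2 using 3
      simp only [y, Pi.add_def, ← π.commutes, ← map_add]
      rfl)
    have h4 := hS' (translate k f') (h3.mono fun w hw => by rwa [eval_translate]) w hw.1.1
    rw [eval_translate, eval_map] at h4
    exact h4
  have himage : (fun v i => γ i + Polynomial.aeval (algebraMap E L (v i)) ψ) '' (v '' S₁) =
      S₁ := by
    rw [Set.image_image]
    conv_rhs => rw [← Set.image_id S₁]
    exact Set.image_congr fun w hw => hw.2
  have hkE := pow_mem_range_of_mem_shifts (C := C) p hadd hψ0 hψ1 (W := W) (m := d * N)
    (fun B _ _ _ _ e he heW i => pow_eq_zero_of_le hN' (hN B e he heW i)) (γ := γ)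
    (himage.trans_subset fun w hw => hw.1.2)
    (by
      rw [himage]
      intro f hf
      rw [mem_vanishingIdeal_iff] at hf ⊢
      intro w hw
      exact hS₀' f (Filter.mem_of_superset hS₁ fun w hw => hf w hw) w hw.1)
    hkV (M := d * n) (fun i => ⟨⟨_, k i, rfl⟩, iterateFrobenius_def ..⟩)
  have hl (i : σ) : ∃ l : L, l ^ p ^ (d * (n - N)) = k i := by
    obtain ⟨⟨_, l, rfl⟩, hl⟩ := hkE i
    refine ⟨l, iterateFrobenius_inj L p (d * N) ?_⟩
    rw [iterateFrobenius_def, iterateFrobenius_def, ← hl, ← pow_mul, ← pow_add, ← mul_add,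
      Nat.sub_add_cancel hn]
    exact (iterateFrobenius_def ..).symm
  choose l hl using hl
  refine ⟨l, fun i => ⟨n - N, ?_⟩, funext hl⟩
  rw [iterate_specialTphi_eval_sepPart, hl, Nat.add_sub_cancel' hn]
  exact hk0 i
end Core

section Cosets

lemma exists_finite_cover_iterate {M : Type*} [AddCommGroup M] (T : M →+ M) {Γ R : Set M}
    (hR : R.Finite) (h : ∀ x ∈ Γ, ∃ r ∈ R, ∃ y ∈ Γ, x = r + T y) (n : ℕ) :
    ∃ R' : Set M, R'.Finite ∧ ∀ x ∈ Γ, ∃ r ∈ R', ∃ y ∈ Γ, x = r + T^[n] y := by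
  induction n with
  | zero => exact ⟨{0}, Set.finite_singleton 0, fun x hx => ⟨0, rfl, x, hx, by simp⟩⟩
  | succ n ih =>
    obtain ⟨R', hR', h'⟩ := ih
    refine ⟨Set.image2 (fun r s => r + T^[n] s) R' R, hR'.image2 _ hR, fun x hx => ?_⟩
    obtain ⟨r, hr, y, hy, rfl⟩ := h' x hx
    obtain ⟨s, hs, z, hz, rfl⟩ := h y hy
    exact ⟨_, Set.mem_image2_of_mem hr hs, z, hz, by
      rw [iterate_map_add, Function.iterate_succ_apply, add_assoc]⟩

lemma specialTphi_add {L : Type*} [Field L] (p : ℕ) [Fact p.Prime] [CharP L p] (d D : ℕ)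
    (c : ℕ → L) (x y : L) :
    specialTphi p d D c (x + y) = specialTphi p d D c x + specialTphi p d D c y := by
  simp [specialTphi, add_pow_char_pow, mul_add, Finset.sum_add_distrib]

lemma map_iterate_specialTphi {K L : Type*} [Field K] [Field L] (f : K →+* L) (p d D : ℕ)
    (c : ℕ → K) (n : ℕ) (x : K) :
    f ((specialTphi p d D c)^[n] x) = (specialTphi p d D fun i => f (c i))^[n] (f x) :=
  Function.Semiconj.iterate_right (f := f) (fun x => by simp [specialTphi]) n x

lemma exists_finite_cover_of_isPhiFG {K : Type*} [Field K] (p : ℕ) [Fact p.Prime] [CharP K p]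
    {d D : ℕ} {c : ℕ → K} {g : ℕ} {Γ : AddSubgroup (Fin g → K)}
    (hfg : IsPhiFG (specialTphi p d D c) Γ) (n : ℕ) :
    ∃ R : Set (Fin g → K), R.Finite ∧ ∀ x ∈ Γ, ∃ r ∈ R, ∃ y : Fin g → K,
      x = fun i => r i + (specialTphi p d D c)^[n] (y i) := by
  obtain ⟨hΓ, s, hs, hmin⟩ := hfg
  let T : (Fin g → K) →+ (Fin g → K) := AddMonoidHom.mk' (fun y i => specialTphi p d D c (y i))
    fun x y => funext fun i => specialTphi_add p d D c (x i) (y i)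
  let G := AddSubgroup.closure (s : Set (Fin g → K))
  have hGΓ : G ≤ Γ := (AddSubgroup.closure_le Γ).2 hs
  have hG : (G : Set (Fin g → K)).Finite := by
    have : Finite G := AddCommGroup.finite_of_fg_isAddTorsion G fun x => by
      rw [isOfFinAddOrder_iff_nsmul_eq_zero]
      refine ⟨p, (Fact.out : p.Prime).pos, Subtype.ext (funext fun i => ?_)⟩
      simp
    exact Set.toFinite _
  have hle : Γ ≤ G ⊔ Γ.map T := by
    refine hmin _ ?_ fun x hx => AddSubgroup.mem_sup_left (AddSubgroup.subset_closure hx)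
    intro y hy
    have hyΓ : y ∈ Γ := by
      refine sup_le hGΓ ?_ hy
      rintro _ ⟨z, hz, rfl⟩
      exact hΓ z hz
    exact AddSubgroup.mem_sup_right ⟨y, hyΓ, rfl⟩
  obtain ⟨R, hR, h⟩ := exists_finite_cover_iterate T (Γ := Γ) hG (fun x hx => by
    obtain ⟨r, hr, _, ⟨y, hy, rfl⟩, rfl⟩ := AddSubgroup.mem_sup.1 (hle hx)
    exact ⟨r, hr, y, hy, rfl⟩) n
  refine ⟨R, hR, fun x hx => ?_⟩
  obtain ⟨r, hr, y, -, rfl⟩ := h x hx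
  refine ⟨r, hr, y, funext fun i => ?_⟩
  have hT : Function.Semiconj (fun z : Fin g → K => z i) T (specialTphi p d D c) := fun z => rfl
  exact congrArg (r i + ·) (hT.iterate_right n y)

lemma lt_of_posModularTransc {K : Type*} [Field K] (p : ℕ) [Fact p.Prime] [CharP K p]
    {d D : ℕ} (hd : 1 ≤ d) (hdD : d ≤ D) {c : ℕ → K} (hcd : c d ≠ 0)
    (hmod : PosModularTransc p d D c) : d < D := by
  classical
  have : CharP (AlgebraicClosure K) p :=
    charP_of_injective_algebraMap (algebraMap K (AlgebraicClosure K)).injective p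
  refine lt_of_le_of_ne hdD ?_
  rintro rfl
  refine hmod ?_
  have hq : 1 < p ^ d := Nat.one_lt_pow (by omega) (Fact.out : p.Prime).one_lt
  set c' := algebraMap K (AlgebraicClosure K) (c d) with hc'
  have hc0 : c' ≠ 0 := by simpa [hc'] using hcd
  obtain ⟨γ, hγ⟩ := IsAlgClosed.exists_pow_nat_eq (c'⁻¹) (n := p ^ d - 1) (by omega)
  have hγ0 : γ ≠ 0 := by
    rintro rfl
    rw [zero_pow (by omega)] at hγ
    exact inv_ne_zero hc0 hγ.symm
  refine ⟨γ, hγ0, fun j => ?_⟩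
  have h1 : γ⁻¹ * (c' * γ ^ p ^ d) = 1 := by
    have : γ ^ p ^ d = γ ^ (p ^ d - 1) * γ := by rw [← pow_succ, Nat.sub_add_cancel hq.le]
    rw [this, hγ]
    field_simp
  have h2 : (Polynomial.C γ⁻¹ * ((∑ i ∈ Finset.Icc d d,
      Polynomial.C (algebraMap K (AlgebraicClosure K) (c i)) * Polynomial.X ^ (p ^ i)).comp
        (Polynomial.C γ * Polynomial.X))) = Polynomial.X ^ p ^ d := by
    simp only [Finset.Icc_self, Finset.sum_singleton, Polynomial.mul_comp, Polynomial.C_comp,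
      Polynomial.X_pow_comp, mul_pow, ← Polynomial.C_pow, ← mul_assoc, ← Polynomial.C_mul]
    rw [← hc', mul_assoc, h1, Polynomial.C_1, one_mul]
  rw [h2, Polynomial.coeff_X_pow]
  split_ifs
  · exact ⟨Polynomial.X - 1, Polynomial.X_sub_C_ne_zero 1, by simp⟩
  · exact ⟨Polynomial.X, Polynomial.X_ne_zero, by simp⟩
end Cosets

end DrinfeldML

/-- Let `φ` be a Drinfeld module of special characteristic over `K` with
positive modular transcendence degree and `Φ[t^∞](K^sep)` finite, let `Γ ⊆ K^g` be a
finitely generated `Φ(R)`-submodule, and let `V` be a Zariski-closed subset of affine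
`g`-space over `K` whose `K̄`-points contain no translate of an infinite Zariski-closed
additive subgroup of `K̄^g`.  Then `V(K) ∩ Γ` is finite. -/
theorem stmt13 {K : Type*} [Field K] (p : ℕ) [Fact p.Prime] [CharP K p]
    (d D : ℕ) (hd : 1 ≤ d) (hdD : d ≤ D) (c : ℕ → K)
    (hcd : c d ≠ 0) (hcD : c D ≠ 0)
    (hmod : PosModularTransc p d D c)
    -- `Φ[t^∞](K^sep)` is finite:
    (htor : {x : AlgebraicClosure K | x ∈ separableClosure K (AlgebraicClosure K) ∧
      ∃ n : ℕ, (specialTphi p d D (fun i => algebraMap K (AlgebraicClosure K) (c i)))^[n] x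
        = 0}.Finite)
    (g : ℕ) (hg : 1 ≤ g) (Γ : AddSubgroup (Fin g → K))
    (hfg : IsPhiFG (specialTphi p d D c) Γ)
    (I : Ideal (MvPolynomial (Fin g) K))
    -- `V(K̄)` contains no translate of an infinite Zariski-closed additive subgroup:
    (hV : ¬ ∃ (a : Fin g → AlgebraicClosure K)
        (H : AddSubgroup (Fin g → AlgebraicClosure K)),
      (H : Set (Fin g → AlgebraicClosure K)).Infinite ∧
      (∃ J : Ideal (MvPolynomial (Fin g) (AlgebraicClosure K)),
        (H : Set (Fin g → AlgebraicClosure K)) =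
          zeroLocusVia J (RingHom.id (AlgebraicClosure K))) ∧
      (fun h => a + h) '' (H : Set (Fin g → AlgebraicClosure K)) ⊆
        zeroLocusVia I (algebraMap K (AlgebraicClosure K))) :
    (zeroLocusVia I (RingHom.id K) ∩ (Γ : Set (Fin g → K))).Finite := by
  classical
  have hdD' := DrinfeldML.lt_of_posModularTransc p hd hdD hcd hmod
  let C := AlgebraicClosure K
  let L := separableClosure K C
  have : IsSepClosed L := (separableClosure.isSepClosure K C).sep_closed
  have : CharP C p := charP_of_injective_algebraMap (algebraMap K C).injective p
  have : CharP L p := charP_of_injective_algebraMap (algebraMap K L).injective p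
  by_contra hinf
  let ι : (Fin g → K) → Fin g → L := fun x i => algebraMap K L (x i)
  have hι : Function.Injective ι := fun x y h =>
    funext fun i => (algebraMap K L).injective (congrFun h i)
  have hT : {x : L | ∃ n, (specialTphi p d D fun i => algebraMap K L (c i))^[n] x = 0}.Finite := by
    refine (htor.preimage (f := algebraMap L C) (algebraMap L C).injective.injOn).subset ?_
    rintro x ⟨n, hx⟩
    refine ⟨x.2, n, ?_⟩
    have := DrinfeldML.map_iterate_specialTphi (algebraMap L C) p d D
      (fun i => algebraMap K L (c i)) n x
    rw [hx, map_zero] at this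
    exact this.symm
  obtain ⟨W, hWW, ⟨w, hw⟩, hW⟩ := DrinfeldML.exists_infinite_shifts (C := C) p hd hdD'
    (c := fun i => algebraMap K L (c i)) (by simpa using hcd) (by simpa using hcD) hT
    (Set.Infinite.image hι.injOn hinf) (fun n => by
      obtain ⟨R, hR, h⟩ := DrinfeldML.exists_finite_cover_of_isPhiFG p hfg n
      refine ⟨ι '' R, hR.image ι, ?_⟩
      rintro _ ⟨x, hx, rfl⟩
      obtain ⟨r, hr, y, rfl⟩ := h x hx.2
      refine ⟨ι r, ⟨r, hr, rfl⟩, ι y, funext fun i => ?_⟩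
      rw [← DrinfeldML.map_iterate_specialTphi, ← map_add])
  refine hV ⟨fun i => algebraMap L C (w i), DrinfeldML.shiftGroup C p W, hW,
    ⟨DrinfeldML.shiftIdeal C W, ?_⟩, ?_⟩
  · ext z
    exact (DrinfeldML.forall_mem_shiftIdeal_iff W z).symm
  · rintro _ ⟨z, hz, rfl⟩ q hq
    have hq' : MvPolynomial.map (algebraMap K L) q ∈ MvPolynomial.vanishingIdeal L W := by
      rw [MvPolynomial.mem_vanishingIdeal_iff]
      intro w hw
      obtain ⟨x, hx, rfl⟩ := hWW hw
      rw [MvPolynomial.aeval_map_algebraMap]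
      have h := MvPolynomial.aeval_algebraMap_apply L x q
      refine h.trans ?_
      rw [MvPolynomial.aeval_def, Algebra.algebraMap_self, hx.1 q hq, map_zero]
    have h := hz _ hq' w hw
    rwa [MvPolynomial.aeval_map_algebraMap] at h
end
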